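/- arXiv:math/9909169 — 3 statements merged into one kernel-verified Lean document; each statement's English description precedes it below -/
import Mathlib

section
/- Suppose the probabilities are not all equal, i.e. the largest value p₁ occurs with multiplicity k₁ < k (so k₁ p₁ < 1). Then for every real s, Prob(ℓ_N ≤ N p₁ + s√(N p₁)) converges as N → ∞ to the ratio I(s)/I(∞), where I(s) = ∫_{(−∞,s]^{k₁}} Δ(ξ)² exp(−½[Σ_{i=1}^{k₁} ξ_i² + (p₁/(1−k₁p₁)) (Σ_{i=1}^{k₁} ξ_i)²]) dξ₁⋯dξ_{k₁}, I(∞) is the same integral over all of ℝ^{k₁}, and Δ(ξ) = ∏_{1≤i<j≤k₁}(ξ_i − ξ_j). -/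
open MeasureTheory Filter
open scoped Classical

noncomputable section

/-- Length of the longest weakly increasing subsequence of the word `w`. -/
def lisLen {k N : ℕ} (w : Fin N → Fin k) : ℕ :=
  (Finset.univ.filter fun s : Finset (Fin N) =>
    ∀ i ∈ s, ∀ j ∈ s, i ≤ j → w i ≤ w j).sup Finset.card

/-- Probability of the event `E` of words of length `N` under the i.i.d. measure
in which letter `i` has probability `p i`. -/
def wordProb (k N : ℕ) (p : Fin k → ℝ) (E : Set (Fin N → Fin k)) : ℝ :=
  ∑ w : Fin N → Fin k, E.indicator (fun w => ∏ i, p (w i)) w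

/-- `T` is a semistandard Young tableau of shape `l` with entries in `{0,...,k-1}`. -/
def IsSSYT (k : ℕ) (l : Fin k → ℕ) (T : Fin k × ℕ → ℕ) : Prop :=
  (∀ (i : Fin k) (j1 j2 : ℕ), j1 ≤ j2 → j2 < l i → T (i, j1) ≤ T (i, j2)) ∧
  (∀ (i1 i2 : Fin k) (j : ℕ), i1 < i2 → j < l i2 → T (i1, j) < T (i2, j)) ∧
  (∀ (i : Fin k) (j : ℕ), j < l i → T (i, j) < k) ∧
  (∀ (i : Fin k) (j : ℕ), l i ≤ j → T (i, j) = 0)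

/-- The Schur polynomial `s_l(x)`, as the generating function of SSYT of shape `l`. -/
def schur (k : ℕ) (l : Fin k → ℕ) (x : Fin k → ℝ) : ℝ :=
  ∑ᶠ T ∈ {T | IsSSYT k l T}, ∏ v : Fin k,
    x v ^ ({c : Fin k × ℕ | c.2 < l c.1 ∧ T c = (v : ℕ)}.ncard)

/-- `T` is a standard Young tableau of shape `l ⊢ N` (entries `0,...,N-1`, each once). -/
def IsSYT (k N : ℕ) (l : Fin k → ℕ) (T : Fin k × ℕ → ℕ) : Prop :=
  (∀ (i : Fin k) (j1 j2 : ℕ), j1 < j2 → j2 < l i → T (i, j1) < T (i, j2)) ∧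
  (∀ (i1 i2 : Fin k) (j : ℕ), i1 < i2 → j < l i2 → T (i1, j) < T (i2, j)) ∧
  (∀ (i : Fin k) (j : ℕ), l i ≤ j → T (i, j) = 0) ∧
  Set.BijOn T {c : Fin k × ℕ | c.2 < l c.1} (Set.Iio N)

/-- `f^l`: the number of standard Young tableaux of shape `l ⊢ N`. -/
def sytCount (k N : ℕ) (l : Fin k → ℕ) : ℕ := {T | IsSYT k N l T}.ncard

/-- The multinomial probability of the outcome `l` in `N` trials. -/
def multProb (k N : ℕ) (p : Fin k → ℝ) (l : Fin k → ℕ) : ℝ :=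
  ((N.factorial : ℝ) / ∏ i, ((l i).factorial : ℝ)) * ∏ i, p i ^ l i

/-- The mean of `lisLen` over random words of length `N`. -/
def wordMean (k N : ℕ) (p : Fin k → ℝ) : ℝ :=
  ∑ w : Fin N → Fin k, (∏ i, p (w i)) * (lisLen w : ℝ)

/-- The variance of `lisLen` over random words of length `N`. -/
def wordVar (k N : ℕ) (p : Fin k → ℝ) : ℝ :=
  ∑ w : Fin N → Fin k, (∏ i, p (w i)) * ((lisLen w : ℝ) - wordMean k N p) ^ 2

/-- Append the letter `a` to the word `w`. -/
def wsnoc {k N : ℕ} (w : Fin N → Fin k) (a : Fin k) : Fin (N + 1) → Fin k :=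
  Fin.snoc (α := fun _ => Fin k) w a

@[simp] lemma wsnoc_castSucc {k N : ℕ} (w : Fin N → Fin k) (a : Fin k) (i : Fin N) :
    wsnoc w a i.castSucc = w i := by simp [wsnoc]

@[simp] lemma wsnoc_last {k N : ℕ} (w : Fin N → Fin k) (a : Fin k) :
    wsnoc w a (Fin.last N) = a := by simp [wsnoc]

/-- The expectation of `φ` over words of length `N` with i.i.d. letters of law `p`. -/
def wordExp {k : ℕ} (p : Fin k → ℝ) (N : ℕ) (φ : (Fin N → Fin k) → ℝ) : ℝ :=
  ∑ w, (∏ i, p (w i)) * φ w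

section wordExp

variable {k : ℕ} {p : Fin k → ℝ} {N : ℕ}

lemma wordExp_zero (φ : (Fin 0 → Fin k) → ℝ) : wordExp p 0 φ = φ Fin.elim0 := by
  simp only [wordExp, Finset.univ_unique, Finset.sum_singleton, Finset.univ_eq_empty,
    Finset.prod_empty, one_mul]
  exact congrArg φ (Subsingleton.elim _ _)

lemma wordExp_succ (φ : (Fin (N + 1) → Fin k) → ℝ) :
    wordExp p (N + 1) φ = ∑ a, p a * wordExp p N (fun w => φ (wsnoc w a)) := by
  simp only [wordExp, Finset.mul_sum]
  rw [← Fintype.sum_prod_type'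
    (f := fun (a : Fin k) (w : Fin N → Fin k) => p a * ((∏ i, p (w i)) * φ (wsnoc w a)))]
  symm
  apply Fintype.sum_equiv (Fin.snocEquiv (fun _ : Fin (N + 1) => Fin k))
  rintro ⟨a, w⟩
  have : Fin.snocEquiv (fun _ : Fin (N + 1) => Fin k) (a, w) = wsnoc w a := rfl
  rw [this, Fin.prod_univ_castSucc]
  simp only [wsnoc_castSucc, wsnoc_last]
  ring

lemma wordExp_add (φ ψ : (Fin N → Fin k) → ℝ) :
    wordExp p N (fun w => φ w + ψ w) = wordExp p N φ + wordExp p N ψ := by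
  simp only [wordExp, mul_add, Finset.sum_add_distrib]

lemma wordExp_sub (φ ψ : (Fin N → Fin k) → ℝ) :
    wordExp p N (fun w => φ w - ψ w) = wordExp p N φ - wordExp p N ψ := by
  simp only [wordExp, mul_sub, Finset.sum_sub_distrib]

lemma wordExp_const_mul (c : ℝ) (φ : (Fin N → Fin k) → ℝ) :
    wordExp p N (fun w => c * φ w) = c * wordExp p N φ := by
  simp only [wordExp, Finset.mul_sum]
  exact Finset.sum_congr rfl fun _ _ => by ring

lemma wordExp_sum {ι : Type*} (t : Finset ι) (φ : ι → (Fin N → Fin k) → ℝ) :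
    wordExp p N (fun w => ∑ i ∈ t, φ i w) = ∑ i ∈ t, wordExp p N (φ i) := by
  simp only [wordExp, Finset.mul_sum]
  exact Finset.sum_comm

lemma wordExp_mono (hp : ∀ i, 0 ≤ p i) {φ ψ : (Fin N → Fin k) → ℝ} (h : ∀ w, φ w ≤ ψ w) :
    wordExp p N φ ≤ wordExp p N ψ :=
  Finset.sum_le_sum fun w _ =>
    mul_le_mul_of_nonneg_left (h w) (Finset.prod_nonneg fun i _ => hp (w i))

lemma wordExp_prod (f : Fin k → ℝ) :
    wordExp p N (fun w => ∏ i, f (w i)) = (∑ a, p a * f a) ^ N := by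
  induction N with
  | zero => simp [wordExp_zero]
  | succ N ih =>
    rw [wordExp_succ, pow_succ', Finset.sum_mul]
    refine Finset.sum_congr rfl fun a _ => ?_
    simp_rw [Fin.prod_univ_castSucc, wsnoc_castSucc, wsnoc_last, mul_comm _ (f a)]
    rw [wordExp_const_mul, ih]
    ring

lemma wordExp_const (hsum : ∑ i, p i = 1) (c : ℝ) : wordExp p N (fun _ => c) = c := by
  have h := wordExp_prod (p := p) (N := N) (fun _ => 1)
  simp only [Finset.prod_const_one, mul_one, hsum, one_pow] at h
  have := wordExp_const_mul (p := p) (N := N) c (fun _ => 1)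
  simpa [h] using this

lemma wordProb_eq_wordExp (E : Set (Fin N → Fin k)) :
    wordProb k N p E = wordExp p N (fun w => if w ∈ E then 1 else 0) := by
  simp only [wordProb, wordExp, Set.indicator_apply]
  exact Finset.sum_congr rfl fun w _ => by split_ifs <;> simp

end wordExp

/-- The length of the longest weakly increasing subsequence of `w` using letters `≤ j` only. -/
def lisTo {k N : ℕ} (j : ℕ) (w : Fin N → Fin k) : ℕ :=
  (Finset.univ.filter fun s : Finset (Fin N) =>
    (∀ i ∈ s, (w i : ℕ) ≤ j) ∧ ∀ i ∈ s, ∀ i' ∈ s, i ≤ i' → w i ≤ w i').sup Finset.card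

section lisTo

variable {k N : ℕ}

lemma card_le_lisTo {j : ℕ} {w : Fin N → Fin k} {s : Finset (Fin N)}
    (h1 : ∀ i ∈ s, (w i : ℕ) ≤ j) (h2 : ∀ i ∈ s, ∀ i' ∈ s, i ≤ i' → w i ≤ w i') :
    s.card ≤ lisTo j w :=
  Finset.le_sup (f := Finset.card) (by simp only [Finset.mem_filter_univ]; exact ⟨h1, h2⟩)

lemma exists_card_eq_lisTo (j : ℕ) (w : Fin N → Fin k) :
    ∃ s : Finset (Fin N), (∀ i ∈ s, (w i : ℕ) ≤ j) ∧
      (∀ i ∈ s, ∀ i' ∈ s, i ≤ i' → w i ≤ w i') ∧ s.card = lisTo j w := by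
  obtain ⟨s, hs, h⟩ := Finset.exists_mem_eq_sup (Finset.univ.filter fun s : Finset (Fin N) =>
    (∀ i ∈ s, (w i : ℕ) ≤ j) ∧ ∀ i ∈ s, ∀ i' ∈ s, i ≤ i' → w i ≤ w i') ⟨∅, by simp⟩ Finset.card
  rw [Finset.mem_filter_univ] at hs
  exact ⟨s, hs.1, hs.2, h.symm⟩

lemma lisTo_le_iff {j n : ℕ} {w : Fin N → Fin k} :
    lisTo j w ≤ n ↔ ∀ s : Finset (Fin N), (∀ i ∈ s, (w i : ℕ) ≤ j) →
      (∀ i ∈ s, ∀ i' ∈ s, i ≤ i' → w i ≤ w i') → s.card ≤ n := by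
  constructor
  · intro h s h1 h2
    exact (card_le_lisTo h1 h2).trans h
  · intro h
    obtain ⟨s, h1, h2, h3⟩ := exists_card_eq_lisTo j w
    exact h3 ▸ h s h1 h2

lemma lisTo_mono {j j' : ℕ} (h : j ≤ j') (w : Fin N → Fin k) : lisTo j w ≤ lisTo j' w :=
  lisTo_le_iff.2 fun _ h1 h2 => card_le_lisTo (fun i hi => (h1 i hi).trans h) h2

lemma lisLen_eq_lisTo (w : Fin N → Fin k) : lisLen w = lisTo (k - 1) w := by
  unfold lisLen lisTo
  congr 1
  ext s
  simp only [Finset.mem_filter_univ]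
  exact ⟨fun h => ⟨fun i _ => by omega, h⟩, fun h => h.2⟩

lemma lisTo_length_zero (j : ℕ) (w : Fin 0 → Fin k) : lisTo j w = 0 := by
  refine Nat.le_zero.1 (lisTo_le_iff.2 fun s _ _ => ?_)
  simp [Finset.eq_empty_of_isEmpty s]

lemma lisTo_wsnoc (j : ℕ) (w : Fin N → Fin k) (a : Fin k) :
    lisTo j (wsnoc w a) = if (a : ℕ) ≤ j then max (lisTo j w) (lisTo a w + 1) else lisTo j w := by
  have key : ∀ (s : Finset (Fin (N + 1))), ∃ t : Finset (Fin N),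
      (∀ i, i ∈ t ↔ i.castSucc ∈ s) ∧
      (Fin.last N ∉ s → s.card = t.card) ∧ (Fin.last N ∈ s → s.card = t.card + 1) := by
    intro s
    refine ⟨Finset.univ.filter fun i => i.castSucc ∈ s, by simp, ?_⟩
    have hc : s.card = (Finset.univ.filter fun i : Fin N => i.castSucc ∈ s).card +
        if Fin.last N ∈ s then 1 else 0 := by
      rw [Finset.card_filter, ← Fin.sum_univ_castSucc (f := fun i => if i ∈ s then 1 else 0)]
      simp
    constructor <;> intro h <;> simpa [h] using hc
  have low : lisTo j w ≤ lisTo j (wsnoc w a) := by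
    refine lisTo_le_iff.2 fun s h1 h2 => ?_
    rw [← Finset.card_map Fin.castSuccEmb]
    apply card_le_lisTo
    · simpa using h1
    · simp only [Finset.mem_map, Fin.coe_castSuccEmb, forall_exists_index, and_imp,
        forall_apply_eq_imp_iff₂, wsnoc_castSucc, Fin.castSucc_le_castSucc_iff]
      exact h2
  have up : ∀ s : Finset (Fin (N + 1)), (∀ i ∈ s, (wsnoc w a i : ℕ) ≤ j) →
      (∀ i ∈ s, ∀ i' ∈ s, i ≤ i' → wsnoc w a i ≤ wsnoc w a i') → Fin.last N ∉ s →
      s.card ≤ lisTo j w := by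
    intro s h1 h2 h3
    obtain ⟨t, ht, hc, -⟩ := key s
    rw [hc h3]
    apply card_le_lisTo
    · intro i hi
      simpa using h1 _ ((ht i).1 hi)
    · intro i hi i' hi' hle
      simpa using h2 _ ((ht i).1 hi) _ ((ht i').1 hi') (by simpa using hle)
  split_ifs with haj
  · apply le_antisymm
    · refine lisTo_le_iff.2 fun s h1 h2 => ?_
      by_cases hl : Fin.last N ∈ s
      · obtain ⟨t, ht, -, hc⟩ := key s
        rw [hc hl]
        refine le_max_of_le_right (Nat.succ_le_succ (card_le_lisTo ?_ ?_))
        · intro i hi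
          have := h2 _ ((ht i).1 hi) _ hl (Fin.le_last _)
          simpa using this
        · intro i hi i' hi' hle
          simpa using h2 _ ((ht i).1 hi) _ ((ht i').1 hi') (by simpa using hle)
      · exact le_max_of_le_left (up s h1 h2 hl)
    · refine max_le low ?_
      obtain ⟨s, h1, h2, h3⟩ := exists_card_eq_lisTo (a : ℕ) w
      rw [← h3, ← Finset.card_map Fin.castSuccEmb,
        ← Finset.card_insert_of_notMem (a := Fin.last N) (by simp)]
      apply card_le_lisTo
      · intro i hi
        rcases Fin.eq_castSucc_or_eq_last i with ⟨i, rfl⟩ | rfl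
        · have : i ∈ s := by simpa using hi
          simpa using (h1 i this).trans haj
        · simpa using haj
      · intro i hi i' hi' hle
        rcases Fin.eq_castSucc_or_eq_last i with ⟨i, rfl⟩ | rfl
        · have his : i ∈ s := by simpa using hi
          rcases Fin.eq_castSucc_or_eq_last i' with ⟨i', rfl⟩ | rfl
          · have his' : i' ∈ s := by simpa using hi'
            simpa using h2 i his i' his' (by simpa using hle)
          · simpa using h1 i his
        · rw [Fin.last_le_iff.1 hle]
  · refine le_antisymm (lisTo_le_iff.2 fun s h1 h2 => up s h1 h2 fun hl => haj ?_) low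
    simpa using h1 _ hl

lemma lisTo_le_lisLen (j : ℕ) (w : Fin N → Fin k) : lisTo j w ≤ lisLen w := by
  rw [lisLen_eq_lisTo]
  exact lisTo_le_iff.2 fun _ _ h2 => card_le_lisTo (fun i _ => by omega) h2

end lisTo

lemma eq_wsnoc {k N : ℕ} (w : Fin (N + 1) → Fin k) :
    w = wsnoc (fun i => w i.castSucc) (w (Fin.last N)) := by
  ext i
  rcases Fin.eq_castSucc_or_eq_last i with ⟨i, rfl⟩ | rfl <;> simp

/-- The largest value, over all suffixes of the word, of the number of letters `j` minus the
number of letters `a`. -/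
def drawup {k : ℕ} (a j : ℕ) : {N : ℕ} → (Fin N → Fin k) → ℕ
  | 0, _ => 0
  | N + 1, w =>
    let u := drawup a j fun i => w i.castSucc
    if (w (Fin.last N) : ℕ) = j then u + 1 else if (w (Fin.last N) : ℕ) = a then u - 1 else u

/-- The running maximum of `drawup`. -/
def maxDrawup {k : ℕ} (a j : ℕ) : {N : ℕ} → (Fin N → Fin k) → ℕ
  | 0, _ => 0
  | _ + 1, w => max (maxDrawup a j fun i => w i.castSucc) (drawup a j w)

/-- The maximum over all splittings of `w` into a prefix and a suffix of `lisTo j` of the prefix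
plus the number of letters `a` in the suffix. -/
def lisSplit {k : ℕ} (a j : ℕ) : {N : ℕ} → (Fin N → Fin k) → ℕ
  | 0, _ => 0
  | N + 1, w =>
    max ((lisSplit a j fun i => w i.castSucc) + if (w (Fin.last N) : ℕ) = a then 1 else 0)
      (lisTo j w)

section reduction

variable {k N : ℕ} {a j : ℕ}

lemma drawup_wsnoc (w : Fin N → Fin k) (i : Fin k) : drawup a j (wsnoc w i) =
    if (i : ℕ) = j then drawup a j w + 1 else if (i : ℕ) = a then drawup a j w - 1
      else drawup a j w := by
  simp [drawup]

lemma maxDrawup_wsnoc (w : Fin N → Fin k) (i : Fin k) : maxDrawup a j (wsnoc w i) =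
    max (maxDrawup a j w) (drawup a j (wsnoc w i)) := by
  simp [maxDrawup]

lemma lisSplit_wsnoc (w : Fin N → Fin k) (i : Fin k) : lisSplit a j (wsnoc w i) =
    max (lisSplit a j w + if (i : ℕ) = a then 1 else 0) (lisTo j (wsnoc w i)) := by
  simp [lisSplit]

lemma drawup_le_maxDrawup (w : Fin N → Fin k) : drawup a j w ≤ maxDrawup a j w := by
  cases N with
  | zero => simp [drawup]
  | succ N => simp [maxDrawup]

lemma lisTo_le_lisSplit (w : Fin N → Fin k) : lisTo j w ≤ lisSplit a j w := by
  cases N with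
  | zero => simp [lisTo_length_zero]
  | succ N => simp [lisSplit]

lemma lisSplit_self (w : Fin N → Fin k) : lisSplit a a w = lisTo a w := by
  induction N with
  | zero => simp [lisTo_length_zero, lisSplit]
  | succ N ih =>
    rw [eq_wsnoc w, lisSplit_wsnoc, ih, lisTo_wsnoc]
    split_ifs with h1 h2 <;> first | omega | skip
    rw [h1]; omega

lemma lisTo_le_lisSplit_add_drawup (haj : a < j) (w : Fin N → Fin k) :
    lisTo j w ≤ lisSplit a (j - 1) w + drawup a j w := by
  induction N with
  | zero => simp [lisTo_length_zero]
  | succ N ih =>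
    rw [eq_wsnoc w]
    generalize w (Fin.last N) = i
    specialize ih fun i => w i.castSucc
    generalize (fun i : Fin N => w i.castSucc) = v at *
    have h1 := lisSplit_wsnoc (a := a) (j := j - 1) v i
    have h2 := drawup_wsnoc (a := a) (j := j) v i
    have h3 := lisTo_wsnoc j v i
    have h4 := lisTo_wsnoc (j - 1) v i
    have h5 : lisTo a v ≤ lisSplit a (j - 1) v :=
      (lisTo_mono (by omega) v).trans (lisTo_le_lisSplit v)
    by_cases hij : (i : ℕ) = j
    · rw [hij] at h1 h2 h3 h4
      simp only [le_refl, if_true] at h2 h3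
      split_ifs at * <;> omega
    · by_cases hia : (i : ℕ) = a
      · rw [hia] at h1 h2 h3 h4
        split_ifs at * <;> omega
      · split_ifs at * <;> omega

lemma lisSplit_le_add_maxDrawup (haj : a < j) (w : Fin N → Fin k) :
    lisSplit a j w ≤ lisSplit a (j - 1) w + maxDrawup a j w := by
  induction N with
  | zero => simp [lisSplit]
  | succ N ih =>
    have h0 := lisTo_le_lisSplit_add_drawup haj w
    have h0' := drawup_le_maxDrawup (a := a) (j := j) w
    rw [eq_wsnoc w] at h0 h0' ⊢
    generalize w (Fin.last N) = i at *
    specialize ih fun i => w i.castSucc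
    generalize (fun i : Fin N => w i.castSucc) = v at *
    have h1 := lisSplit_wsnoc (a := a) (j := j - 1) v i
    have h2 := lisSplit_wsnoc (a := a) (j := j) v i
    have h3 := maxDrawup_wsnoc (a := a) (j := j) v i
    omega

lemma lisLen_le_lisTo_add (ha : a < k) (w : Fin N → Fin k) :
    lisLen w ≤ lisTo a w + ∑ j ∈ Finset.Ioc a (k - 1), maxDrawup a j w := by
  have key : ∀ j, a ≤ j → lisSplit a j w ≤ lisTo a w + ∑ j ∈ Finset.Ioc a j, maxDrawup a j w := by
    intro j hj
    induction j, hj using Nat.le_induction with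
    | base => simp [lisSplit_self]
    | succ j hj ih =>
      have := lisSplit_le_add_maxDrawup (a := a) (j := j + 1) (by omega) w
      rw [← Finset.insert_Ioc_right_eq_Ioc_add_one hj, Finset.sum_insert (by simp)]
      simp only [add_tsub_cancel_right] at this
      omega
  rw [lisLen_eq_lisTo]
  exact (lisTo_le_lisSplit w).trans (key _ (by omega))

variable {p : Fin k → ℝ}

lemma wordExp_pow_drawup_le (hp : ∀ i, 0 < p i) (hsum : ∑ i, p i = 1) {a j : Fin k}
    (h : p j < p a) (N : ℕ) :
    wordExp p N (fun w => (p a / p j) ^ drawup a j w) ≤ N + 1 := by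
  set ρ := p a / p j with hρ
  have hja : j ≠ a := by rintro rfl; exact lt_irrefl _ h
  have hρ1 : 1 ≤ ρ := (one_le_div (hp j)).2 h.le
  have hρ0 : 0 < ρ := by positivity
  induction N with
  | zero => simp [wordExp_zero, drawup]
  | succ N ih =>
    rw [wordExp_succ]
    have hstep : ∀ i : Fin k, wordExp p N (fun w => ρ ^ drawup a j (wsnoc w i)) ≤
        (1 + (if i = j then ρ - 1 else 0) + (if i = a then ρ⁻¹ - 1 else 0)) *
          wordExp p N (fun w => ρ ^ drawup a j w) + if i = a then 1 else 0 := by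
      intro i
      have : ∀ c : ℝ, wordExp p N (fun _ => c) = c := wordExp_const hsum
      rw [← wordExp_const_mul, ← this (if i = a then 1 else 0), ← wordExp_add]
      refine wordExp_mono (fun i => (hp i).le) fun w => ?_
      rw [drawup_wsnoc]
      simp only [← Fin.ext_iff]
      by_cases hij : i = j
      · simp [hij, hja, pow_succ']
      · by_cases hia : i = a
        · simp only [hia, if_true, hja.symm, if_false]
          rcases Nat.eq_zero_or_pos (drawup a j w) with h0 | h0
          · simp [h0, hρ0.le]
          · obtain ⟨u, hu⟩ : ∃ u, drawup (a : ℕ) (j : ℕ) w = u + 1 :=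
              ⟨_, (Nat.sub_add_cancel h0).symm⟩
            rw [hu, add_tsub_cancel_right, pow_succ]
            field_simp
            linarith
        · simp [hij, hia]
    calc _ ≤ ∑ i, p i * ((1 + (if i = j then ρ - 1 else 0) + (if i = a then ρ⁻¹ - 1 else 0)) *
          wordExp p N (fun w => ρ ^ drawup a j w) + if i = a then 1 else 0) :=
          Finset.sum_le_sum fun i _ => mul_le_mul_of_nonneg_left (hstep i) (hp i).le
      _ = (1 + p j * (ρ - 1) + p a * (ρ⁻¹ - 1)) * wordExp p N (fun w => ρ ^ drawup a j w)
          + p a := by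
          simp only [mul_add, add_mul, Finset.sum_add_distrib, ← mul_assoc, mul_ite, ite_mul,
            mul_zero, zero_mul, mul_one, Finset.sum_ite_eq', Finset.mem_univ, if_true,
            ← Finset.sum_mul, hsum]
      _ = wordExp p N (fun w => ρ ^ drawup a j w) + p a := by
          have : 1 + p j * (ρ - 1) + p a * (ρ⁻¹ - 1) = 1 := by
            have := (hp j).ne'
            have := (hp a).ne'
            rw [hρ]; field_simp; ring
          rw [this, one_mul]
      _ ≤ _ := by
          have : p a ≤ 1 := hsum ▸ Finset.single_le_sum (fun i _ => (hp i).le) (Finset.mem_univ a)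
          push_cast
          linarith

lemma wordExp_pow_maxDrawup_le (hp : ∀ i, 0 < p i) (hsum : ∑ i, p i = 1) {a j : Fin k}
    (h : p j < p a) (N : ℕ) :
    wordExp p N (fun w => (p a / p j) ^ maxDrawup a j w) ≤ (N + 1) ^ 2 := by
  induction N with
  | zero => simp [wordExp_zero, maxDrawup]
  | succ N ih =>
    have h2 := wordExp_pow_drawup_le hp hsum h (N + 1)
    have hρ : 0 < p a / p j := div_pos (hp a) (hp j)
    have h3 : wordExp p (N + 1) (fun w => (p a / p j) ^ maxDrawup a j w) ≤
        wordExp p (N + 1) (fun w => (p a / p j) ^ (maxDrawup (a : ℕ) j fun i => w i.castSucc) +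
          (p a / p j) ^ drawup a j w) := by
      refine wordExp_mono (fun i => (hp i).le) fun w => ?_
      rw [maxDrawup]
      rcases max_choice (maxDrawup (a : ℕ) j fun i => w i.castSucc) (drawup (a : ℕ) j w) with h | h <;>
        rw [h] <;> nlinarith [pow_pos hρ (maxDrawup (a : ℕ) j fun i => w i.castSucc),
          pow_pos hρ (drawup (a : ℕ) j w)]
    have h4 : wordExp p (N + 1) (fun w => (p a / p j) ^ (maxDrawup (a : ℕ) j fun i => w i.castSucc))
        = wordExp p N (fun w => (p a / p j) ^ maxDrawup a j w) := by
      rw [wordExp_succ]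
      simp only [wsnoc_castSucc, ← Finset.sum_mul, hsum, one_mul]
    rw [wordExp_add, h4] at h3
    push_cast at h2 ⊢
    nlinarith

lemma wordExp_maxDrawup_gt_le (hp : ∀ i, 0 < p i) (hsum : ∑ i, p i = 1) {a j : Fin k}
    (h : p j < p a) (N : ℕ) (x : ℝ) :
    wordExp p N (fun w => if x < maxDrawup a j w then 1 else 0) ≤
      (N + 1) ^ 2 * Real.exp (-(Real.log (p a / p j) * x)) := by
  have hρ : 0 < p a / p j := div_pos (hp a) (hp j)
  have hl : 0 < Real.log (p a / p j) := Real.log_pos ((one_lt_div (hp j)).2 h)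
  refine le_trans ?_ (mul_le_mul_of_nonneg_right (wordExp_pow_maxDrawup_le hp hsum h N)
    (Real.exp_pos _).le)
  rw [mul_comm, ← wordExp_const_mul]
  refine wordExp_mono (fun i => (hp i).le) fun w => ?_
  split_ifs with hx
  · nth_rw 2 [← Real.exp_log hρ]
    rw [← Real.exp_nat_mul, ← Real.exp_add]
    apply Real.one_le_exp
    nlinarith
  · positivity

lemma tendsto_wordExp_lisLen_sub_lisTo (hp : ∀ i, 0 < p i) (hsum : ∑ i, p i = 1) (a : Fin k)
    (h : ∀ j, a < j → p j < p a) {ε : ℝ} (hε : 0 < ε) :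
    Tendsto (fun N : ℕ => wordExp p N
      (fun w => if (lisTo a w : ℝ) + ε * Real.sqrt N < lisLen w then 1 else 0)) atTop (nhds 0) := by
  have hk : (0 : ℝ) < k := by exact_mod_cast a.pos
  have hbound : ∀ N : ℕ, wordExp p N
      (fun w => if (lisTo a w : ℝ) + ε * Real.sqrt N < lisLen w then 1 else 0) ≤
      ∑ j ∈ Finset.univ.filter (fun j => a < j), ((N : ℝ) + 1) ^ 2 *
        Real.exp (-(Real.log (p a / p j) * (ε / k * Real.sqrt N))) := by
    intro N
    refine le_trans ?_ (Finset.sum_le_sum fun j hj =>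
      wordExp_maxDrawup_gt_le hp hsum (h j (by simpa using hj)) N _)
    rw [← wordExp_sum]
    refine wordExp_mono (fun i => (hp i).le) fun w => ?_
    split_ifs with hw
    · by_contra! hlt
      have hall : ∀ j ∈ Finset.univ.filter (fun j => a < j),
          (maxDrawup a j w : ℝ) ≤ ε / k * Real.sqrt N := by
        intro j hj
        by_contra! hjx
        refine absurd hlt (not_lt.2 ?_)
        refine le_trans (by simp [hjx]) (Finset.single_le_sum (f := fun j : Fin k =>
          if ε / k * Real.sqrt N < (maxDrawup a j w : ℝ) then (1 : ℝ) else 0)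
          (fun i _ => by split_ifs <;> simp) hj)
      have h1 := lisLen_le_lisTo_add a.2 w
      have h2 : ∑ j ∈ Finset.Ioc (a : ℕ) (k - 1), maxDrawup a j w =
          ∑ j ∈ Finset.univ.filter (fun j => a < j), maxDrawup a j w := by
        refine (Finset.sum_bij (fun (j : Fin k) _ => (j : ℕ)) ?_ ?_ ?_ ?_).symm
        · intro j hj
          simp only [Finset.mem_filter_univ, Fin.lt_def] at hj
          simp only [Finset.mem_Ioc]
          omega
        · intro _ _ _ _ h
          exact Fin.ext h
        · intro j hj
          simp only [Finset.mem_Ioc] at hj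
          exact ⟨⟨j, by omega⟩, (Finset.mem_filter_univ _).2 hj.1, rfl⟩
        · simp
      have h3 : ((∑ j ∈ Finset.univ.filter (fun j => a < j), maxDrawup a j w : ℕ) : ℝ) ≤
          ε * Real.sqrt N := by
        push_cast
        refine (Finset.sum_le_card_nsmul _ _ _ hall).trans ?_
        rw [nsmul_eq_mul]
        have : ((Finset.univ.filter (fun j => a < j)).card : ℝ) ≤ k := by
          exact_mod_cast (Finset.card_le_univ _).trans (by simp)
        calc _ ≤ (k : ℝ) * (ε / k * Real.sqrt N) :=
              mul_le_mul_of_nonneg_right this (by positivity)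
          _ = _ := by field_simp
      rw [h2] at h1
      have h4 : (lisLen w : ℝ) ≤ lisTo a w +
        (∑ j ∈ Finset.univ.filter (fun j => a < j), maxDrawup a j w : ℕ) := by exact_mod_cast h1
      linarith
    · exact Finset.sum_nonneg fun i _ => by split_ifs <;> simp
  refine squeeze_zero (fun N => ?_) hbound ?_
  · exact Finset.sum_nonneg fun w _ => mul_nonneg (Finset.prod_nonneg fun i _ => (hp _).le)
      (by dsimp only; split_ifs <;> simp)
  · rw [← Finset.sum_const_zero (s := Finset.univ.filter (fun j => a < j))]
    refine tendsto_finsetSum _ fun j hj => ?_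
    have hl : 0 < Real.log (p a / p j) :=
      Real.log_pos ((one_lt_div (hp j)).2 (h j (by simpa using hj)))
    set c := Real.log (p a / p j) * (ε / k) with hc
    have hc0 : 0 < c := by positivity
    have key : Tendsto (fun x : ℝ => (x ^ 2 + 1) ^ 2 * Real.exp (-(c * x))) atTop (nhds 0) := by
      have h4 := Real.tendsto_pow_mul_exp_neg_atTop_nhds_zero 4
      have h2 := Real.tendsto_pow_mul_exp_neg_atTop_nhds_zero 2
      have h0 := Real.tendsto_pow_mul_exp_neg_atTop_nhds_zero 0
      have := ((h4.const_mul (c⁻¹ ^ 4)).add ((h2.const_mul (2 * c⁻¹ ^ 2)).add h0)).comp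
        (tendsto_id.const_mul_atTop hc0)
      simp only [mul_zero, add_zero] at this
      refine this.congr fun x => ?_
      simp only [Function.comp_apply, id]
      field_simp
      ring
    refine (key.comp (Real.tendsto_sqrt_atTop.comp tendsto_natCast_atTop_atTop)).congr fun N => ?_
    simp only [Function.comp_apply]
    rw [Real.sq_sqrt (Nat.cast_nonneg N), hc, mul_assoc]

end reduction

/-- The integer vectors interlacing with `h`. -/
def interlacing {m : ℕ} (h : Fin (m + 1) → ℤ) : Finset (Fin m → ℤ) :=
  Fintype.piFinset fun i => Finset.Ico (h i.succ) (h i.castSucc)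

lemma mem_interlacing {m : ℕ} {h : Fin (m + 1) → ℤ} {μ : Fin m → ℤ} :
    μ ∈ interlacing h ↔ ∀ i, h i.succ ≤ μ i ∧ μ i < h i.castSucc := by
  simp [interlacing, Fintype.mem_piFinset]

lemma strictAnti_of_mem_interlacing {m : ℕ} {h : Fin (m + 1) → ℤ} {μ : Fin m → ℤ}
    (hμ : μ ∈ interlacing h) : StrictAnti μ := by
  rw [mem_interlacing] at hμ
  cases m with
  | zero => exact Subsingleton.strictAnti _
  | succ m =>
    rw [Fin.strictAnti_iff_succ_lt]
    intro i
    have h1 := (hμ i.castSucc).1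
    have h2 := (hμ i.succ).2
    rw [Fin.succ_castSucc] at h1
    exact h2.trans_le h1

/-- The sum of `φ` over the Gelfand-Tsetlin patterns with bottom row `h` in strict coordinates,
evaluated at the edge consisting of the first parts of the rows. -/
def gtSum : (m : ℕ) → (Fin m → ℤ) → ((Fin m → ℤ) → ℝ) → ℝ
  | 0, _, φ => φ 0
  | m + 1, h, φ => ∑ μ ∈ interlacing h,
      gtSum m μ fun x => φ (Fin.snoc (α := fun _ => ℤ) x (h 0 - m))

/-- The effect of the letter `i` on the vector of lengths of longest weakly increasing
subsequences. -/
def push {m : ℕ} (i : Fin m) (x : Fin m → ℤ) : Fin m → ℤ :=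
  fun j => if j < i then x j else max (x j) (x i + 1)

lemma gtSum_congr {m : ℕ} {h : Fin (m + 1) → ℤ} {φ ψ : (Fin (m + 1) → ℤ) → ℝ}
    (H : ∀ x, x (Fin.last m) = h 0 - m → φ x = ψ x) : gtSum (m + 1) h φ = gtSum (m + 1) h ψ := by
  simp only [gtSum]
  refine Finset.sum_congr rfl fun μ _ => ?_
  congr 1
  ext x
  exact H _ (by simp)

lemma gtSum_eq_zero {m : ℕ} {h : Fin m → ℤ} (hh : ¬ StrictAnti h) (φ : (Fin m → ℤ) → ℝ) :
    gtSum m h φ = 0 := by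
  cases m with
  | zero => exact absurd (Subsingleton.strictAnti _) hh
  | succ m =>
    rw [gtSum, Finset.sum_eq_zero]
    intro μ hμ
    refine absurd ?_ hh
    rw [mem_interlacing] at hμ
    rw [Fin.strictAnti_iff_succ_lt]
    exact fun i => (hμ i).1.trans_lt (hμ i).2

lemma gtSum_const_mul {m : ℕ} (h : Fin m → ℤ) (c : ℝ) (φ : (Fin m → ℤ) → ℝ) :
    gtSum m h (fun x => c * φ x) = c * gtSum m h φ := by
  induction m with
  | zero => simp [gtSum]
  | succ m ih => simp only [gtSum, Finset.mul_sum, ih]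

lemma push_castSucc_snoc {m : ℕ} (i : Fin m) (x : Fin m → ℤ) (a : ℤ) :
    push i.castSucc (Fin.snoc (α := fun _ => ℤ) x a) =
      Fin.snoc (α := fun _ => ℤ) (push i x) (max a (x i + 1)) := by
  ext j
  rcases Fin.eq_castSucc_or_eq_last j with ⟨j, rfl⟩ | rfl
  · simp [push]
  · simp [push, (Fin.castSucc_lt_last i).le]

lemma push_last_snoc {m : ℕ} (x : Fin m → ℤ) (a : ℤ) :
    push (Fin.last m) (Fin.snoc (α := fun _ => ℤ) x a) =
      Fin.snoc (α := fun _ => ℤ) x (a + 1) := by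
  ext j
  rcases Fin.eq_castSucc_or_eq_last j with ⟨j, rfl⟩ | rfl
  · simp [push, Fin.castSucc_lt_last]
  · simp [push]

lemma ite_eq_ite_add_ite {P Q R : Prop} [Decidable P] [Decidable Q] [Decidable R]
    (e : P ↔ Q ∨ R) (d : ¬ (Q ∧ R)) :
    (if P then (1 : ℝ) else 0) = (if Q then 1 else 0) + if R then 1 else 0 := by
  by_cases hQ : Q <;> by_cases hR : R <;> simp_all

lemma card_interlacing_moves {n : ℕ} {h : Fin (n + 2) → ℤ} (hh : StrictAnti h)
    {μ : Fin (n + 1) → ℤ} (hμ : StrictAnti μ) (h0 : μ 0 < h 0) :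
    (∑ r, if μ - Pi.single r 1 ∈ interlacing h then (1 : ℝ) else 0) =
      ∑ r : Fin (n + 1), if μ ∈ interlacing (h + Pi.single r.succ 1) then (1 : ℝ) else 0 := by
  have hlt : ∀ i : Fin (n + 1), h i.succ < h i.castSucc := Fin.strictAnti_iff_succ_lt.1 hh
  have hμlt : ∀ i : Fin n, μ i.succ < μ i.castSucc := Fin.strictAnti_iff_succ_lt.1 hμ
  set Q : Fin (n + 1) → Prop := fun i => h i.succ ≤ μ i ∧ μ i < h i.castSucc with hQ
  set A : Fin (n + 1) → Prop := fun r => (∀ i, i ≠ r → Q i) ∧ h r.succ + 1 ≤ μ r ∧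
    μ r < h r.castSucc with hA
  set C : Fin (n + 1) → Prop := fun r => (∀ i, i ≠ r → Q i) ∧ μ r = h r.castSucc with hC
  have h1 : ∀ r, (if μ - Pi.single r 1 ∈ interlacing h then (1 : ℝ) else 0) =
      (if A r then 1 else 0) + if C r then 1 else 0 := by
    intro r
    have e : μ - Pi.single r 1 ∈ interlacing h ↔ A r ∨ C r := by
      rw [mem_interlacing, hA, hC, ← and_or_left]
      constructor
      · intro H
        refine ⟨fun i hi => by simpa [hi] using H i, ?_⟩
        have := H r
        simp only [Pi.sub_apply, Pi.single_eq_same] at this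
        omega
      · rintro ⟨H1, H2⟩ i
        by_cases hi : i = r
        · subst hi
          have := hlt i
          simp only [Pi.sub_apply, Pi.single_eq_same]
          omega
        · simpa [hi] using H1 i hi
    have d : ¬ (A r ∧ C r) := by
      rintro ⟨⟨-, -, h1⟩, -, h2⟩
      omega
    exact ite_eq_ite_add_ite e d
  have h2 : ∀ s : Fin n,
      (if μ ∈ interlacing (h + Pi.single s.castSucc.succ 1) then (1 : ℝ) else 0) =
      (if A s.castSucc then 1 else 0) + if C s.succ then 1 else 0 := by
    intro s
    have hs : s.succ ≠ s.castSucc := (Fin.castSucc_lt_succ).ne'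
    have e : μ ∈ interlacing (h + Pi.single s.castSucc.succ 1) ↔ A s.castSucc ∨ C s.succ := by
      rw [mem_interlacing]
      have hs1 := hμlt s
      have hs2 := hlt s.succ
      have hs3 := hlt s.castSucc
      rw [Fin.succ_castSucc] at hs3 ⊢
      constructor
      · intro H
        have H1 : ∀ i, i ≠ s.castSucc → i ≠ s.succ → Q i := by
          intro i hi1 hi2
          have := H i
          rw [Pi.add_apply, Pi.add_apply, Pi.single_eq_of_ne, Pi.single_eq_of_ne] at this
          · simpa using this
          · intro h'; exact hi2 (Fin.castSucc_injective _ h')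
          · rw [← Fin.succ_castSucc]; intro h'; exact hi1 (Fin.succ_injective _ h')
        have H2 := H s.castSucc
        have H3 := H s.succ
        rw [Fin.succ_castSucc, Pi.add_apply, Pi.add_apply, Pi.single_eq_same,
          Pi.single_eq_of_ne ((Fin.castSucc_injective _).ne hs.symm)] at H2
        rw [Pi.add_apply, Pi.add_apply, Pi.single_eq_same, Pi.single_eq_of_ne (by
          rw [← Fin.succ_castSucc]; simpa using hs)] at H3
        by_cases hc : μ s.succ = h s.succ.castSucc
        · right
          refine ⟨fun i hi => ?_, hc⟩
          by_cases hi' : i = s.castSucc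
          · subst hi'
            exact ⟨by rw [Fin.succ_castSucc]; omega, by omega⟩
          · exact H1 i hi' hi
        · left
          refine ⟨fun i hi => ?_, by rw [Fin.succ_castSucc]; omega, by omega⟩
          by_cases hi' : i = s.succ
          · subst hi'
            exact ⟨by omega, by omega⟩
          · exact H1 i hi hi'
      · intro H
        have H1 : ∀ i, i ≠ s.castSucc → i ≠ s.succ → Q i := fun i hi1 hi2 =>
          H.elim (fun H => H.1 i hi1) (fun H => H.1 i hi2)
        have H2 : h s.succ.castSucc + 1 ≤ μ s.castSucc ∧ μ s.castSucc < h s.castSucc.castSucc := by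
          rcases H with H | H
          · have := H.2; rwa [Fin.succ_castSucc] at this
          · have := H.1 _ hs.symm
            have := H.2
            simp only [hQ] at *
            omega
        have H3 : h s.succ.succ ≤ μ s.succ ∧ μ s.succ < h s.succ.castSucc + 1 := by
          rcases H with H | H
          · have := H.1 _ hs
            simp only [hQ] at this
            omega
          · have := H.2
            omega
        intro i
        by_cases hi1 : i = s.castSucc
        · subst hi1
          rw [Fin.succ_castSucc, Pi.add_apply, Pi.add_apply, Pi.single_eq_same,
            Pi.single_eq_of_ne ((Fin.castSucc_injective _).ne hs.symm)]
          omega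
        · by_cases hi2 : i = s.succ
          · subst hi2
            rw [Pi.add_apply, Pi.add_apply, Pi.single_eq_same, Pi.single_eq_of_ne (by
              rw [← Fin.succ_castSucc]; simpa using hs)]
            omega
          · rw [Pi.add_apply, Pi.add_apply, Pi.single_eq_of_ne, Pi.single_eq_of_ne]
            · simpa using H1 i hi1 hi2
            · intro h'; exact hi2 (Fin.castSucc_injective _ h')
            · rw [← Fin.succ_castSucc]; intro h'; exact hi1 (Fin.succ_injective _ h')
    have d : ¬ (A s.castSucc ∧ C s.succ) := by
      rintro ⟨h1, -, h2⟩
      have := (h1.1 _ hs).2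
      omega
    exact ite_eq_ite_add_ite e d
  have h3 : (if μ ∈ interlacing (h + Pi.single (Fin.last n).succ 1) then (1 : ℝ) else 0) =
      if A (Fin.last n) then 1 else 0 := by
    have e : μ ∈ interlacing (h + Pi.single (Fin.last n).succ 1) ↔ A (Fin.last n) := by
      rw [mem_interlacing]
      have hc : ∀ i : Fin (n + 1),
          (h + Pi.single (M := fun _ => ℤ) (Fin.last n).succ 1) i.castSucc = h i.castSucc := by
        intro i
        rw [Pi.add_apply, Pi.single_eq_of_ne, add_zero]
        rw [Fin.succ_last]
        exact (Fin.castSucc_lt_last i).ne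
      have hs : ∀ i : Fin (n + 1), i ≠ Fin.last n →
          (h + Pi.single (M := fun _ => ℤ) (Fin.last n).succ 1) i.succ = h i.succ := by
        intro i hi
        rw [Pi.add_apply, Pi.single_eq_of_ne, add_zero]
        simpa using hi
      have hl : (h + Pi.single (M := fun _ => ℤ) (Fin.last n).succ 1) (Fin.last n).succ =
          h (Fin.last n).succ + 1 := by simp
      constructor
      · intro H
        refine ⟨fun i hi => ?_, ?_⟩
        · have := H i
          rwa [hc, hs i hi] at this
        · have := H (Fin.last n)
          rwa [hc, hl] at this
      · intro H i
        by_cases hi : i = Fin.last n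
        · subst hi
          rw [hc, hl]
          exact H.2
        · rw [hc, hs i hi]
          exact H.1 i hi
    simp only [e]
  have hC0 : ¬ C 0 := fun H => h0.ne H.2
  conv_rhs => rw [Fin.sum_univ_castSucc]
  simp only [h1, h2, h3, Finset.sum_add_distrib]
  rw [Fin.sum_univ_castSucc (f := fun r => if A r then (1 : ℝ) else 0),
    Fin.sum_univ_succ (f := fun r => if C r then (1 : ℝ) else 0), if_neg hC0]
  ring

lemma sum_comp_add_eq_sum_ite {G : Type*} [AddCommGroup G] {s B : Finset G} {e : G}
    (hs : ∀ x ∈ s, x + e ∈ B) (f : G → ℝ) :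
    ∑ x ∈ s, f (x + e) = ∑ y ∈ B, if y - e ∈ s then f y else 0 := by
  have h : ∑ y ∈ B, (if y - e ∈ s then f y else 0) = ∑ y ∈ B.filter (fun y => y - e ∈ s), f y :=
    (Finset.sum_filter _ _).symm
  rw [h]
  refine Finset.sum_nbij' (· + e) (· - e) (fun x hx => ?_) (fun y hy => ?_) (fun x _ => by simp)
    (fun y _ => by simp) (fun x _ => rfl)
  · rw [Finset.mem_filter]
    exact ⟨hs x hx, by simpa using hx⟩
  · exact (Finset.mem_filter.1 hy).2

lemma sum_interlacing_moves {n : ℕ} {h : Fin (n + 2) → ℤ} (hh : StrictAnti h)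
    {F : (Fin (n + 1) → ℤ) → ℤ → ℝ} (hF : ∀ μ a, ¬ StrictAnti μ → F μ a = 0) :
    ∑ μ ∈ interlacing h, ((∑ r, F (μ + Pi.single r 1)
        (max (h 0) ((μ + Pi.single r 1 : Fin (n + 1) → ℤ) 0 + 1))) + F μ (h 0 + 1)) =
      ∑ r : Fin (n + 2), ∑ μ ∈ interlacing (h + Pi.single r 1),
        F μ ((h + Pi.single r 1 : Fin (n + 2) → ℤ) 0) := by
  set B : Finset (Fin (n + 1) → ℤ) := interlacing h ∪
    (Finset.univ.biUnion fun r : Fin (n + 1) => (interlacing h).image (· + Pi.single r 1)) ∪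
    (Finset.univ.biUnion fun r : Fin (n + 2) => interlacing (h + Pi.single r 1)) with hB
  have hB1 : ∀ μ ∈ interlacing h, μ + 0 ∈ B := by
    intro μ hμ
    simp only [hB, Finset.mem_union, add_zero]
    exact Or.inl (Or.inl hμ)
  have hB2 : ∀ r : Fin (n + 1), ∀ μ ∈ interlacing h, μ + Pi.single r 1 ∈ B := by
    intro r μ hμ
    simp only [hB, Finset.mem_union, Finset.mem_biUnion, Finset.mem_image]
    exact Or.inl (Or.inr ⟨r, Finset.mem_univ _, μ, hμ, rfl⟩)
  have hB3 : ∀ r : Fin (n + 2), ∀ μ ∈ interlacing (h + Pi.single r 1), μ + 0 ∈ B := by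
    intro r μ hμ
    simp only [hB, Finset.mem_union, Finset.mem_biUnion, add_zero]
    exact Or.inr ⟨r, Finset.mem_univ _, hμ⟩
  rw [Finset.sum_add_distrib, Finset.sum_comm]
  have e1 : ∀ r : Fin (n + 1), _ := fun r => sum_comp_add_eq_sum_ite (hB2 r)
    (fun μ => F μ (max (h 0) (μ 0 + 1)))
  have e2 := sum_comp_add_eq_sum_ite hB1 (fun μ => F μ (h 0 + 1))
  have e3 : ∀ r : Fin (n + 2), _ := fun r => sum_comp_add_eq_sum_ite (hB3 r)
    (fun μ => F μ ((h + Pi.single r 1 : Fin (n + 2) → ℤ) 0))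
  simp only [add_zero, sub_zero] at e2 e3
  rw [Finset.sum_congr rfl fun r _ => e1 r, e2, Finset.sum_congr rfl fun r _ => e3 r,
    Finset.sum_comm, Finset.sum_comm (s := (Finset.univ : Finset (Fin (n + 2)))),
    ← Finset.sum_add_distrib]
  refine Finset.sum_congr rfl fun μ _ => ?_
  by_cases hμ : StrictAnti μ
  swap
  · simp [hF μ _ hμ]
  rw [Fin.sum_univ_succ (n := n + 1)]
  have hsucc : ∀ r : Fin (n + 1), (h + Pi.single r.succ 1 : Fin (n + 2) → ℤ) 0 = h 0 := by
    intro r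
    simp [(Fin.succ_ne_zero r).symm]
  have hzero : (h + Pi.single 0 1 : Fin (n + 2) → ℤ) 0 = h 0 + 1 := by simp
  simp only [hsucc, hzero]
  by_cases h0 : μ 0 < h 0
  · have hm : max (h 0) (μ 0 + 1) = h 0 := by omega
    have hiff : μ ∈ interlacing h ↔ μ ∈ interlacing (h + Pi.single 0 1) := by
      simp only [mem_interlacing, Fin.forall_fin_succ (n := n)]
      simp
      intros
      omega
    have hc := card_interlacing_moves hh hμ h0
    rw [hm, add_comm]
    simp only [hiff]
    congr 1
    have := congrArg (· * F μ (h 0)) hc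
    simp only [Finset.sum_mul, ite_mul, one_mul, zero_mul] at this
    convert this
  · have hm : max (h 0) (μ 0 + 1) = μ 0 + 1 := by omega
    have h1 : ∀ r : Fin (n + 1), r ≠ 0 → μ - Pi.single r 1 ∉ interlacing h := by
      intro r hr H
      have := ((mem_interlacing.1 H) 0).2
      simp [hr.symm] at this
      omega
    have h2 : μ ∉ interlacing h := fun H => h0 (by simpa using ((mem_interlacing.1 H) 0).2)
    have h3 : ∀ r : Fin (n + 1), μ ∉ interlacing (h + Pi.single r.succ 1) := by
      intro r H
      have := ((mem_interlacing.1 H) 0).2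
      simp only [Fin.castSucc_zero, hsucc] at this
      omega
    have h4 : μ - Pi.single 0 1 ∈ interlacing h ↔ μ ∈ interlacing (h + Pi.single 0 1) := by
      have h01 : h (Fin.succ 0) < h 0 := hh (Fin.succ_pos 0)
      simp only [mem_interlacing, Fin.forall_fin_succ (n := n)]
      simp at h01 ⊢
      intros
      omega
    rw [Fin.sum_univ_succ]
    simp only [h1 _ (Fin.succ_ne_zero _), h2, h3, h4, if_false, Finset.sum_const_zero, add_zero, hm]
    split_ifs with H
    · have := ((mem_interlacing.1 H) 0).2
      simp only [Fin.castSucc_zero, hzero] at this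
      rw [show μ 0 = h 0 by omega]
    · rfl

lemma sum_gtSum_push {m : ℕ} {h : Fin m → ℤ} (hh : StrictAnti h) (φ : (Fin m → ℤ) → ℝ) :
    ∑ i, gtSum m h (fun x => φ (push i x)) = ∑ r, gtSum m (h + Pi.single r 1) φ := by
  induction m with
  | zero => simp
  | succ m ih =>
    cases m with
    | zero =>
      have e : ∀ h : Fin 1 → ℤ, interlacing h = {0} := by
        intro h
        ext μ
        simp [mem_interlacing, eq_iff_true_of_subsingleton]
      simp only [gtSum, e, Finset.sum_singleton, Pi.add_apply]
      rw [Fin.sum_univ_castSucc, Fin.sum_univ_castSucc, Finset.univ_eq_empty, Finset.sum_empty,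
        Finset.sum_empty, zero_add (φ _), zero_add (φ _)]
      have := push_last_snoc (m := 0) 0 (h 0 - (0 : ℕ))
      have e3 : (Pi.single (M := fun _ => ℤ) (Fin.last 0) 1 : Fin 1 → ℤ) 0 = 1 := rfl
      rw [this, e3]
      congr 1
      simp
    | succ n =>
      set F : (Fin (n + 1) → ℤ) → ℤ → ℝ := fun μ a =>
        gtSum (n + 1) μ (fun y => φ (Fin.snoc (α := fun _ => ℤ) y (a - (n + 1 : ℕ)))) with hFdef
      have hF : ∀ μ a, ¬ StrictAnti μ → F μ a = 0 := fun μ a hμ => gtSum_eq_zero hμ _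
      have key := sum_interlacing_moves hh hF
      have hR : ∀ r : Fin (n + 2), gtSum (n + 2) (h + Pi.single r 1) φ =
        ∑ μ ∈ interlacing (h + Pi.single r 1),
          F μ ((h + Pi.single r 1 : Fin (n + 2) → ℤ) 0) := fun r => rfl
      simp only [hR]
      rw [← key, Fin.sum_univ_castSucc]
      have hL : ∀ ψ, gtSum (n + 2) h ψ = ∑ μ ∈ interlacing h, gtSum (n + 1) μ
        (fun x => ψ (Fin.snoc (α := fun _ => ℤ) x (h 0 - (n + 1 : ℕ)))) := fun ψ => rfl
      simp only [hL, Finset.sum_add_distrib]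
      congr 1
      · rw [Finset.sum_comm]
        refine Finset.sum_congr rfl fun μ hμ => ?_
        have hμs := strictAnti_of_mem_interlacing hμ
        have h0 : μ 0 < h 0 := by simpa using ((mem_interlacing.1 hμ) 0).2
        set a : ℤ := h 0 - (n + 1 : ℕ) with ha
        have := ih hμs (fun y => φ (Fin.snoc (α := fun _ => ℤ) y (max a (y (Fin.last n)))))
        calc _ = ∑ i, gtSum (n + 1) μ (fun x => φ (Fin.snoc (α := fun _ => ℤ) (push i x)
              (max a (push i x (Fin.last n))))) := by
              refine Finset.sum_congr rfl fun i _ => gtSum_congr fun x hx => ?_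
              rw [push_castSucc_snoc]
              congr 2
              simp only [push, if_neg (Fin.le_last i).not_gt]
              push_cast at *
              omega
          _ = _ := this
          _ = _ := by
              refine Finset.sum_congr rfl fun i _ => gtSum_congr fun x hx => ?_
              rw [hx]
              congr 2
              push_cast at *
              omega
      · refine Finset.sum_congr rfl fun μ hμ => ?_
        simp only [hFdef]
        congr 1
        ext x
        rw [push_last_snoc]
        congr 2
        push_cast
        ring

/-- The Vandermonde determinant of an integer vector. -/
def vand {m : ℕ} (h : Fin m → ℤ) : ℝ := (Matrix.vandermonde fun i => (h i : ℝ)).det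

lemma vand_eq_det_descPochhammer {m : ℕ} (h : Fin m → ℤ) :
    vand h = (Matrix.of fun i j : Fin m => (descPochhammer ℝ j).eval (h i : ℝ)).det :=
  Matrix.det_eval_matrixOfPolynomials_eq_det_vandermonde _ (fun j : Fin m => descPochhammer ℝ j)
    (fun i => descPochhammer_natDegree ℝ i) (fun i => monic_descPochhammer ℝ i)

lemma descPochhammer_eval_add_one (n : ℕ) (x : ℝ) :
    (descPochhammer ℝ (n + 1)).eval (x + 1) =
      (descPochhammer ℝ (n + 1)).eval x + (n + 1) * (descPochhammer ℝ n).eval x := by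
  have := congrArg (Polynomial.eval (x + 1)) (descPochhammer_succ_comp_X_sub_one ℝ n)
  simp [Polynomial.eval_comp] at this
  linarith

lemma sum_Ico_descPochhammer (n : ℕ) {a b : ℤ} (hab : a ≤ b) :
    (n + 1) * ∑ x ∈ Finset.Ico a b, (descPochhammer ℝ n).eval (x : ℝ) =
      (descPochhammer ℝ (n + 1)).eval (b : ℝ) - (descPochhammer ℝ (n + 1)).eval (a : ℝ) := by
  induction b, hab using Int.leInduction with
  | base => simp
  | succ b hab ih =>
    have e : Finset.Ico a (b + 1) = insert b (Finset.Ico a b) := by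
      ext x
      simp
      omega
    rw [e, Finset.sum_insert (by simp), mul_add, ih]
    push_cast
    rw [descPochhammer_eval_add_one]
    ring

lemma sum_interlacing_vand {m : ℕ} {h : Fin (m + 1) → ℤ} (hh : StrictAnti h) :
    vand h = (∏ j : Fin m, -((j : ℝ) + 1)) * ∑ μ ∈ interlacing h, vand μ := by
  have h1 : ∑ μ ∈ interlacing h, vand μ = (Matrix.of fun i j : Fin m =>
      ∑ x ∈ Finset.Ico (h i.succ) (h i.castSucc), (descPochhammer ℝ j).eval (x : ℝ)).det := by
    have := (Matrix.detRowAlternating (n := Fin m) (R := ℝ)).toMultilinearMap.map_sum_finset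
      (fun (i : Fin m) (x : ℤ) (j : Fin m) => (descPochhammer ℝ j).eval (x : ℝ))
      (fun i => Finset.Ico (h i.succ) (h i.castSucc))
    simp only [vand_eq_det_descPochhammer]
    refine Eq.trans this.symm ?_
    change Matrix.det _ = _
    congr 1
    ext i j
    simp
  rw [h1, ← Matrix.det_mul_row, vand_eq_det_descPochhammer]
  set B : Matrix (Fin (m + 1)) (Fin (m + 1)) ℝ := fun i j =>
    Fin.cases ((descPochhammer ℝ j).eval (h 0 : ℝ)) (fun i' : Fin m =>
      (descPochhammer ℝ j).eval (h i'.succ : ℝ) - (descPochhammer ℝ j).eval (h i'.castSucc : ℝ)) i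
    with hB
  have hAB : (Matrix.of fun i j : Fin (m + 1) => (descPochhammer ℝ j).eval (h i : ℝ)).det = B.det :=
    Matrix.det_eq_of_forall_row_eq_smul_add_pred (fun _ => 1) (fun j => rfl)
      (fun i j => by simp [hB])
  rw [hAB, Matrix.det_succ_column_zero, Fin.sum_univ_succ]
  have h0 : B 0 0 = 1 := by simp [hB]
  have hs : ∀ i : Fin m, B i.succ 0 = 0 := fun i => by simp [hB]
  simp only [h0, hs, Fin.val_zero, pow_zero, mul_one, one_mul, mul_zero, zero_mul,
    Finset.sum_const_zero, add_zero]
  congr 1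
  ext i j
  have hi : h i.succ ≤ h i.castSucc := hh.antitone (Fin.castSucc_lt_succ).le
  have := sum_Ico_descPochhammer j hi
  have hBs : B.submatrix (Fin.succAbove 0) Fin.succ i j =
      (descPochhammer ℝ (j + 1)).eval (h i.succ : ℝ) -
        (descPochhammer ℝ (j + 1)).eval (h i.castSucc : ℝ) := by
    rw [Matrix.submatrix_apply, Fin.zero_succAbove]
    rfl
  rw [hBs]
  simp only [Matrix.of_apply]
  linarith

lemma exists_gtSum_one_eq (m : ℕ) : ∃ c : ℝ, c ≠ 0 ∧ ∀ h : Fin m → ℤ, StrictAnti h →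
    gtSum m h (fun _ => 1) = c * vand h := by
  induction m with
  | zero => exact ⟨1, one_ne_zero, fun h _ => by simp [gtSum, vand]⟩
  | succ m ih =>
    obtain ⟨c, hc, H⟩ := ih
    have hd : (∏ j : Fin m, -((j : ℝ) + 1)) ≠ 0 :=
      Finset.prod_ne_zero_iff.2 fun j _ => neg_ne_zero.2 (Nat.cast_add_one_ne_zero _)
    refine ⟨c / ∏ j : Fin m, -((j : ℝ) + 1), div_ne_zero hc hd, fun h hh => ?_⟩
    rw [sum_interlacing_vand hh, gtSum, Finset.sum_congr rfl fun μ hμ =>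
      H μ (strictAnti_of_mem_interlacing hμ), ← Finset.mul_sum]
    field_simp

lemma sum_mul_vand_sub_single {m : ℕ} (h : Fin m → ℤ) :
    ∑ r, (h r : ℝ) * vand (h - Pi.single r 1) =
      (∑ r, (h r : ℝ) - ∑ i : Fin m, (i : ℝ)) * vand h := by
  simp only [vand_eq_det_descPochhammer, Matrix.det_apply', Finset.mul_sum]
  rw [Finset.sum_comm]
  refine Finset.sum_congr rfl fun σ _ => ?_
  have key : ∀ r, (h r : ℝ) * (((Equiv.Perm.sign σ : ℤ) : ℝ) * ∏ i, (Matrix.of fun i j : Fin m =>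
      (descPochhammer ℝ j).eval (((h - Pi.single r 1 : Fin m → ℤ) i : ℤ) : ℝ)) (σ i) i) =
      (h r - (σ.symm r : ℝ)) * (((Equiv.Perm.sign σ : ℤ) : ℝ) * ∏ i, (Matrix.of fun i j : Fin m =>
        (descPochhammer ℝ j).eval (h i : ℝ)) (σ i) i) := by
    intro r
    have hP : ∀ (j : ℕ) (x : ℝ), x * (descPochhammer ℝ j).eval (x - 1) =
        (x - j) * (descPochhammer ℝ j).eval x := by
      intro j x
      rw [mul_comm (x - j), ← descPochhammer_succ_eval, descPochhammer_succ_left]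
      simp [Polynomial.eval_comp]
    rw [← Finset.mul_prod_erase _ _ (Finset.mem_univ (σ.symm r)),
      ← Finset.mul_prod_erase Finset.univ (fun i => (Matrix.of fun i j : Fin m =>
        (descPochhammer ℝ j).eval (h i : ℝ)) (σ i) i) (Finset.mem_univ (σ.symm r))]
    have e : ∏ i ∈ Finset.univ.erase (σ.symm r), (Matrix.of fun i j : Fin m =>
        (descPochhammer ℝ j).eval (((h - Pi.single r 1 : Fin m → ℤ) i : ℤ) : ℝ)) (σ i) i =
        ∏ i ∈ Finset.univ.erase (σ.symm r), (Matrix.of fun i j : Fin m =>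
        (descPochhammer ℝ j).eval (h i : ℝ)) (σ i) i := by
      refine Finset.prod_congr rfl fun i hi => ?_
      have : σ i ≠ r := fun h' => (Finset.mem_erase.1 hi).1 (by simp [← h'])
      simp [this]
    rw [e]
    simp only [Matrix.of_apply, Equiv.apply_symm_apply, Pi.sub_apply, Pi.single_eq_same]
    have := hP (σ.symm r) (h r)
    push_cast
    linear_combination ((Equiv.Perm.sign σ : ℤ) : ℝ) * (∏ i ∈ Finset.univ.erase (σ.symm r),
      (descPochhammer ℝ i).eval ((h (σ i)) : ℝ)) * this
  simp only [key]
  rw [← Finset.sum_mul, Finset.sum_sub_distrib, Equiv.sum_comp σ.symm (fun i : Fin m => (i : ℝ))]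

lemma wordExp_sum_mul {k M : ℕ} {p : Fin k → ℝ} {G : Type*} [AddCommGroup G] (v : Fin k → G)
    (u : Fin k → ℝ) (f : G → ℝ) :
    wordExp p (M + 1) (fun w => (∑ i, u (w i)) * f (∑ i, v (w i))) =
      (M + 1) * ∑ a, p a * u a * wordExp p M (fun w => f (∑ i, v (w i) + v a)) := by
  have step : ∀ {M : ℕ} (f : G → ℝ), wordExp p (M + 1) (fun w => f (∑ i, v (w i))) =
      ∑ a, p a * wordExp p M (fun w => f (∑ i, v (w i) + v a)) := by
    intro M f
    simp only [wordExp_succ, Fin.sum_univ_castSucc, wsnoc_castSucc, wsnoc_last]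
  have main : ∀ (M : ℕ) (f : G → ℝ), wordExp p M (fun w => (∑ i, u (w i)) * f (∑ i, v (w i))) =
      M * ∑ a, p a * u a * wordExp p (M - 1) (fun w => f (∑ i, v (w i) + v a)) := by
    intro M
    induction M with
    | zero => intro f; simp [wordExp_zero]
    | succ M ih =>
      intro f
      have e1 : wordExp p (M + 1) (fun w => (∑ i, u (w i)) * f (∑ i, v (w i))) =
          ∑ a, (p a * wordExp p M (fun w => (∑ i, u (w i)) * f (∑ i, v (w i) + v a)) +
            p a * u a * wordExp p M (fun w => f (∑ i, v (w i) + v a))) := by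
        simp only [wordExp_succ, Fin.sum_univ_castSucc, wsnoc_castSucc, wsnoc_last, add_mul,
          wordExp_add, wordExp_const_mul]
        exact Finset.sum_congr rfl fun a _ => by ring
      have e2 : ∑ a, p a * wordExp p M (fun w => (∑ i, u (w i)) * f (∑ i, v (w i) + v a)) =
          M * ∑ a, p a * u a * wordExp p M (fun w => f (∑ i, v (w i) + v a)) := by
        have : ∀ a, wordExp p M (fun w => (∑ i, u (w i)) * f (∑ i, v (w i) + v a)) = _ :=
          fun a => ih (fun x => f (x + v a))
        simp only [this]
        cases M with
        | zero => simp
        | succ M =>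
          have : ∀ b, wordExp p (M + 1) (fun w => f (∑ i, v (w i) + v b)) = _ :=
            fun b => step (fun x => f (x + v b))
          rw [show M + 1 - 1 = M from rfl]
          simp only [this, Finset.mul_sum]
          rw [Finset.sum_comm]
          refine Finset.sum_congr rfl fun b _ => Finset.sum_congr rfl fun a _ => ?_
          simp only [add_right_comm]
          ring
      rw [e1, Finset.sum_add_distrib, e2, Nat.add_sub_cancel]
      push_cast
      ring
  simpa using main (M + 1) f

section counts

variable {k : ℕ} {p : Fin k → ℝ} {m : ℕ} {p₁ : ℝ}

lemma sum_letters (hm : m ≤ k) (hsum : ∑ a, p a = 1) (hp : ∀ a : Fin k, (a : ℕ) < m → p a = p₁)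
    (g : Fin m → ℝ) (g₀ : ℝ) :
    (∑ a : Fin k, p a * if h : (a : ℕ) < m then g ⟨a, h⟩ else g₀) =
      (1 - m * p₁) * g₀ + p₁ * ∑ r, g r := by
  obtain ⟨d, rfl⟩ := Nat.exists_eq_add_of_le hm
  have hp' : ∀ i : Fin m, p (Fin.castAdd d i) = p₁ := fun i => hp _ (by simp)
  rw [Fin.sum_univ_add] at hsum ⊢
  simp only [hp', Finset.sum_const, Finset.card_univ, Fintype.card_fin, nsmul_eq_mul] at hsum
  have : ∑ i : Fin d, p (Fin.natAdd m i) = 1 - m * p₁ := by linarith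
  simp [hp', ← Finset.mul_sum, ← Finset.sum_mul, this]
  ring

/-- The increment of the letter counts caused by the letter `a`. -/
def letterStep (m : ℕ) (a : Fin k) : Fin m → ℤ :=
  if h : (a : ℕ) < m then Pi.single ⟨a, h⟩ 1 else 0

/-- The number of occurrences in `w` of each of the first `m` letters. -/
def counts (m : ℕ) {N : ℕ} (w : Fin N → Fin k) : Fin m → ℤ := ∑ i, letterStep m (w i)

lemma counts_wsnoc {N : ℕ} (w : Fin N → Fin k) (a : Fin k) :
    counts m (wsnoc w a) = counts m w + letterStep m a := by
  simp [counts, Fin.sum_univ_castSucc]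

lemma sum_counts_le {N : ℕ} (w : Fin N → Fin k) : ∑ r, counts m w r ≤ N := by
  induction N with
  | zero => simp [counts]
  | succ N ih =>
    obtain ⟨w, a, rfl⟩ : ∃ w' a, w = wsnoc w' a := ⟨_, _, eq_wsnoc w⟩
    have h : ∑ r, letterStep m a r ≤ 1 := by
      unfold letterStep
      split_ifs <;> simp
    have := ih w
    simp only [counts_wsnoc, Pi.add_apply, Finset.sum_add_distrib]
    push_cast
    omega

lemma counts_nonneg {N : ℕ} (w : Fin N → Fin k) (r : Fin m) : 0 ≤ counts m w r := by
  rw [counts, Finset.sum_apply]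
  refine Finset.sum_nonneg fun i _ => ?_
  unfold letterStep
  split_ifs
  · exact (Pi.single_nonneg.2 (zero_le_one (α := ℤ)) : (0 : Fin m → ℤ) ≤ _) r
  · exact le_rfl

lemma wordExp_succ_counts (hm : m ≤ k) (hsum : ∑ a, p a = 1)
    (hp : ∀ a : Fin k, (a : ℕ) < m → p a = p₁) {N : ℕ} (f : (Fin m → ℤ) → ℝ) :
    wordExp p (N + 1) (fun w => f (counts m w)) =
      (1 - m * p₁) * wordExp p N (fun w => f (counts m w)) +
        p₁ * ∑ r, wordExp p N (fun w => f (counts m w + Pi.single r 1)) := by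
  rw [← sum_letters hm hsum hp, wordExp_succ]
  refine Finset.sum_congr rfl fun a _ => ?_
  simp only [counts_wsnoc, letterStep]
  split_ifs <;> simp

lemma wordExp_counts_mul (hm : m ≤ k) (hsum : ∑ a, p a = 1)
    (hp : ∀ a : Fin k, (a : ℕ) < m → p a = p₁) {N : ℕ} (r : Fin m) (f : (Fin m → ℤ) → ℝ) :
    wordExp p (N + 1) (fun w => counts m w r * f (counts m w)) =
      (N + 1) * (p₁ * wordExp p N (fun w => f (counts m w + Pi.single r 1))) := by
  have h1 : ∀ w : Fin (N + 1) → Fin k, (counts m w r : ℝ) =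
      ∑ i, (letterStep m (w i) r : ℝ) := fun w => by simp [counts]
  simp only [h1]
  have := wordExp_sum_mul (p := p) (M := N) (letterStep m) (fun a => (letterStep m a r : ℝ)) f
  simp only [counts]
  rw [this]
  congr 1
  have h2 := sum_letters hm hsum hp (fun s => if s = r then wordExp p N (fun w =>
    f (∑ i, letterStep m (w i) + Pi.single r 1)) else 0) 0
  rw [Finset.sum_ite_eq' Finset.univ, if_pos (Finset.mem_univ _), mul_zero, zero_add] at h2
  rw [← h2]
  refine Finset.sum_congr rfl fun a _ => ?_
  rw [mul_assoc]
  congr 1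
  by_cases h : (a : ℕ) < m
  · by_cases h' : (⟨a, h⟩ : Fin m) = r
    · simp [letterStep, h, h']
    · simp [letterStep, h, h']
  · simp [letterStep, h]

lemma wordExp_counts_compl_mul (hm : m ≤ k) (hsum : ∑ a, p a = 1)
    (hp : ∀ a : Fin k, (a : ℕ) < m → p a = p₁) {N : ℕ} (f : (Fin m → ℤ) → ℝ) :
    wordExp p (N + 1) (fun w => (N + 1 - ∑ r, (counts m w r : ℝ)) * f (counts m w)) =
      (N + 1) * ((1 - m * p₁) * wordExp p N (fun w => f (counts m w))) := by
  have h1 : wordExp p (N + 1) (fun w => (N + 1 - ∑ r, (counts m w r : ℝ)) * f (counts m w)) =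
      (N + 1) * wordExp p (N + 1) (fun w => f (counts m w)) -
        ∑ r, wordExp p (N + 1) (fun w => counts m w r * f (counts m w)) := by
    simp only [sub_mul, wordExp_sub, wordExp_const_mul, Finset.sum_mul, wordExp_sum]
  rw [h1, wordExp_succ_counts hm hsum hp, Finset.sum_congr rfl fun r _ =>
    wordExp_counts_mul hm hsum hp r f, ← Finset.mul_sum, ← Finset.mul_sum]
  ring

end counts

section lisVec

variable {k : ℕ} {p : Fin k → ℝ} {m : ℕ} {p₁ : ℝ}

/-- The lengths of the longest weakly increasing subsequences of `w` in the alphabets formed by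
the first `1, …, m` letters. -/
def lisVec (m : ℕ) {N : ℕ} (w : Fin N → Fin k) : Fin m → ℤ := fun j => lisTo j w

lemma lisVec_wsnoc_of_lt {N : ℕ} (w : Fin N → Fin k) {a : Fin k} (h : (a : ℕ) < m) :
    lisVec m (wsnoc w a) = push ⟨a, h⟩ (lisVec m w) := by
  ext j
  simp only [lisVec, push, lisTo_wsnoc, Fin.lt_def]
  split_ifs <;> omega

lemma lisVec_wsnoc_of_le {N : ℕ} (w : Fin N → Fin k) {a : Fin k} (h : m ≤ (a : ℕ)) :
    lisVec m (wsnoc w a) = lisVec m w := by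
  ext j
  have := j.2
  simp only [lisVec, lisTo_wsnoc]
  rw [if_neg (by omega)]

lemma wordExp_succ_lisVec (hm : m ≤ k) (hsum : ∑ a, p a = 1)
    (hp : ∀ a : Fin k, (a : ℕ) < m → p a = p₁) {N : ℕ} (φ : (Fin m → ℤ) → ℝ) :
    wordExp p (N + 1) (fun w => φ (lisVec m w)) =
      (1 - m * p₁) * wordExp p N (fun w => φ (lisVec m w)) +
        p₁ * ∑ r, wordExp p N (fun w => φ (push r (lisVec m w))) := by
  rw [← sum_letters hm hsum hp, wordExp_succ]
  refine Finset.sum_congr rfl fun a _ => ?_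
  split_ifs with h
  · simp only [lisVec_wsnoc_of_lt _ h]
  · simp only [lisVec_wsnoc_of_le _ (not_lt.1 h)]

/-- The sum of the entries of the staircase `(m - 1, …, 1, 0)`. -/
def stairSize (m : ℕ) : ℕ := ∑ i : Fin m, (i : ℕ)

lemma gtSum_staircase (m : ℕ) (φ : (Fin m → ℤ) → ℝ) :
    gtSum m (fun i => m - 1 - i) φ = φ 0 * gtSum m (fun i => m - 1 - i) (fun _ => 1) := by
  induction m with
  | zero => simp [gtSum]
  | succ m ih =>
    have e : interlacing (fun i : Fin (m + 1) => ((m + 1 : ℕ) : ℤ) - 1 - i) =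
        {fun i : Fin m => (m : ℤ) - 1 - i} := by
      ext μ
      rw [mem_interlacing, Finset.mem_singleton, funext_iff]
      refine forall_congr' fun i => ?_
      simp
      omega
    have e0 : (Fin.snoc (α := fun _ => ℤ) (0 : Fin m → ℤ) 0 : Fin (m + 1) → ℤ) = 0 := by
      ext j
      rcases Fin.eq_castSucc_or_eq_last j with ⟨j, rfl⟩ | rfl <;> simp
    simp only [gtSum, e, Finset.sum_singleton]
    rw [ih]
    congr 2
    simpa using e0

lemma eq_staircase {h : Fin m → ℤ} (hh : StrictAnti h) (h0 : ∀ i, 0 ≤ h i)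
    (hs : ∑ i, h i ≤ stairSize m) : h = fun i : Fin m => (m : ℤ) - 1 - i := by
  have hle : ∀ i : Fin m, (m : ℤ) - 1 - i ≤ h i := by
    suffices H : ∀ (d : ℕ) (i : Fin m), m - 1 - i = d → (d : ℤ) ≤ h i by
      intro i
      have := H _ i rfl
      omega
    intro d
    induction d with
    | zero => exact fun i _ => by simpa using h0 i
    | succ d ih =>
      intro i hi
      have h1 := ih ⟨i + 1, by omega⟩ (by simp; omega)
      have h2 := hh (show i < ⟨i + 1, by omega⟩ from Fin.lt_def.2 (by simp))
      push_cast
      omega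
  have hsum : ∑ i : Fin m, ((m : ℤ) - 1 - i) = stairSize m := by
    rw [← Equiv.sum_comp Fin.revPerm, stairSize]
    push_cast
    refine Finset.sum_congr rfl fun i _ => ?_
    have := i.2
    simp [Fin.val_rev]
  have heq : ∑ i : Fin m, ((m : ℤ) - 1 - i) = ∑ i, h i :=
    le_antisymm (Finset.sum_le_sum fun i _ => hle i) (hs.trans hsum.ge)
  ext i
  exact ((Finset.sum_eq_sum_iff_of_le fun i _ => hle i).1 heq i (Finset.mem_univ i)).symm

lemma wordExp_vand_mul_gtSum_succ (hm : m ≤ k) (hsum : ∑ a, p a = 1)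
    (hp : ∀ a : Fin k, (a : ℕ) < m → p a = p₁) (M : ℕ) (φ : (Fin m → ℤ) → ℝ) :
    (M + 1 - stairSize m) *
        wordExp p (M + 1) (fun w => vand (counts m w) * gtSum m (counts m w) φ) =
      (M + 1) * ((1 - m * p₁) * wordExp p M (fun w => vand (counts m w) * gtSum m (counts m w) φ) +
        p₁ * ∑ r, wordExp p M (fun w => vand (counts m w) *
          gtSum m (counts m w) (fun x => φ (push r x)))) := by
  have h1 : ∑ r, wordExp p M (fun w => vand (counts m w) *
      gtSum m (counts m w) (fun x => φ (push r x))) =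
      ∑ r, wordExp p M (fun w => vand (counts m w + Pi.single r 1 - Pi.single r 1) *
        gtSum m (counts m w + Pi.single r 1) φ) := by
    rw [← wordExp_sum, ← wordExp_sum]
    congr 1
    ext w
    simp only [add_sub_cancel_right, ← Finset.mul_sum]
    by_cases hw : StrictAnti (counts m w)
    · rw [sum_gtSum_push hw]
    · have : ∃ i j, i < j ∧ counts m w i ≤ counts m w j := by
        simpa [StrictAnti] using hw
      obtain ⟨i, j, hij, h⟩ := this
      rcases h.eq_or_lt with h | h
      · have : vand (counts m w) = 0 :=
          Matrix.det_zero_of_row_eq hij.ne (by ext; simp [Matrix.vandermonde_apply, h])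
        simp [this]
      · rw [Finset.sum_eq_zero fun r _ => gtSum_eq_zero hw _,
          Finset.sum_eq_zero fun r _ => gtSum_eq_zero (fun h' => ?_) _]
        have h1 := h' hij
        have h2 : (Pi.single r 1 : Fin m → ℤ) j ≥ 0 :=
          (Pi.single_nonneg.2 (zero_le_one (α := ℤ)) : (0 : Fin m → ℤ) ≤ _) j
        have h3 : (Pi.single r 1 : Fin m → ℤ) i ≤ 1 := by
          by_cases hr : i = r
          · simp [hr]
          · simp [hr]
        simp only [Pi.add_apply] at h1
        omega
  have h2 : ∀ r, (M + 1) * (p₁ * wordExp p M (fun w =>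
      vand (counts m w + Pi.single r 1 - Pi.single r 1) *
        gtSum m (counts m w + Pi.single r 1) φ)) =
      wordExp p (M + 1) (fun w => counts m w r *
        (vand (counts m w - Pi.single r 1) * gtSum m (counts m w) φ)) := by
    intro r
    have := wordExp_counts_mul hm hsum hp (N := M) r
      fun h : Fin m → ℤ => vand (h - Pi.single r 1) * gtSum m h φ
    exact this.symm
  have h3 := wordExp_counts_compl_mul hm hsum hp (N := M) fun h => vand h * gtSum m h φ
  rw [h1, mul_add, ← h3, Finset.mul_sum, Finset.mul_sum, Finset.sum_congr rfl fun r _ => h2 r,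
    ← wordExp_sum, ← wordExp_add, ← wordExp_const_mul]
  congr 1
  ext w
  have h4 := sum_mul_vand_sub_single (counts m w)
  simp only [← mul_assoc, ← Finset.sum_mul]
  rw [h4, stairSize]
  push_cast
  ring

/-- The law of the vector of longest weakly increasing subsequences in the first alphabets, in
terms of multinomial letter counts. -/
theorem wordExp_vand_mul_gtSum (hm : m ≤ k) (hsum : ∑ a, p a = 1)
    (hp : ∀ a : Fin k, (a : ℕ) < m → p a = p₁) (N : ℕ) (φ : (Fin m → ℤ) → ℝ) :
    wordExp p (N + stairSize m) (fun w => vand (counts m w) * gtSum m (counts m w) φ) =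
      wordExp p (N + stairSize m) (fun w => vand (counts m w) * gtSum m (counts m w) fun _ => 1) *
        wordExp p N (fun w => φ (lisVec m w)) := by
  induction N generalizing φ with
  | zero =>
    have h0 : lisVec m (Fin.elim0 : Fin 0 → Fin k) = 0 := by
      ext j
      simp [lisVec, lisTo_length_zero]
    rw [wordExp_zero, h0, mul_comm, ← wordExp_const_mul]
    congr 1
    ext w
    by_cases hw : StrictAnti (counts m w)
    · have hle : ∑ r, counts m w r ≤ (stairSize m : ℤ) := by
        simpa only [zero_add] using sum_counts_le (m := m) w
      rw [eq_staircase hw (counts_nonneg w) hle, gtSum_staircase]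
      ring
    · simp [gtSum_eq_zero hw]
  | succ N ih =>
    have h1 : ∀ φ, _ := wordExp_vand_mul_gtSum_succ hm hsum hp (N + stairSize m)
    have h2 := h1 φ
    have h3 := h1 fun _ => 1
    have hs := wordExp_succ_lisVec hm hsum hp (N := N) φ
    simp only [ih φ, fun r => ih (fun x => φ (push r x)), ← Finset.mul_sum,
      Finset.sum_const] at h2 h3
    have e : N + 1 + stairSize m = N + stairSize m + 1 := by ring
    have hN : ((N + stairSize m : ℕ) : ℝ) + 1 - stairSize m ≠ 0 := by
      push_cast
      have : (0 : ℝ) ≤ N := Nat.cast_nonneg N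
      intro
      linarith
    rw [e, hs]
    apply mul_left_cancel₀ hN
    rw [h2]
    simp only [Finset.card_univ, Fintype.card_fin, nsmul_eq_mul] at h3
    linear_combination -((1 - m * p₁) * wordExp p N (fun w => φ (lisVec m w)) +
      p₁ * ∑ r, wordExp p N (fun w => φ (push r (lisVec m w)))) * h3

end lisVec

section symm

variable {k : ℕ} {p : Fin k → ℝ} {m : ℕ} {p₁ : ℝ}

lemma wordExp_counts_comp_perm (hm : m ≤ k) (hsum : ∑ a, p a = 1)
    (hp : ∀ a : Fin k, (a : ℕ) < m → p a = p₁) (N : ℕ) (f : (Fin m → ℤ) → ℝ)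
    (σ : Equiv.Perm (Fin m)) :
    wordExp p N (fun w => f (counts m w ∘ σ)) = wordExp p N (fun w => f (counts m w)) := by
  induction N generalizing f with
  | zero =>
    simp only [wordExp_zero, counts, Finset.univ_eq_empty, Finset.sum_empty]
    rfl
  | succ N ih =>
    rw [wordExp_succ_counts hm hsum hp f,
      wordExp_succ_counts hm hsum hp (fun h : Fin m → ℤ => f (h ∘ σ)), ih,
      ← Equiv.sum_comp σ]
    congr 2
    refine Finset.sum_congr rfl fun r _ => ?_
    refine Eq.trans ?_ (ih fun x => f (x + Pi.single r 1))
    congr 1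
    ext w
    congr 1
    ext i
    simp [Pi.single_apply]

lemma vand_comp_perm_sq (h : Fin m → ℤ) (σ : Equiv.Perm (Fin m)) :
    vand (h ∘ σ) ^ 2 = vand h ^ 2 := by
  have : vand (h ∘ σ) = ((Equiv.Perm.sign σ : ℤ) : ℝ) * vand h := by
    rw [vand, vand, ← Matrix.det_permute]
    rfl
  rw [this, mul_pow, ← Int.cast_pow, ← Units.val_pow_eq_pow_val, Int.units_sq]
  simp

lemma sum_perm_ite_strictAnti {h : Fin m → ℤ} (hh : Function.Injective h) :
    (∑ σ : Equiv.Perm (Fin m), if StrictAnti (h ∘ σ) then (1 : ℝ) else 0) = 1 := by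
  set g : Fin m → ℤᵒᵈ := fun i => OrderDual.toDual (h i) with hg
  have key : ∀ σ : Equiv.Perm (Fin m), StrictAnti (h ∘ σ) ↔ σ = Tuple.sort g := by
    intro σ
    have h1 : StrictAnti (h ∘ σ) ↔ Monotone (g ∘ σ) := by
      constructor
      · exact fun H => H.antitone.dual_right
      · intro H
        have : Antitone (h ∘ σ) := fun i j hij => H hij
        exact this.strictAnti_of_injective (hh.comp σ.injective)
    rw [h1]
    constructor
    · intro H
      have := Tuple.unique_monotone H (Tuple.monotone_sort g)
      ext i
      exact congrArg Fin.val (hh (congrFun this i))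
    · rintro rfl
      exact Tuple.monotone_sort g
  simp only [key]
  simp

lemma vand_eq_zero_of_not_injective {h : Fin m → ℤ} (hh : ¬ Function.Injective h) :
    vand h = 0 := by
  by_contra H
  rw [vand, ← ne_eq, Matrix.det_vandermonde_ne_zero_iff] at H
  exact hh fun i j hij => H (by simp [hij])

lemma factorial_mul_wordExp_strictAnti (hm : m ≤ k) (hsum : ∑ a, p a = 1)
    (hp : ∀ a : Fin k, (a : ℕ) < m → p a = p₁) (N : ℕ) {f : (Fin m → ℤ) → ℝ}
    (hf : ∀ h (σ : Equiv.Perm (Fin m)), f (h ∘ σ) = f h)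
    (hf0 : ∀ h, ¬ Function.Injective h → f h = 0) :
    (m.factorial : ℝ) * wordExp p N (fun w => f (counts m w) *
        if StrictAnti (counts m w) then 1 else 0) =
      wordExp p N (fun w => f (counts m w)) := by
  have h1 : ∀ σ : Equiv.Perm (Fin m), wordExp p N (fun w => f (counts m w) *
      if StrictAnti (counts m w ∘ σ) then 1 else 0) = wordExp p N (fun w => f (counts m w) *
        if StrictAnti (counts m w) then 1 else 0) := by
    intro σ
    rw [← wordExp_counts_comp_perm hm hsum hp N
      (fun h => f h * if StrictAnti h then 1 else 0) σ]
    simp only [hf]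
  have h2 : (m.factorial : ℝ) = (Finset.univ : Finset (Equiv.Perm (Fin m))).card := by
    rw [Finset.card_univ, Fintype.card_perm, Fintype.card_fin]
  rw [h2, ← nsmul_eq_mul, ← Finset.sum_const, ← Finset.sum_congr rfl fun σ _ => h1 σ,
    ← wordExp_sum]
  congr 1
  ext w
  rw [← Finset.mul_sum]
  by_cases hw : Function.Injective (counts m w)
  · rw [sum_perm_ite_strictAnti hw, mul_one]
  · rw [hf0 _ hw, zero_mul]

/-- The distribution of `lisTo m` in terms of the multinomial distribution reweighted by a squared
Vandermonde determinant. -/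
theorem wordExp_vand_sq_eq (hm : m + 1 ≤ k) (hsum : ∑ a, p a = 1)
    (hp : ∀ a : Fin k, (a : ℕ) < m + 1 → p a = p₁) (N : ℕ) (n : ℤ) :
    wordExp p (N + stairSize (m + 1)) (fun w => vand (counts (m + 1) w) ^ 2 *
        if ∀ i, counts (m + 1) w i ≤ n + m then 1 else 0) =
      wordExp p (N + stairSize (m + 1)) (fun w => vand (counts (m + 1) w) ^ 2) *
        wordExp p N (fun w => if (lisTo m w : ℤ) ≤ n then 1 else 0) := by
  obtain ⟨c, hc, hgt⟩ := exists_gtSum_one_eq (m + 1)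
  have h1 := wordExp_vand_mul_gtSum hm hsum hp N
    (fun x : Fin (m + 1) → ℤ => if x (Fin.last m) ≤ n then 1 else 0)
  have h2 : ∀ w : Fin (N + stairSize (m + 1)) → Fin k, vand (counts (m + 1) w) *
      gtSum (m + 1) (counts (m + 1) w) (fun x => if x (Fin.last m) ≤ n then 1 else 0) =
      c * ((vand (counts (m + 1) w) ^ 2 * if ∀ i, counts (m + 1) w i ≤ n + m then 1 else 0) *
        if StrictAnti (counts (m + 1) w) then 1 else 0) := by
    intro w
    by_cases hw : StrictAnti (counts (m + 1) w)
    · have e : (∀ i, counts (m + 1) w i ≤ n + m) ↔ counts (m + 1) w 0 - m ≤ n := by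
        constructor
        · intro H
          have := H 0
          omega
        · intro H i
          have := hw.antitone (Fin.zero_le i)
          omega
      have := gtSum_congr (h := counts (m + 1) w)
        (φ := fun x => if x (Fin.last m) ≤ n then (1 : ℝ) else 0)
        (ψ := fun x => (if counts (m + 1) w 0 - m ≤ n then (1 : ℝ) else 0) * 1) fun x hx => by
          simp only [hx, mul_one]
      rw [this, gtSum_const_mul, hgt _ hw, if_pos hw]
      simp only [e]
      ring
    · rw [gtSum_eq_zero hw, if_neg hw]
      ring
  have h3 : ∀ w : Fin (N + stairSize (m + 1)) → Fin k, vand (counts (m + 1) w) *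
      gtSum (m + 1) (counts (m + 1) w) (fun _ => 1) =
      c * (vand (counts (m + 1) w) ^ 2 * if StrictAnti (counts (m + 1) w) then 1 else 0) := by
    intro w
    by_cases hw : StrictAnti (counts (m + 1) w)
    · rw [hgt _ hw, if_pos hw]
      ring
    · rw [gtSum_eq_zero hw, if_neg hw]
      ring
  simp only [h2, h3, wordExp_const_mul, lisVec, Fin.val_last] at h1
  have h4 := factorial_mul_wordExp_strictAnti hm hsum hp (N + stairSize (m + 1))
    (f := fun h => vand h ^ 2 * if ∀ i, h i ≤ n + m then 1 else 0)
    (fun h σ => by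
      rw [vand_comp_perm_sq]
      congr 2
      exact propext ⟨fun H i => by simpa using H (σ.symm i), fun H i => H (σ i)⟩)
    (fun h hh => by rw [vand_eq_zero_of_not_injective hh]; ring)
  have h5 := factorial_mul_wordExp_strictAnti hm hsum hp (N + stairSize (m + 1))
    (f := fun h => vand h ^ 2) (fun h σ => vand_comp_perm_sq h σ)
    (fun h hh => by rw [vand_eq_zero_of_not_injective hh]; ring)
  rw [← h4, ← h5, mul_assoc]
  congr 1
  rw [mul_assoc] at h1
  exact mul_left_cancel₀ hc h1

end symm

section Gaussian

variable {ι : Type*} [Fintype ι]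

/-- The quadratic form in the exponent of the limiting density. -/
def limitForm (r : ℝ) (ξ : ι → ℝ) : ℝ := ∑ i, ξ i ^ 2 + r * (∑ i, ξ i) ^ 2

lemma integral_cexp_inner_sub_sq_norm_comp {E : Type*} [NormedAddCommGroup E]
    [InnerProductSpace ℝ E] [FiniteDimensional ℝ E] [MeasurableSpace E] [BorelSpace E]
    (B : E ≃ₗ[ℝ] E) {T : E → E} (hT : ∀ x t, inner ℝ (B.symm x) t = inner ℝ x (T t)) (t : E) :
    ∫ x, Complex.exp (-(1 / 2) * (‖B x‖ : ℂ) ^ 2 + Complex.I * (inner ℝ t x : ℝ)) =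
      (|(LinearMap.det (B : E →ₗ[ℝ] E))⁻¹| * (2 * Real.pi) ^ (Module.finrank ℝ E / 2 : ℝ) : ℝ) *
        Complex.exp (-(1 / 2) * (‖T t‖ : ℂ) ^ 2) := by
  have hdet : LinearMap.det (B : E →ₗ[ℝ] E) ≠ 0 := B.isUnit_det'.ne_zero
  have hmap := Measure.map_linearMap_addHaar_eq_smul_addHaar (volume : Measure E) hdet
  have hG := GaussianFourier.integral_cexp_neg_mul_sq_norm_add (V := E) (b := 1 / 2)
    (by norm_num) Complex.I (T t)
  set G : E → ℂ := fun v =>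
    Complex.exp (-(1 / 2) * (‖v‖ : ℂ) ^ 2 + Complex.I * (inner ℝ (T t) v : ℝ)) with hGdef
  have h1 : ∀ x, Complex.exp (-(1 / 2) * (‖B x‖ : ℂ) ^ 2 + Complex.I * (inner ℝ t x : ℝ)) =
      G (B x) := by
    intro x
    simp only [hGdef]
    rw [real_inner_comm (B x) (T t), ← hT, B.symm_apply_apply, real_inner_comm x t]
  have h2 : ∫ x, G (B x) = ∫ y, G y ∂(Measure.map (B : E →ₗ[ℝ] E) volume) :=
    (integral_map_equiv (B.toContinuousLinearEquiv.toHomeomorph.toMeasurableEquiv) G).symm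
  simp only [h1]
  rw [h2, hmap, integral_smul_measure, ENNReal.toReal_ofReal (abs_nonneg _), hG,
    Complex.real_smul]
  push_cast
  rw [mul_assoc]
  congr 2
  · rw [Complex.ofReal_cpow (by positivity)]
    push_cast
    congr 1
    ring
  · rw [Complex.I_sq]
    ring_nf

lemma exists_probabilityMeasure_gaussian_density {E : Type*} [NormedAddCommGroup E]
    [InnerProductSpace ℝ E] [FiniteDimensional ℝ E] [MeasurableSpace E] [BorelSpace E]
    (B : E ≃ₗ[ℝ] E) {T : E → E} (hT : ∀ x t, inner ℝ (B.symm x) t = inner ℝ x (T t)) :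
    ∃ (ν : ProbabilityMeasure E) (K : ℝ), 0 < K ∧
      (∀ t, charFun (ν : Measure E) t = Complex.exp (-(1 / 2) * (‖T t‖ : ℂ) ^ 2)) ∧
      (ν : Measure E) = volume.withDensity
        (fun x => ENNReal.ofReal (K * Real.exp (-‖B x‖ ^ 2 / 2))) := by
  have hdet : LinearMap.det (B : E →ₗ[ℝ] E) ≠ 0 := B.isUnit_det'.ne_zero
  set Z : ℝ := |(LinearMap.det (B : E →ₗ[ℝ] E))⁻¹| *
    (2 * Real.pi) ^ (Module.finrank ℝ E / 2 : ℝ) with hZ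
  have hZpos : 0 < Z := by
    have : 0 < |(LinearMap.det (B : E →ₗ[ℝ] E))⁻¹| := abs_pos.2 (inv_ne_zero hdet)
    positivity
  have hT0 : T 0 = 0 := by
    have := hT (T 0) 0
    rw [inner_zero_right] at this
    exact inner_self_eq_zero.1 this.symm
  have hInt := integral_cexp_inner_sub_sq_norm_comp B hT
  have hone : ∫ x, Z⁻¹ * Real.exp (-‖B x‖ ^ 2 / 2) = 1 := by
    have h0 := hInt 0
    simp only [inner_zero_left, hT0, norm_zero, Complex.ofReal_zero, mul_zero, add_zero,
      ne_eq, OfNat.ofNat_ne_zero, not_false_eq_true, zero_pow, Complex.exp_zero, mul_one] at h0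
    have h1 : ∀ x : E, Complex.exp (-(1 / 2) * (‖B x‖ : ℂ) ^ 2) =
        ((Real.exp (-‖B x‖ ^ 2 / 2) : ℝ) : ℂ) := fun x => by
      push_cast; congr 1; ring
    simp only [h1] at h0
    rw [integral_complex_ofReal] at h0
    have h2 : ∫ x, Real.exp (-‖B x‖ ^ 2 / 2) = Z := by exact_mod_cast h0
    rw [integral_const_mul, h2, inv_mul_cancel₀ hZpos.ne']
  have hcont : Continuous fun x => Z⁻¹ * Real.exp (-‖B x‖ ^ 2 / 2) := by
    have : Continuous B := B.toContinuousLinearEquiv.continuous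
    fun_prop
  have hnn : ∀ x, 0 ≤ Z⁻¹ * Real.exp (-‖B x‖ ^ 2 / 2) := fun x => by positivity
  refine ⟨⟨volume.withDensity fun x => ENNReal.ofReal (Z⁻¹ * Real.exp (-‖B x‖ ^ 2 / 2)), ⟨?_⟩⟩,
    Z⁻¹, inv_pos.2 hZpos, fun t => ?_, rfl⟩
  · rw [withDensity_apply _ MeasurableSet.univ, Measure.restrict_univ,
      ← ofReal_integral_eq_lintegral_ofReal (integrable_of_integral_eq_one hone)
        (ae_of_all _ hnn), hone, ENNReal.ofReal_one]
  · simp only [ProbabilityMeasure.coe_mk]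
    rw [charFun_apply, integral_withDensity_eq_integral_toReal_smul
      hcont.measurable.ennreal_ofReal (ae_of_all _ fun _ => ENNReal.ofReal_lt_top)]
    have h1 : ∀ x : E, (ENNReal.ofReal (Z⁻¹ * Real.exp (-‖B x‖ ^ 2 / 2))).toReal •
        Complex.exp ((inner ℝ x t : ℝ) * Complex.I) = (Z : ℂ)⁻¹ *
        Complex.exp (-(1 / 2) * (‖B x‖ : ℂ) ^ 2 + Complex.I * (inner ℝ t x : ℝ)) := fun x => by
      rw [ENNReal.toReal_ofReal (hnn x), Complex.real_smul, Complex.exp_add, real_inner_comm]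
      push_cast
      rw [mul_assoc, mul_comm Complex.I]
      congr 3
      ring
    simp only [h1]
    rw [integral_const_mul, hInt, ← mul_assoc, inv_mul_cancel₀ (by exact_mod_cast hZpos.ne'),
      one_mul]

/-- The map `ξ ↦ ξ - a (∑ ξ) 1`. -/
def subSum (a : ℝ) (ξ : EuclideanSpace ℝ ι) : EuclideanSpace ℝ ι :=
  WithLp.toLp 2 fun i => ξ i - a * ∑ j, ξ j

lemma sum_subSum (a : ℝ) (ξ : EuclideanSpace ℝ ι) :
    ∑ i, subSum a ξ i = (1 - a * Fintype.card ι) * ∑ i, ξ i := by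
  simp only [subSum, Finset.sum_sub_distrib, Finset.sum_const, Finset.card_univ, nsmul_eq_mul]
  ring

lemma subSum_subSum {a b : ℝ} (h : a + b = a * b * Fintype.card ι) (ξ : EuclideanSpace ℝ ι) :
    subSum a (subSum b ξ) = ξ := by
  ext i
  have h1 : subSum a (subSum b ξ) i = subSum b ξ i - a * ∑ j, subSum b ξ j := rfl
  have h2 : subSum b ξ i = ξ i - b * ∑ j, ξ j := rfl
  rw [h1, sum_subSum, h2]
  linear_combination (-∑ j, ξ j) * h

/-- `subSum` as a linear equivalence. -/
def subSumEquiv {a b : ℝ} (h : a + b = a * b * Fintype.card ι) :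
    EuclideanSpace ℝ ι ≃ₗ[ℝ] EuclideanSpace ℝ ι where
  toFun := subSum a
  invFun := subSum b
  map_add' x y := by
    ext i
    simp only [subSum, PiLp.add_apply, Finset.sum_add_distrib]
    ring
  map_smul' c x := by
    ext i
    simp only [subSum, PiLp.smul_apply, smul_eq_mul, ← Finset.mul_sum, RingHom.id_apply]
    ring
  left_inv := subSum_subSum (by linarith)
  right_inv := subSum_subSum h

lemma inner_subSum (a : ℝ) (x t : EuclideanSpace ℝ ι) :
    inner ℝ (subSum a x) t = inner ℝ x (subSum a t) := by
  simp only [PiLp.inner_apply, RCLike.inner_apply, conj_trivial, subSum, sub_mul, mul_sub,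
    Finset.sum_sub_distrib, ← Finset.sum_mul, ← Finset.mul_sum]
  ring

lemma norm_subSum_sq (a : ℝ) (x : EuclideanSpace ℝ ι) :
    ‖subSum a x‖ ^ 2 = limitForm (a ^ 2 * Fintype.card ι - 2 * a) x.ofLp := by
  rw [EuclideanSpace.norm_sq_eq]
  simp only [Real.norm_eq_abs, sq_abs, subSum, sub_sq, Finset.sum_add_distrib,
    Finset.sum_sub_distrib, Finset.sum_const, Finset.card_univ, nsmul_eq_mul, limitForm,
    ← Finset.sum_mul, ← Finset.mul_sum]
  ring

/-- The Gaussian law with covariance `1 - p J`, where `J` is the all-ones matrix. -/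
lemma exists_limit_law {p : ℝ} (hp : p * Fintype.card ι < 1) :
    ∃ (ν : ProbabilityMeasure (EuclideanSpace ℝ ι)) (K : ℝ), 0 < K ∧
      (∀ t, charFun (ν : Measure (EuclideanSpace ℝ ι)) t =
        Complex.exp (-(1 / 2) * (limitForm (-p) t.ofLp : ℂ))) ∧
      (ν : Measure (EuclideanSpace ℝ ι)) = volume.withDensity fun x => ENNReal.ofReal
        (K * Real.exp (-limitForm (p / (1 - Fintype.card ι * p)) x.ofLp / 2)) := by
  set n : ℝ := ((Fintype.card ι : ℕ) : ℝ) with hn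
  set c : ℝ := √(1 - p * n) with hc
  have hcpos : 0 < c := Real.sqrt_pos.2 (by linarith)
  have hc2 : c ^ 2 = 1 - p * n := Real.sq_sqrt (by linarith)
  have h1c : 0 < 1 + c := by linarith
  have hb : ∃ b : ℝ, b ^ 2 * n - 2 * b = -p ∧ 1 - b * n = c := by
    refine ⟨p / (1 + c), ?_, ?_⟩
    · field_simp
      linear_combination p * hc2
    · field_simp
      linear_combination (-1) * hc2
  obtain ⟨b, hb1, hb2⟩ := hb
  have hb0 : 1 - b * n ≠ 0 := by rw [hb2]; exact hcpos.ne'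
  have ha : (-b / c) + b = (-b / c) * b * n := by
    field_simp
    linear_combination (-b) * hb2
  obtain ⟨ν, K, hK, h1, h2⟩ := exists_probabilityMeasure_gaussian_density
    (subSumEquiv (ι := ι) ha) (T := subSum b) (fun x t => inner_subSum b x t)
  refine ⟨ν, K, hK, fun t => ?_, ?_⟩
  · rw [h1, ← Complex.ofReal_pow, norm_subSum_sq, ← hn, hb1]
  · rw [h2]
    congr 1
    ext x
    have : ‖(subSumEquiv (ι := ι) ha) x‖ ^ 2 =
        limitForm (p / (1 - n * p)) x.ofLp := by
      have h3 : (-b / c) ^ 2 * n - 2 * (-b / c) = p / (1 - n * p) := by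
        have : 1 - n * p = c ^ 2 := by rw [hc2]; ring
        rw [this]
        field_simp
        linear_combination (-2 * b) * hb2 - hb1
      rw [← h3]
      exact norm_subSum_sq _ x
    rw [this]

end Gaussian

section clt

variable {k : ℕ} {p : Fin k → ℝ}

lemma tendsto_mul_cexp_div_sqrt (c : ℝ) :
    Tendsto (fun N : ℕ => (N : ℂ) * (Complex.exp (Complex.I * (c / √N : ℝ)) - 1 -
      Complex.I * (c / √N : ℝ))) atTop (nhds (-(c ^ 2 / 2 : ℝ))) := by
  have hs : Tendsto (fun N : ℕ => c / √(N : ℝ)) atTop (nhds 0) :=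
    tendsto_const_nhds.div_atTop (Real.tendsto_sqrt_atTop.comp tendsto_natCast_atTop_atTop)
  have h0 : Tendsto (fun N : ℕ => c ^ 2 * |c / √(N : ℝ)| * Real.exp |c / √(N : ℝ)|) atTop
      (nhds 0) := by
    have := ((hs.abs.const_mul (c ^ 2)).mul ((Real.continuous_exp.tendsto _).comp hs.abs))
    simpa using this
  rw [tendsto_iff_norm_sub_tendsto_zero]
  refine squeeze_zero' (Eventually.of_forall fun _ => norm_nonneg _) ?_ h0
  filter_upwards [eventually_gt_atTop 0] with N hN
  have hN' : (0 : ℝ) < N := by exact_mod_cast hN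
  have hsq : √(N : ℝ) ^ 2 = N := Real.sq_sqrt hN'.le
  have hsp : 0 < √(N : ℝ) := Real.sqrt_pos.2 hN'
  set u : ℝ := c / √(N : ℝ) with hu
  have huc : (N : ℝ) * u ^ 2 = c ^ 2 := by
    rw [hu, div_pow, hsq]; field_simp
  have hb := Complex.norm_exp_sub_sum_le_norm_mul_exp (Complex.I * (u : ℂ)) 3
  have hn : ‖Complex.I * (u : ℂ)‖ = |u| := by simp
  rw [hn] at hb
  have huc' : (N : ℂ) * (u : ℂ) ^ 2 = (c : ℂ) ^ 2 := by exact_mod_cast huc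
  have h1 : (N : ℂ) * (Complex.exp (Complex.I * (u : ℂ)) - 1 - Complex.I * (u : ℂ)) -
      -((c ^ 2 / 2 : ℝ) : ℂ) = N * (Complex.exp (Complex.I * (u : ℂ)) -
        ∑ j ∈ Finset.range 3, (Complex.I * (u : ℂ)) ^ j / (j.factorial : ℂ)) := by
    simp only [Finset.sum_range_succ, Finset.range_zero, Finset.sum_empty, Nat.factorial,
      mul_pow, Complex.I_sq]
    push_cast
    linear_combination (-(1 : ℂ) / 2) * huc'
  rw [h1, norm_mul, Complex.norm_natCast]
  calc (N : ℝ) * _ ≤ N * (|u| ^ 3 * Real.exp |u|) := by gcongr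
    _ = c ^ 2 * |u| * Real.exp |u| := by
      rw [← huc, ← sq_abs u]; ring

lemma tendsto_sum_cexp_pow (hsum : ∑ a, p a = 1) (c : Fin k → ℝ) (hc : ∑ a, p a * c a = 0) :
    Tendsto (fun N : ℕ => (∑ a, (p a : ℂ) * Complex.exp (Complex.I * (c a / √N : ℝ))) ^ N) atTop
      (nhds (Complex.exp (-((∑ a, p a * c a ^ 2) / 2 : ℝ)))) := by
  have h := Complex.tendsto_one_add_pow_exp_of_tendsto
    (g := fun N : ℕ => (∑ a, (p a : ℂ) * Complex.exp (Complex.I * (c a / √N : ℝ))) - 1)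
    (t := (-((∑ a, p a * c a ^ 2) / 2 : ℝ) : ℂ)) ?_
  · simpa using h
  have h1 : Tendsto (fun N : ℕ => ∑ a, (p a : ℂ) * ((N : ℂ) *
      (Complex.exp (Complex.I * (c a / √N : ℝ)) - 1 - Complex.I * (c a / √N : ℝ)))) atTop
      (nhds (∑ a, (p a : ℂ) * (-(c a ^ 2 / 2 : ℝ)))) :=
    tendsto_finsetSum _ fun a _ => (tendsto_mul_cexp_div_sqrt (c a)).const_mul _
  convert h1 using 2 with N
  · have hs : (∑ a, (p a : ℂ)) = 1 := by exact_mod_cast hsum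
    have h0 : (∑ a, (p a : ℂ) * (c a : ℂ)) = 0 := by exact_mod_cast hc
    have h2 : ∑ a, (p a : ℂ) * (Complex.I * (c a / √N : ℝ)) = 0 := by
      have : ∀ a, (p a : ℂ) * (Complex.I * (c a / √N : ℝ)) =
          (p a : ℂ) * c a * (Complex.I / (√(N : ℝ) : ℝ)) := fun a => by push_cast; ring
      simp only [this, ← Finset.sum_mul, h0, zero_mul]
    calc _ = (N : ℂ) * ((∑ a, (p a : ℂ) * Complex.exp (Complex.I * (c a / √N : ℝ))) -
          ∑ a, (p a : ℂ) - ∑ a, (p a : ℂ) * (Complex.I * (c a / √N : ℝ))) := by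
          rw [hs, h2, sub_zero]
      _ = _ := by
          rw [← Finset.sum_sub_distrib, ← Finset.sum_sub_distrib, Finset.mul_sum]
          exact Finset.sum_congr rfl fun a _ => by ring
  · push_cast
    rw [Finset.sum_div, ← Finset.sum_neg_distrib]
    exact Finset.sum_congr rfl fun a _ => by ring

/-- The law of `X` under the i.i.d. measure on words of length `N`. -/
def wordLaw {Ω : Type*} [MeasurableSpace Ω] (p : Fin k → ℝ) (N : ℕ)
    (X : (Fin N → Fin k) → Ω) : Measure Ω :=
  ∑ w, ENNReal.ofReal (∏ i, p (w i)) • Measure.dirac (X w)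

section wordLaw

variable {Ω : Type*} [MeasurableSpace Ω] {N : ℕ}

lemma integral_wordLaw [MeasurableSingletonClass Ω] (hp : ∀ i, 0 ≤ p i)
    (X : (Fin N → Fin k) → Ω) {G : Type*} [NormedAddCommGroup G] [NormedSpace ℝ G]
    [CompleteSpace G] (F : Ω → G) :
    ∫ x, F x ∂(wordLaw p N X) = ∑ w, (∏ i, p (w i)) • F (X w) := by
  have hi : ∀ w, Integrable F (Measure.dirac (X w)) := fun w =>
    integrable_dirac (by simp)
  rw [wordLaw, integral_finsetSum_measure fun w _ => (hi w).smul_measure ENNReal.ofReal_ne_top]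
  refine Finset.sum_congr rfl fun w _ => ?_
  rw [integral_smul_measure, integral_dirac,
    ENNReal.toReal_ofReal (Finset.prod_nonneg fun i _ => hp _)]

lemma integral_wordLaw_real [MeasurableSingletonClass Ω] (hp : ∀ i, 0 ≤ p i)
    (X : (Fin N → Fin k) → Ω) (F : Ω → ℝ) :
    ∫ x, F x ∂(wordLaw p N X) = wordExp p N fun w => F (X w) := by
  simp only [integral_wordLaw hp, smul_eq_mul, wordExp]

lemma isProbabilityMeasure_wordLaw (hp : ∀ i, 0 ≤ p i) (hsum : ∑ i, p i = 1)
    (X : (Fin N → Fin k) → Ω) : IsProbabilityMeasure (wordLaw p N X) := by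
  constructor
  have h := wordExp_const (N := N) hsum 1
  simp only [wordExp, mul_one] at h
  simp only [wordLaw, Measure.coe_finsetSum, Finset.sum_apply, Measure.smul_apply,
    measure_univ, smul_eq_mul, mul_one]
  rw [← ENNReal.ofReal_sum_of_nonneg fun w _ => Finset.prod_nonneg fun i _ => hp _, h,
    ENNReal.ofReal_one]

end wordLaw

lemma sum_prod_cexp {N : ℕ} (f : Fin k → ℂ) :
    ∑ w : Fin N → Fin k, (∏ i, (p (w i) : ℂ)) * ∏ i, f (w i) = (∑ a, (p a : ℂ) * f a) ^ N := by
  simp only [← Finset.prod_mul_distrib]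
  rw [← Fin.prod_const, Finset.prod_univ_sum, Fintype.piFinset_univ]

/-- The letter counts of `w`, centered and rescaled. -/
def scaledCounts (m : ℕ) (p₁ : ℝ) {N : ℕ} (w : Fin N → Fin k) : EuclideanSpace ℝ (Fin m) :=
  WithLp.toLp 2 fun i => (counts m w i - N * p₁) / √(N * p₁)

lemma scaledCounts_apply (m : ℕ) (p₁ : ℝ) {N : ℕ} (w : Fin N → Fin k) (i : Fin m) :
    scaledCounts m p₁ w i = (counts m w i - N * p₁) / √(N * p₁) := rfl

lemma inner_scaledCounts {m : ℕ} {p₁ : ℝ} {N : ℕ} (w : Fin N → Fin k)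
    (t : EuclideanSpace ℝ (Fin m)) :
    inner ℝ (scaledCounts m p₁ w) t = ∑ j, (if h : (w j : ℕ) < m then
      (t ⟨w j, h⟩ - p₁ * ∑ i, t i) / √p₁ else (-p₁ * ∑ i, t i) / √p₁) / √N := by
  have h1 : ∀ a : Fin k, (if h : (a : ℕ) < m then
      (t ⟨a, h⟩ - p₁ * ∑ i, t i) / √p₁ else (-p₁ * ∑ i, t i) / √p₁) =
      (∑ i, t i * (letterStep m a i - p₁)) / √p₁ := by
    intro a
    simp only [letterStep, mul_sub, Finset.sum_sub_distrib, ← Finset.sum_mul]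
    split_ifs with h
    · simp [Pi.single_apply]
      ring_nf
    · simp
      ring_nf
  simp only [h1]
  simp only [PiLp.inner_apply, RCLike.inner_apply, conj_trivial, scaledCounts_apply, counts,
    Finset.sum_apply, Int.cast_sum]
  rw [← Finset.sum_div, ← Finset.sum_div, Finset.sum_comm, Real.sqrt_mul (Nat.cast_nonneg _)]
  simp only [mul_div_assoc', ← Finset.mul_sum, Finset.sum_sub_distrib, Finset.sum_const,
    Finset.card_univ, Fintype.card_fin, nsmul_eq_mul, ← Finset.sum_div]
  rw [div_div, mul_comm (√p₁)]

/-- The **central limit theorem** for letter counts, in terms of characteristic functions. -/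
lemma tendsto_charFun_scaledCounts {m : ℕ} {p₁ : ℝ} (hm : m ≤ k) (hp0 : ∀ i, 0 ≤ p i)
    (hsum : ∑ a, p a = 1) (hp : ∀ a : Fin k, (a : ℕ) < m → p a = p₁) (hp₁ : 0 < p₁)
    (t : EuclideanSpace ℝ (Fin m)) :
    Tendsto (fun N => charFun (wordLaw p N (scaledCounts m p₁)) t) atTop
      (nhds (Complex.exp (-(1 / 2) * (limitForm (-p₁) t.ofLp : ℂ)))) := by
  set c : Fin k → ℝ := fun a => if h : (a : ℕ) < m then
      (t ⟨a, h⟩ - p₁ * ∑ i, t i) / √p₁ else (-p₁ * ∑ i, t i) / √p₁ with hc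
  have hs : √p₁ ≠ 0 := (Real.sqrt_pos.2 hp₁).ne'
  have hs2 : √p₁ ^ 2 = p₁ := Real.sq_sqrt hp₁.le
  have h1 : ∑ a, p a * c a = 0 := by
    rw [hc, sum_letters hm hsum hp (fun i => (t i - p₁ * ∑ i, t i) / √p₁), ← Finset.sum_div,
      Finset.sum_sub_distrib]
    simp only [Finset.sum_const, Finset.card_univ, Fintype.card_fin, nsmul_eq_mul]
    field_simp
    ring
  have h2 : ∑ a, p a * c a ^ 2 = limitForm (-p₁) t.ofLp := by
    have : ∀ a, c a ^ 2 = if h : (a : ℕ) < m then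
      ((t ⟨a, h⟩ - p₁ * ∑ i, t i) / √p₁) ^ 2 else ((-p₁ * ∑ i, t i) / √p₁) ^ 2 := by
      intro a
      simp only [hc]
      split_ifs <;> rfl
    simp only [this]
    rw [sum_letters hm hsum hp (fun i => ((t i - p₁ * ∑ i, t i) / √p₁) ^ 2)]
    simp only [div_pow, hs2, ← Finset.sum_div, sub_sq, Finset.sum_add_distrib,
      Finset.sum_sub_distrib, Finset.sum_const, Finset.card_univ, Fintype.card_fin, nsmul_eq_mul,
      ← Finset.sum_mul, ← Finset.mul_sum, limitForm]
    field_simp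
    ring
  have h3 := tendsto_sum_cexp_pow hsum c h1
  rw [h2] at h3
  convert h3 using 2 with N
  · rw [charFun_apply, integral_wordLaw hp0, ← sum_prod_cexp]
    refine Finset.sum_congr rfl fun w _ => ?_
    rw [inner_scaledCounts, Complex.real_smul, ← Complex.exp_sum]
    push_cast
    rw [Finset.sum_mul]
    congr 2
    exact Finset.sum_congr rfl fun j _ => mul_comm _ _
  · push_cast
    ring_nf

end clt

section weak

variable {Ω : Type*} [TopologicalSpace Ω] [MeasurableSpace Ω] [OpensMeasurableSpace Ω]
  {μ : ℕ → ProbabilityMeasure Ω} {ν : ProbabilityMeasure Ω} {W : Ω → ℝ} {C : ℝ}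

lemma tendsto_integral_of_bounded (h : Tendsto μ atTop (nhds ν)) {f : Ω → ℝ} (hf : Continuous f)
    {R : ℝ} (hR : ∀ x, |f x| ≤ R) :
    Tendsto (fun N => ∫ x, f x ∂(μ N : Measure Ω)) atTop (nhds (∫ x, f x ∂(ν : Measure Ω))) :=
  ProbabilityMeasure.tendsto_iff_forall_integral_tendsto.1 h
    (BoundedContinuousFunction.ofNormedAddCommGroup f hf R hR)

lemma sub_min_le_sq_div (x : ℝ) {R : ℝ} (hR : 0 < R) : x - min x R ≤ x ^ 2 / R := by
  rw [le_div_iff₀ hR]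
  rcases le_total x R with h | h
  · rw [min_eq_left h]; nlinarith [sq_nonneg x]
  · rw [min_eq_right h]; nlinarith [sq_nonneg (x - R)]

lemma integrable_of_weak_limit (h : Tendsto μ atTop (nhds ν)) (hW : Continuous W)
    (hW0 : ∀ x, 0 ≤ W x) (hi : ∀ N, Integrable W (μ N : Measure Ω))
    (hC : ∀ᶠ N in atTop, ∫ x, W x ∂(μ N : Measure Ω) ≤ C) : Integrable W (ν : Measure Ω) := by
  have hb : ∀ n : ℕ, ∫ x, min (W x) n ∂(ν : Measure Ω) ≤ C := by
    intro n
    refine le_of_tendsto (tendsto_integral_of_bounded h (f := fun x => min (W x) n) (by fun_prop)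
      (R := n) fun x => ?_) ?_
    · rw [abs_of_nonneg (le_min (hW0 x) (Nat.cast_nonneg n))]
      exact min_le_right _ _
    · filter_upwards [hC] with N hN
      refine le_trans (integral_mono_of_nonneg (ae_of_all _ fun x =>
        le_min (hW0 x) (Nat.cast_nonneg n)) (hi N) (ae_of_all _ fun x => min_le_left _ _)) hN
  have hInt : ∀ n : ℕ, Integrable (fun x => min (W x) n) (ν : Measure Ω) := fun n =>
    Integrable.of_bound (by fun_prop) (n : ℝ) (ae_of_all _ fun x => by
      rw [Real.norm_eq_abs, abs_of_nonneg (le_min (hW0 x) (Nat.cast_nonneg n))]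
      exact min_le_right _ _)
  refine ⟨hW.measurable.aestronglyMeasurable, ?_⟩
  rw [hasFiniteIntegral_iff_ofReal (ae_of_all _ hW0)]
  have h1 : ∀ x, ENNReal.ofReal (W x) =
      liminf (fun n : ℕ => ENNReal.ofReal (min (W x) n)) atTop := by
    intro x
    refine (Tendsto.liminf_eq ?_).symm
    refine tendsto_const_nhds.congr' ?_
    obtain ⟨n₀, hn₀⟩ := exists_nat_ge (W x)
    filter_upwards [eventually_ge_atTop n₀] with n hn
    rw [min_eq_left (hn₀.trans (by exact_mod_cast hn))]
  simp only [h1]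
  refine (lintegral_liminf_le fun n => by fun_prop).trans_lt ?_
  refine lt_of_le_of_lt (b := ENNReal.ofReal C) ?_ ENNReal.ofReal_lt_top
  refine liminf_le_of_le (by isBoundedDefault) fun b hb' => ?_
  obtain ⟨n, hn⟩ := hb'.exists
  refine hn.trans ?_
  rw [← ofReal_integral_eq_lintegral_ofReal (hInt n) (ae_of_all _ fun x =>
        le_min (hW0 x) (Nat.cast_nonneg n))]
  exact ENNReal.ofReal_le_ofReal (hb n)

lemma tendsto_integral_mul_of_sq_bounded (h : Tendsto μ atTop (nhds ν)) (hW : Continuous W)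
    (hW0 : ∀ x, 0 ≤ W x) (hi : ∀ N, Integrable (fun x => W x ^ 2) (μ N : Measure Ω))
    (hC : ∀ᶠ N in atTop, ∫ x, W x ^ 2 ∂(μ N : Measure Ω) ≤ C) (hWν : Integrable W (ν : Measure Ω))
    (hWμ : ∀ N, Integrable W (μ N : Measure Ω))
    {χ : Ω → ℝ} (hχ : Continuous χ) (hχ0 : ∀ x, 0 ≤ χ x) (hχ1 : ∀ x, χ x ≤ 1) :
    Tendsto (fun N => ∫ x, W x * χ x ∂(μ N : Measure Ω)) atTop
      (nhds (∫ x, W x * χ x ∂(ν : Measure Ω))) := by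
  have hWχ : ∀ (ρ : ProbabilityMeasure Ω), Integrable W (ρ : Measure Ω) →
      Integrable (fun x => W x * χ x) (ρ : Measure Ω) := fun ρ hρ =>
    hρ.mono' (by fun_prop) (ae_of_all _ fun x => by
      rw [Real.norm_eq_abs, abs_of_nonneg (mul_nonneg (hW0 x) (hχ0 x))]
      exact mul_le_of_le_one_right (hW0 x) (hχ1 x))
  have hmin : ∀ (ρ : ProbabilityMeasure Ω) (n : ℕ),
      Integrable (fun x => min (W x) n * χ x) (ρ : Measure Ω) := fun ρ n =>
    Integrable.of_bound (by fun_prop) (n : ℝ) (ae_of_all _ fun x => by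
      have h0 : 0 ≤ min (W x) n := le_min (hW0 x) (Nat.cast_nonneg n)
      rw [Real.norm_eq_abs, abs_of_nonneg (mul_nonneg h0 (hχ0 x))]
      exact (mul_le_of_le_one_right h0 (hχ1 x)).trans (min_le_right _ _))
  have hlim : Tendsto (fun n : ℕ => ∫ x, min (W x) n * χ x ∂(ν : Measure Ω)) atTop
      (nhds (∫ x, W x * χ x ∂(ν : Measure Ω))) := by
    refine tendsto_integral_of_dominated_convergence W (fun n => by fun_prop) hWν
      (fun n => ae_of_all _ fun x => ?_) (ae_of_all _ fun x => ?_)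
    · have h0 : 0 ≤ min (W x) n := le_min (hW0 x) (Nat.cast_nonneg n)
      rw [Real.norm_eq_abs, abs_of_nonneg (mul_nonneg h0 (hχ0 x))]
      exact (mul_le_of_le_one_right h0 (hχ1 x)).trans (min_le_left _ _)
    · refine tendsto_const_nhds.congr' ?_
      obtain ⟨n₀, hn₀⟩ := exists_nat_ge (W x)
      filter_upwards [eventually_ge_atTop n₀] with n hn
      rw [min_eq_left (hn₀.trans (by exact_mod_cast hn))]
  rw [Metric.tendsto_atTop]
  intro ε hε
  obtain ⟨n, ⟨hn1, hn2⟩, hn0⟩ := (((Metric.tendsto_nhds.1 hlim (ε / 3) (by positivity)).and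
    ((tendsto_const_div_atTop_nhds_zero_nat C).eventually
      (gt_mem_nhds (show (0 : ℝ) < ε / 3 by positivity)))).and (eventually_gt_atTop 0)).exists
  have hn0' : (0 : ℝ) < n := by exact_mod_cast hn0
  have hb := tendsto_integral_of_bounded h (f := fun x => min (W x) n * χ x) (by fun_prop)
    (R := n) fun x => by
      have h0 : 0 ≤ min (W x) n := le_min (hW0 x) (Nat.cast_nonneg n)
      rw [abs_of_nonneg (mul_nonneg h0 (hχ0 x))]
      exact (mul_le_of_le_one_right h0 (hχ1 x)).trans (min_le_right _ _)
  obtain ⟨N₀, hN₀⟩ := (((Metric.tendsto_nhds.1 hb (ε / 3) (by positivity)).and hC)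
    |> eventually_atTop.1)
  refine ⟨N₀, fun N hN => ?_⟩
  obtain ⟨h1, h2⟩ := hN₀ N hN
  have h3 : |∫ x, W x * χ x ∂(μ N : Measure Ω) - ∫ x, min (W x) n * χ x ∂(μ N : Measure Ω)|
      ≤ C / n := by
    rw [← integral_sub (hWχ _ (hWμ N)) (hmin _ n)]
    refine (abs_integral_le_integral_abs).trans ?_
    calc _ ≤ ∫ x, W x ^ 2 / n ∂(μ N : Measure Ω) := by
          refine integral_mono_of_nonneg (ae_of_all _ fun x => abs_nonneg _)
            ((hi N).div_const _) (ae_of_all _ fun x => ?_)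
          have h0 : 0 ≤ W x - min (W x) n := sub_nonneg.2 (min_le_left _ _)
          simp only [← sub_mul]
          rw [abs_of_nonneg (mul_nonneg h0 (hχ0 x))]
          exact (mul_le_of_le_one_right h0 (hχ1 x)).trans (sub_min_le_sq_div _ hn0')
      _ ≤ C / n := by
          rw [integral_div]
          gcongr
  rw [Real.dist_eq] at *
  rw [abs_lt] at *
  rw [abs_le] at h3
  constructor <;> linarith [h1.1, h1.2, h3.1, h3.2, hn1.1, hn1.2]

end weak

/-- The Vandermonde product `∏_{i<j} (x i - x j)`. -/
def diffProd {n : ℕ} (x : Fin n → ℝ) : ℝ :=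
  ∏ q ∈ Finset.univ.filter fun q : Fin n × Fin n => q.1 < q.2, (x q.1 - x q.2)

section moments

variable {k m : ℕ} {p : Fin k → ℝ} {p₁ : ℝ}

lemma wordExp_exp_scaledCounts_le (hm : m ≤ k) (hp0 : ∀ i, 0 ≤ p i)
    (hsum : ∑ a, p a = 1) (hp : ∀ a : Fin k, (a : ℕ) < m → p a = p₁) (hp₁ : 0 < p₁)
    {N : ℕ} (hN : 0 < N) {τ : ℝ} (hτ : |τ| ≤ √(N * p₁)) (i : Fin m) :
    wordExp p N (fun w => Real.exp (τ * scaledCounts m p₁ w i)) ≤ Real.exp (τ ^ 2) := by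
  have hN' : (0 : ℝ) < N := by exact_mod_cast hN
  have hs : 0 < √(N * p₁) := Real.sqrt_pos.2 (by positivity)
  have hs2 : √(N * p₁) ^ 2 = N * p₁ := Real.sq_sqrt (by positivity)
  set u : ℝ := τ / √(N * p₁) with hu
  have hu1 : |u| ≤ 1 := by
    rw [hu, abs_div, abs_of_pos hs]
    exact (div_le_one hs).2 hτ
  have hu2 : N * p₁ * u ^ 2 = τ ^ 2 := by
    rw [hu, div_pow, hs2]; field_simp
  have h1 : ∀ w : Fin N → Fin k, Real.exp (τ * scaledCounts m p₁ w i) =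
      ∏ j, (Real.exp (-(p₁ * u)) * (1 + (Real.exp u - 1) * letterStep m (w j) i)) := by
    intro w
    have h2 : ∀ a : Fin k, Real.exp (-(p₁ * u)) * (1 + (Real.exp u - 1) * letterStep m a i) =
        Real.exp (u * (letterStep m a i - p₁)) := by
      intro a
      have : letterStep m a i = 0 ∨ letterStep m a i = 1 := by
        unfold letterStep
        split_ifs
        · simp only [Pi.single_apply]; split_ifs <;> simp
        · simp
      rcases this with h | h <;> rw [h]
      · simp; ring_nf
      · rw [Int.cast_one, mul_one, add_sub_cancel, ← Real.exp_add]; ring_nf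
    simp only [h2]
    rw [← Real.exp_sum, ← Finset.mul_sum, Finset.sum_sub_distrib]
    simp only [scaledCounts_apply, counts, Finset.sum_apply, Int.cast_sum, Finset.sum_const,
      Finset.card_univ, Fintype.card_fin, nsmul_eq_mul]
    congr 1
    rw [hu]; ring
  have h3 : ∑ a, p a * (letterStep m a i : ℝ) = p₁ := by
    have h4 : ∀ a : Fin k, (letterStep m a i : ℝ) =
        if h : (a : ℕ) < m then (if i = ⟨a, h⟩ then 1 else 0) else 0 := by
      intro a
      unfold letterStep
      split_ifs with h h' <;> simp [*]
    simp only [h4]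
    have := sum_letters hm hsum hp (fun r => if i = r then 1 else 0) 0
    simpa using this
  simp only [h1]
  rw [wordExp_prod fun a =>
    Real.exp (-(p₁ * u)) * (1 + (Real.exp u - 1) * (letterStep m a i : ℝ))]
  have h5 : ∑ a, p a * (Real.exp (-(p₁ * u)) * (1 + (Real.exp u - 1) * letterStep m a i)) =
      Real.exp (-(p₁ * u)) * (1 + (Real.exp u - 1) * p₁) := by
    rw [← h3] at *
    calc _ = Real.exp (-((∑ a, p a * (letterStep m a i : ℝ)) * u)) *
          (∑ a, p a + (Real.exp u - 1) * ∑ a, p a * (letterStep m a i : ℝ)) := by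
          rw [Finset.mul_sum _ _ (Real.exp u - 1), ← Finset.sum_add_distrib, Finset.mul_sum]
          exact Finset.sum_congr rfl fun a _ => by ring
      _ = _ := by rw [hsum]
  rw [h5]
  have h6 : Real.exp u - 1 ≤ u + u ^ 2 := by
    have := (abs_le.1 (Real.abs_exp_sub_one_sub_id_le hu1)).2
    linarith
  have h7 : 1 + (Real.exp u - 1) * p₁ ≤ Real.exp (p₁ * (u + u ^ 2)) := by
    have := Real.add_one_le_exp (p₁ * (u + u ^ 2))
    nlinarith
  have h8 : 0 ≤ 1 + (Real.exp u - 1) * p₁ := by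
    have hp1 : p₁ ≤ 1 := by
      rw [← hp ⟨i, by omega⟩ i.2, ← hsum]
      exact Finset.single_le_sum (fun a _ => hp0 a) (Finset.mem_univ _)
    nlinarith [Real.exp_pos u]
  calc _ ≤ (Real.exp (-(p₁ * u)) * Real.exp (p₁ * (u + u ^ 2))) ^ N := by gcongr
    _ = Real.exp (τ ^ 2) := by
      rw [← Real.exp_add, ← Real.exp_nat_mul, ← hu2]; ring_nf

lemma abs_diffProd_le {n : ℕ} (x : Fin n → ℝ) :
    |diffProd x| ≤ (∑ i, |x i|) ^
      (Finset.univ.filter fun q : Fin n × Fin n => q.1 < q.2).card := by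
  rw [diffProd, Finset.abs_prod, ← Finset.prod_const]
  refine Finset.prod_le_prod (fun _ _ => abs_nonneg _) fun q hq => ?_
  have hq' : q.1 ≠ q.2 := (Finset.mem_filter.1 hq).2.ne
  calc |x q.1 - x q.2| ≤ |x q.1| + |x q.2| := norm_sub_le (x q.1) (x q.2)
    _ = ∑ i ∈ {q.1, q.2}, |x i| := by convert (Finset.sum_pair (f := fun i => |x i|) hq').symm
    _ ≤ ∑ i, |x i| := Finset.sum_le_sum_of_subset_of_nonneg (Finset.subset_univ _)
      fun _ _ _ => abs_nonneg _

lemma exp_sum_abs_le {n : ℕ} (x : Fin (n + 1) → ℝ) :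
    Real.exp (∑ i, |x i|) ≤
      ∑ i, (Real.exp (((n + 1 : ℕ) : ℝ) * x i) + Real.exp (-((n + 1 : ℕ) : ℝ) * x i)) := by
  obtain ⟨i, -, hi⟩ := Finset.exists_max_image Finset.univ (fun i => |x i|)
    Finset.univ_nonempty
  have h1 : ∑ j, |x j| ≤ ((n + 1 : ℕ) : ℝ) * |x i| := by
    have := Finset.sum_le_card_nsmul Finset.univ (fun j => |x j|) |x i| fun j hj => hi j hj
    simpa using this
  calc _ ≤ Real.exp (((n + 1 : ℕ) : ℝ) * |x i|) := Real.exp_le_exp.2 h1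
    _ ≤ Real.exp (((n + 1 : ℕ) : ℝ) * x i) + Real.exp (-((n + 1 : ℕ) : ℝ) * x i) := by
      rcases abs_cases (x i) with ⟨h, -⟩ | ⟨h, -⟩ <;> rw [h]
      · linarith [Real.exp_pos (-((n + 1 : ℕ) : ℝ) * x i)]
      · rw [mul_neg, ← neg_mul]
        linarith [Real.exp_pos (((n + 1 : ℕ) : ℝ) * x i)]
    _ ≤ _ := Finset.single_le_sum
      (f := fun i => Real.exp (((n + 1 : ℕ) : ℝ) * x i) + Real.exp (-((n + 1 : ℕ) : ℝ) * x i))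
      (fun j _ => by positivity) (Finset.mem_univ i)

/-- The moments of the Vandermonde product of the rescaled letter counts are bounded. -/
lemma exists_wordExp_diffProd_le (hm : m + 1 ≤ k) (hp0 : ∀ i, 0 ≤ p i)
    (hsum : ∑ a, p a = 1) (hp : ∀ a : Fin k, (a : ℕ) < m + 1 → p a = p₁) (hp₁ : 0 < p₁) :
    ∃ C : ℝ, ∀ᶠ N : ℕ in atTop, wordExp p N
      (fun w => (diffProd (scaledCounts (m + 1) p₁ w) ^ 2) ^ 2) ≤ C := by
  set d := (Finset.univ.filter fun q : Fin (m + 1) × Fin (m + 1) => q.1 < q.2).card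
  set c : ℝ := ((m + 1 : ℕ) : ℝ) with hc
  refine ⟨(d * 4).factorial * ∑ _i : Fin (m + 1), (Real.exp (c ^ 2) + Real.exp ((-c) ^ 2)), ?_⟩
  have hlim : Tendsto (fun N : ℕ => √((N : ℝ) * p₁)) atTop atTop :=
    Real.tendsto_sqrt_atTop.comp (tendsto_natCast_atTop_atTop.atTop_mul_const hp₁)
  filter_upwards [hlim.eventually_ge_atTop c, eventually_gt_atTop 0] with N hN hN0
  have hc0 : 0 ≤ c := Nat.cast_nonneg _
  have h1 : ∀ w : Fin N → Fin k, (diffProd (scaledCounts (m + 1) p₁ w) ^ 2) ^ 2 ≤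
      (d * 4).factorial * ∑ i, (Real.exp (c * scaledCounts (m + 1) p₁ w i) +
        Real.exp (-c * scaledCounts (m + 1) p₁ w i)) := by
    intro w
    set x := scaledCounts (m + 1) p₁ w
    have h2 := abs_diffProd_le x.ofLp
    have h3 : 0 ≤ ∑ i, |x i| := Finset.sum_nonneg fun _ _ => abs_nonneg _
    calc (diffProd x ^ 2) ^ 2 = |diffProd x| ^ 4 := by
          rw [← pow_mul]
          exact (Even.pow_abs (by decide) _).symm
      _ ≤ ((∑ i, |x i|) ^ d) ^ 4 := by gcongr
      _ = (∑ i, |x i|) ^ (d * 4) := (pow_mul _ _ _).symm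
      _ ≤ (d * 4).factorial * Real.exp (∑ i, |x i|) := by
          have := Real.pow_div_factorial_le_exp _ h3 (d * 4)
          rwa [div_le_iff₀' (by positivity)] at this
      _ ≤ _ := by
          gcongr
          exact exp_sum_abs_le x.ofLp
  refine (wordExp_mono hp0 h1).trans ?_
  rw [wordExp_const_mul, wordExp_sum]
  simp only [wordExp_add]
  gcongr
  · exact wordExp_exp_scaledCounts_le hm hp0 hsum hp hp₁ hN0 (by rwa [abs_of_nonneg hc0]) _
  · exact wordExp_exp_scaledCounts_le hm hp0 hsum hp hp₁ hN0
      (by rwa [abs_neg, abs_of_nonneg hc0]) _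

end moments

section orthant

variable {ι : Type*} [Fintype ι]

/-- The orthant `(-∞, s]^ι`. -/
def orthant (ι : Type*) (s : ℝ) : Set (EuclideanSpace ℝ ι) := {x | ∀ i, x i ≤ s}

lemma measurableSet_orthant (s : ℝ) : MeasurableSet (orthant ι s) := by
  have : orthant ι s = ⋂ i, {x : EuclideanSpace ℝ ι | x i ≤ s} := by ext; simp [orthant]
  rw [this]
  exact MeasurableSet.iInter fun i => (isClosed_le (by fun_prop) continuous_const).measurableSet

/-- A continuous function between the indicators of the orthants at `a` and `b`. -/
def orthantCutoff (a b : ℝ) (x : EuclideanSpace ℝ ι) : ℝ :=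
  ∏ i, max 0 (min 1 ((b - x i) / (b - a)))

lemma continuous_orthantCutoff (a b : ℝ) : Continuous (orthantCutoff (ι := ι) a b) := by
  unfold orthantCutoff
  fun_prop

lemma orthantCutoff_nonneg (a b : ℝ) (x : EuclideanSpace ℝ ι) : 0 ≤ orthantCutoff a b x :=
  Finset.prod_nonneg fun _ _ => le_max_left _ _

lemma orthantCutoff_le_one (a b : ℝ) (x : EuclideanSpace ℝ ι) : orthantCutoff a b x ≤ 1 :=
  Finset.prod_le_one (fun _ _ => le_max_left _ _) fun _ _ => max_le zero_le_one (min_le_left _ _)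

lemma orthantCutoff_eq_one {a b : ℝ} (hab : a < b) {x : EuclideanSpace ℝ ι}
    (hx : x ∈ orthant ι a) : orthantCutoff a b x = 1 := by
  refine Finset.prod_eq_one fun i _ => ?_
  have : 1 ≤ (b - x i) / (b - a) := by
    rw [le_div_iff₀ (by linarith)]
    linarith [hx i]
  rw [min_eq_left this, max_eq_right zero_le_one]

lemma orthantCutoff_eq_zero {a b : ℝ} (hab : a < b) {x : EuclideanSpace ℝ ι}
    (hx : x ∉ orthant ι b) : orthantCutoff a b x = 0 := by
  obtain ⟨i, hi⟩ := not_forall.1 hx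
  refine Finset.prod_eq_zero (Finset.mem_univ i) ?_
  have : (b - x i) / (b - a) ≤ 0 :=
    div_nonpos_of_nonpos_of_nonneg (by linarith [not_le.1 hi]) (by linarith)
  exact max_eq_left ((min_le_right _ _).trans this)

variable {W : EuclideanSpace ℝ ι → ℝ}

lemma integrable_mul_orthantCutoff {μ : Measure (EuclideanSpace ℝ ι)} (hW : Integrable W μ)
    (a b : ℝ) : Integrable (fun x => W x * orthantCutoff a b x) μ := by
  refine hW.mul_bdd (c := 1) (continuous_orthantCutoff a b).aestronglyMeasurable
    (ae_of_all _ fun x => ?_)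
  rw [Real.norm_eq_abs, abs_of_nonneg (orthantCutoff_nonneg a b x)]
  exact orthantCutoff_le_one a b x

lemma setIntegral_orthant_le {μ : Measure (EuclideanSpace ℝ ι)} (hW : Integrable W μ)
    (hW0 : ∀ x, 0 ≤ W x) {a b : ℝ} (hab : a < b) :
    ∫ x in orthant ι a, W x ∂μ ≤ ∫ x, W x * orthantCutoff a b x ∂μ := by
  rw [← integral_indicator (measurableSet_orthant a)]
  refine integral_mono (hW.indicator (measurableSet_orthant a))
    (integrable_mul_orthantCutoff hW a b) fun x => ?_
  simp only [Set.indicator_apply]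
  split_ifs with h
  · rw [orthantCutoff_eq_one hab h, mul_one]
  · exact mul_nonneg (hW0 x) (orthantCutoff_nonneg a b x)

lemma le_setIntegral_orthant {μ : Measure (EuclideanSpace ℝ ι)} (hW : Integrable W μ)
    (hW0 : ∀ x, 0 ≤ W x) {a b : ℝ} (hab : a < b) :
    ∫ x, W x * orthantCutoff a b x ∂μ ≤ ∫ x in orthant ι b, W x ∂μ := by
  rw [← integral_indicator (measurableSet_orthant b)]
  refine integral_mono (integrable_mul_orthantCutoff hW a b)
    (hW.indicator (measurableSet_orthant b)) fun x => ?_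
  simp only [Set.indicator_apply]
  split_ifs with h
  · exact mul_le_of_le_one_right (hW0 x) (orthantCutoff_le_one a b x)
  · rw [orthantCutoff_eq_zero hab h, mul_zero]

lemma continuous_setIntegral_orthant {ν : Measure (EuclideanSpace ℝ ι)} (hW : Integrable W ν)
    (hν : ∀ i s, ν {x | x i = s} = 0) : Continuous fun s => ∫ x in orthant ι s, W x ∂ν := by
  simp only [← integral_indicator (measurableSet_orthant _)]
  refine continuous_iff_continuousAt.2 fun s => ?_
  refine tendsto_integral_filter_of_dominated_convergence (fun x => ‖W x‖)
    (Eventually.of_forall fun a => (hW.indicator (measurableSet_orthant a)).aestronglyMeasurable)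
    (Eventually.of_forall fun a => ae_of_all _ fun x => norm_indicator_le_norm_self _ _)
    hW.norm ?_
  have h : ∀ᵐ x ∂ν, ∀ i, x i ≠ s := ae_all_iff.2 fun i => by
    rw [ae_iff]
    simpa using hν i s
  filter_upwards [h] with x hx
  refine tendsto_const_nhds.congr' ?_
  have h1 : ∀ᶠ a in nhds s, ∀ i, (x i ≤ s ↔ x i ≤ a) := by
    refine eventually_all.2 fun i => ?_
    rcases lt_or_gt_of_ne (hx i) with hi | hi
    · filter_upwards [lt_mem_nhds hi] with a ha
      exact ⟨fun _ => ha.le, fun _ => hi.le⟩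
    · filter_upwards [gt_mem_nhds hi] with a ha
      exact ⟨fun h => absurd h hi.not_ge, fun h => absurd h ha.not_ge⟩
  filter_upwards [h1] with a ha
  have : x ∈ orthant ι s ↔ x ∈ orthant ι a := forall_congr' ha
  simp only [Set.indicator_apply, this]

lemma tendsto_setIntegral_orthant {μ : ℕ → Measure (EuclideanSpace ℝ ι)}
    {ν : Measure (EuclideanSpace ℝ ι)} (hW0 : ∀ x, 0 ≤ W x) (hWμ : ∀ N, Integrable W (μ N))
    (hW : Integrable W ν) (hν : ∀ i s, ν {x | x i = s} = 0)
    (h : ∀ a b, Tendsto (fun N => ∫ x, W x * orthantCutoff a b x ∂(μ N)) atTop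
      (nhds (∫ x, W x * orthantCutoff a b x ∂ν)))
    {s : ℕ → ℝ} {s₀ : ℝ} (hs : Tendsto s atTop (nhds s₀)) :
    Tendsto (fun N => ∫ x in orthant ι (s N), W x ∂(μ N)) atTop
      (nhds (∫ x in orthant ι s₀, W x ∂ν)) := by
  have hc := (continuous_setIntegral_orthant hW hν).tendsto s₀
  have hmono : ∀ (ρ : Measure (EuclideanSpace ℝ ι)), Integrable W ρ → ∀ a b : ℝ, a ≤ b →
      ∫ x in orthant ι a, W x ∂ρ ≤ ∫ x in orthant ι b, W x ∂ρ := fun ρ hρ a b hab =>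
    setIntegral_mono_set hρ.integrableOn (ae_of_all _ hW0)
      (show orthant ι a ≤ orthant ι b from fun x hx i => (hx i).trans hab).eventuallyLE
  refine tendsto_order.2 ⟨fun y hy => ?_, fun y hy => ?_⟩
  · obtain ⟨δ, hδ, hb⟩ := Metric.eventually_nhds_iff.1 (hc.eventually (lt_mem_nhds hy))
    have h1 : y < ∫ x, W x * orthantCutoff (s₀ - δ / 2) (s₀ - δ / 4) x ∂ν :=
      (hb (y := s₀ - δ / 2) (by rw [Real.dist_eq, abs_lt]; constructor <;> linarith)).trans_le
        (setIntegral_orthant_le hW hW0 (by linarith))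
    filter_upwards [(h _ _).eventually (lt_mem_nhds h1),
      hs.eventually (lt_mem_nhds (show s₀ - δ / 4 < s₀ by linarith))] with N hN hsN
    exact hN.trans_le ((le_setIntegral_orthant (hWμ N) hW0 (by linarith)).trans
      (hmono _ (hWμ N) _ _ hsN.le))
  · obtain ⟨δ, hδ, hb⟩ := Metric.eventually_nhds_iff.1 (hc.eventually (gt_mem_nhds hy))
    have h1 : ∫ x, W x * orthantCutoff (s₀ + δ / 4) (s₀ + δ / 2) x ∂ν < y :=
      (le_setIntegral_orthant hW hW0 (by linarith)).trans_lt
        (hb (y := s₀ + δ / 2) (by rw [Real.dist_eq, abs_lt]; constructor <;> linarith))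
    filter_upwards [(h _ _).eventually (gt_mem_nhds h1),
      hs.eventually (gt_mem_nhds (show s₀ < s₀ + δ / 4 by linarith))] with N hN hsN
    exact ((hmono _ (hWμ N) _ _ hsN.le).trans
      (setIntegral_orthant_le (hWμ N) hW0 (by linarith))).trans_lt hN

end orthant

section limit

lemma diffProd_sq {n : ℕ} (x : Fin n → ℝ) :
    diffProd x ^ 2 = (Matrix.vandermonde x).det ^ 2 := by
  rw [Matrix.det_vandermonde, diffProd, Finset.prod_filter, Fintype.prod_prod_type,
    ← Finset.prod_pow, ← Finset.prod_pow]
  refine Finset.prod_congr rfl fun i _ => ?_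
  simp only
  rw [← Finset.prod_filter, ← Finset.prod_pow, ← Finset.prod_pow]
  refine Finset.prod_congr (by ext; simp) fun j _ => by ring

lemma diffProd_ne_zero_of_injective {n : ℕ} {x : Fin n → ℝ} (hx : Function.Injective x) :
    diffProd x ≠ 0 :=
  Finset.prod_ne_zero_iff.2 fun _ hq =>
    sub_ne_zero.2 fun h => (Finset.mem_filter.1 hq).2.ne (hx h)

lemma continuous_diffProd {n : ℕ} : Continuous (diffProd (n := n)) := by
  unfold diffProd
  fun_prop

section

variable {ι : Type*} [Fintype ι] {ν : Measure (EuclideanSpace ℝ ι)} {K r : ℝ}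

lemma continuous_limitForm : Continuous (limitForm (ι := ι) r) := by
  unfold limitForm
  fun_prop

lemma integral_limit_law (hK : 0 < K) (hν : ν = volume.withDensity fun x => ENNReal.ofReal
      (K * Real.exp (-limitForm r x.ofLp / 2))) (F : EuclideanSpace ℝ ι → ℝ) :
    ∫ x, F x ∂ν = K * ∫ ξ : ι → ℝ, F (WithLp.toLp 2 ξ) * Real.exp (-limitForm r ξ / 2) := by
  have hc : Continuous fun x : EuclideanSpace ℝ ι => K * Real.exp (-limitForm r x.ofLp / 2) := by
    have := continuous_limitForm (ι := ι) (r := r)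
    fun_prop
  rw [hν, integral_withDensity_eq_integral_toReal_smul hc.measurable.ennreal_ofReal
    (ae_of_all _ fun _ => ENNReal.ofReal_lt_top), ← integral_const_mul,
    ← (PiLp.volume_preserving_toLp ι).integral_comp
      (MeasurableEquiv.toLp 2 (ι → ℝ)).measurableEmbedding]
  refine integral_congr_ae (ae_of_all _ fun ξ => ?_)
  simp only [smul_eq_mul]
  rw [ENNReal.toReal_ofReal (by positivity)]
  ring

lemma limit_law_hyperplane (hν : ν = volume.withDensity fun x => ENNReal.ofReal
      (K * Real.exp (-limitForm r x.ofLp / 2))) (i : ι) (s : ℝ) : ν {x | x i = s} = 0 := by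
  have h1 : ν ≪ volume := by rw [hν]; exact withDensity_absolutelyContinuous _ _
  refine h1 ?_
  have hm : MeasurableSet {x : EuclideanSpace ℝ ι | x i = s} :=
    (isClosed_eq (by fun_prop) continuous_const).measurableSet
  rw [← (PiLp.volume_preserving_toLp ι).measure_preimage hm.nullMeasurableSet]
  exact Measure.pi_hyperplane (fun _ : ι => (volume : Measure ℝ)) i s

lemma integral_limit_law_pos (hK : 0 < K) (hν : ν = volume.withDensity fun x => ENNReal.ofReal
      (K * Real.exp (-limitForm r x.ofLp / 2))) {W : EuclideanSpace ℝ ι → ℝ}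
    (hc : Continuous W) (hW0 : ∀ x, 0 ≤ W x) (hW : Integrable W ν) {x₀ : EuclideanSpace ℝ ι}
    (hx₀ : W x₀ ≠ 0) : 0 < ∫ x, W x ∂ν := by
  rw [integral_pos_iff_support_of_nonneg hW0 hW]
  have hcont : Continuous fun x : EuclideanSpace ℝ ι =>
      K * Real.exp (-limitForm r x.ofLp / 2) := by
    have := continuous_limitForm (ι := ι) (r := r)
    fun_prop
  have h1 : volume ≪ ν := by
    rw [hν]
    refine withDensity_absolutelyContinuous' hcont.measurable.ennreal_ofReal.aemeasurable
      (ae_of_all _ fun x => ?_)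
    exact (ENNReal.ofReal_pos.2 (by positivity)).ne'
  refine pos_iff_ne_zero.2 fun h => ?_
  exact (hc.isOpen_support.measure_pos volume ⟨x₀, hx₀⟩).ne' (h1 h)

end

variable {k m : ℕ} {p : Fin k → ℝ} {p₁ : ℝ}

lemma integrable_wordLaw {Ω : Type*} [MeasurableSpace Ω] [MeasurableSingletonClass Ω] {N : ℕ}
    (X : (Fin N → Fin k) → Ω) (F : Ω → ℝ) : Integrable F (wordLaw p N X) :=
  integrable_finsetSum_measure.2 fun w _ =>
    (integrable_dirac (by simp)).smul_measure ENNReal.ofReal_ne_top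

lemma vand_counts_sq {N : ℕ} (hN : 0 < N * p₁) (w : Fin N → Fin k) :
    vand (counts m w) ^ 2 = (N * p₁) ^
      (Finset.univ.filter fun q : Fin m × Fin m => q.1 < q.2).card *
        diffProd (scaledCounts m p₁ w) ^ 2 := by
  rw [vand, ← diffProd_sq, diffProd, diffProd, ← Finset.prod_pow, ← Finset.prod_pow,
    ← Finset.prod_const, ← Finset.prod_mul_distrib]
  refine Finset.prod_congr rfl fun q _ => ?_
  have hs : √(N * p₁) ^ 2 = N * p₁ := Real.sq_sqrt hN.le
  rw [scaledCounts_apply, scaledCounts_apply, ← sub_div, div_pow, hs, mul_div_cancel₀ _ hN.ne']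
  ring

/-- Weak convergence of the rescaled letter counts, weighted by the squared Vandermonde product. -/
lemma exists_limit_weighted_counts (hm : m + 1 ≤ k) (hp0 : ∀ i, 0 ≤ p i)
    (hsum : ∑ a, p a = 1) (hp : ∀ a : Fin k, (a : ℕ) < m + 1 → p a = p₁) (hp₁ : 0 < p₁)
    (hlt : p₁ * (m + 1 : ℕ) < 1) :
    ∃ (ν : Measure (EuclideanSpace ℝ (Fin (m + 1)))) (K : ℝ), 0 < K ∧
      (ν = volume.withDensity fun x => ENNReal.ofReal
        (K * Real.exp (-limitForm (p₁ / (1 - (m + 1 : ℕ) * p₁)) x.ofLp / 2))) ∧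
      0 < ∫ x, diffProd x ^ 2 ∂ν ∧
      Tendsto (fun N => wordExp p N fun w => diffProd (scaledCounts (m + 1) p₁ w) ^ 2) atTop
        (nhds (∫ x, diffProd x ^ 2 ∂ν)) ∧
      ∀ (n : ℕ → ℕ), Tendsto n atTop atTop → ∀ (s : ℕ → ℝ) (s₀ : ℝ), Tendsto s atTop (nhds s₀) →
        Tendsto (fun N => wordExp p (n N) fun w => diffProd (scaledCounts (m + 1) p₁ w) ^ 2 *
          if ∀ i, scaledCounts (m + 1) p₁ w i ≤ s N then 1 else 0) atTop
        (nhds (∫ x in orthant _ s₀, diffProd x ^ 2 ∂ν)) := by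
  obtain ⟨ν, K, hK, hchar, hden⟩ := exists_limit_law (ι := Fin (m + 1)) (p := p₁)
    (by rwa [Fintype.card_fin])
  rw [Fintype.card_fin] at hden
  have hprob : ∀ N, IsProbabilityMeasure (wordLaw p N (scaledCounts (m + 1) p₁)) := fun N =>
    isProbabilityMeasure_wordLaw hp0 hsum _
  set μ : ℕ → ProbabilityMeasure (EuclideanSpace ℝ (Fin (m + 1))) := fun N =>
    ⟨wordLaw p N (scaledCounts (m + 1) p₁), hprob N⟩ with hμ
  have hweak : Tendsto μ atTop (nhds ν) := by
    refine ProbabilityMeasure.tendsto_of_tendsto_charFun fun t => ?_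
    rw [hchar]
    exact tendsto_charFun_scaledCounts hm hp0 hsum hp hp₁ t
  set W : EuclideanSpace ℝ (Fin (m + 1)) → ℝ := fun x => diffProd x ^ 2 with hWdef
  have hWc : Continuous W := by
    have := continuous_diffProd (n := m + 1)
    fun_prop
  have hW0 : ∀ x, 0 ≤ W x := fun x => sq_nonneg _
  have hInt : ∀ N (F : EuclideanSpace ℝ (Fin (m + 1)) → ℝ),
      Integrable F (μ N : Measure _) := fun N F => integrable_wordLaw _ F
  obtain ⟨C, hC⟩ := exists_wordExp_diffProd_le hm hp0 hsum hp hp₁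
  have hC2 : ∀ᶠ N in atTop, ∫ x, W x ^ 2 ∂(μ N : Measure _) ≤ C := by
    filter_upwards [hC] with N hN
    exact (integral_wordLaw_real hp0 _ _).trans_le hN
  have hC1 : ∀ᶠ N in atTop, ∫ x, W x ∂(μ N : Measure _) ≤ 1 + C := by
    filter_upwards [hC2] with N hN
    calc _ ≤ ∫ x, (1 + W x ^ 2) ∂(μ N : Measure _) :=
          integral_mono (hInt _ _) (hInt _ _) fun x => by nlinarith [sq_nonneg (W x - 1), hW0 x]
      _ ≤ 1 + C := by
          rw [integral_add (hInt _ _) (hInt _ _)]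
          simpa using hN
  have hWν := integrable_of_weak_limit hweak hWc hW0 (fun N => hInt N W) hC1
  have hlim := fun {χ : EuclideanSpace ℝ (Fin (m + 1)) → ℝ} =>
    tendsto_integral_mul_of_sq_bounded hweak hWc hW0 (fun N => hInt N _) hC2 hWν
      (fun N => hInt N W) (χ := χ)
  refine ⟨ν, K, hK, hden, ?_, ?_, fun n hn s s₀ hs => ?_⟩
  · refine integral_limit_law_pos hK hden hWc hW0 hWν
      (x₀ := WithLp.toLp 2 fun i : Fin (m + 1) => (i : ℝ)) (pow_ne_zero _ ?_)
    exact diffProd_ne_zero_of_injective fun i j h => by simpa [Fin.ext_iff] using h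
  · have h1 := hlim (χ := fun _ => 1) continuous_const (fun _ => zero_le_one) fun _ => le_rfl
    simp only [mul_one] at h1
    refine h1.congr fun N => ?_
    exact integral_wordLaw_real hp0 _ _
  · have h1 := tendsto_setIntegral_orthant (μ := fun N =>
      (μ (n N) : Measure (EuclideanSpace ℝ (Fin (m + 1))))) hW0
      (fun N => hInt _ _) hWν (limit_law_hyperplane hden)
      (fun a b => (hlim (continuous_orthantCutoff a b) (orthantCutoff_nonneg a b)
        (orthantCutoff_le_one a b)).comp hn) hs
    refine h1.congr fun N => ?_
    rw [← integral_indicator (measurableSet_orthant _)]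
    refine (integral_wordLaw_real hp0 _ _).trans ?_
    congr 1
    ext w
    simp only [Set.indicator_apply, orthant, Set.mem_ofPred_eq, mul_ite, mul_one, mul_zero, hWdef]

end limit

section final

variable {k m : ℕ} {p : Fin k → ℝ} {p₁ : ℝ}

lemma tendsto_rescale_shift {y z : ℕ → ℝ} {B s : ℝ} (c : ℕ) (hp₁ : 0 < p₁)
    (hy : Tendsto (fun N : ℕ => (y N - N * p₁) / √(N * p₁)) atTop (nhds s))
    (hz : ∀ N, |z N - y N| ≤ B) :
    Tendsto (fun N : ℕ => (z N - (N + c : ℕ) * p₁) / √((N + c : ℕ) * p₁)) atTop (nhds s) := by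
  have hM : Tendsto (fun N : ℕ => √(((N + c : ℕ) : ℝ) * p₁)) atTop atTop :=
    Real.tendsto_sqrt_atTop.comp (((tendsto_natCast_atTop_atTop (R := ℝ)).comp
      (tendsto_add_atTop_nat c)).atTop_mul_const hp₁)
  have h1 : Tendsto (fun N : ℕ => √((N : ℝ) / (N + c))) atTop (nhds 1) := by
    have := (Real.continuous_sqrt.tendsto 1).comp (tendsto_natCast_div_add_atTop (c : ℝ))
    rwa [Real.sqrt_one] at this
  have h2 : Tendsto (fun N : ℕ => (z N - y N - c * p₁) / √(((N + c : ℕ) : ℝ) * p₁)) atTop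
      (nhds 0) := by
    refine squeeze_zero_norm (a := fun N : ℕ => (B + c * p₁) / √(((N + c : ℕ) : ℝ) * p₁))
      (fun N => ?_) (tendsto_const_nhds.div_atTop hM)
    rw [Real.norm_eq_abs, abs_div, abs_of_nonneg (Real.sqrt_nonneg _)]
    gcongr
    have := abs_le.1 (hz N)
    have hc : 0 ≤ c * p₁ := by positivity
    rw [abs_le]
    constructor <;> linarith
  have h3 := (hy.mul h1).add h2
  rw [mul_one, add_zero] at h3
  refine h3.congr' ?_
  filter_upwards [eventually_gt_atTop 0] with N hN
  have hN' : (0 : ℝ) < N := by exact_mod_cast hN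
  have hs1 : 0 < √((N : ℝ) * p₁) := Real.sqrt_pos.2 (by positivity)
  have hs2 : 0 < √((N + c : ℝ) * p₁) := Real.sqrt_pos.2 (by positivity)
  have h4 : √((N : ℝ) / (N + c)) = √(N * p₁) / √((N + c) * p₁) := by
    rw [← Real.sqrt_div (by positivity), mul_div_mul_right _ _ hp₁.ne']
  push_cast
  rw [h4]
  field_simp
  ring

/-- The limiting distribution function in terms of its unnormalized density. -/
def limitCdf (n : ℕ) (r s : ℝ) : ℝ :=
  (∫ ξ in {ξ : Fin n → ℝ | ∀ i, ξ i ≤ s}, diffProd ξ ^ 2 * Real.exp (-limitForm r ξ / 2)) /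
    ∫ ξ : Fin n → ℝ, diffProd ξ ^ 2 * Real.exp (-limitForm r ξ / 2)

lemma setIntegral_div_integral_limit_law {n : ℕ} {ν : Measure (EuclideanSpace ℝ (Fin n))} {K r : ℝ}
    (hK : 0 < K) (hν : ν = volume.withDensity fun x => ENNReal.ofReal
      (K * Real.exp (-limitForm r x.ofLp / 2))) (s : ℝ) :
    (∫ x in orthant _ s, diffProd x ^ 2 ∂ν) / ∫ x, diffProd x ^ 2 ∂ν = limitCdf n r s := by
  have hm : MeasurableSet {ξ : Fin n → ℝ | ∀ i, ξ i ≤ s} := by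
    have : {ξ : Fin n → ℝ | ∀ i, ξ i ≤ s} = ⋂ i, {ξ | ξ i ≤ s} := by ext; simp
    rw [this]
    exact MeasurableSet.iInter fun i => measurableSet_le (measurable_pi_apply i) measurable_const
  rw [← integral_indicator (measurableSet_orthant _), integral_limit_law hK hν,
    integral_limit_law hK hν, mul_div_mul_left _ _ hK.ne', limitCdf, ← integral_indicator hm]
  congr 2
  ext ξ
  simp only [Set.indicator_apply, orthant, Set.mem_ofPred_eq, ite_mul, zero_mul]

lemma continuous_limitCdf {n : ℕ} {ν : Measure (EuclideanSpace ℝ (Fin n))} {K r : ℝ}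
    (hK : 0 < K) (hν : ν = volume.withDensity fun x => ENNReal.ofReal
      (K * Real.exp (-limitForm r x.ofLp / 2)))
    (hW : Integrable (fun x : EuclideanSpace ℝ (Fin n) => diffProd x ^ 2) ν) :
    Continuous (limitCdf n r) := by
  simp only [← funext (setIntegral_div_integral_limit_law hK hν)]
  exact (continuous_setIntegral_orthant hW (limit_law_hyperplane hν)).div_const _

/-- The limit law of the longest weakly increasing subsequence using only the letters whose
probability is maximal. -/
lemma tendsto_wordExp_lisTo_le (hm : m + 1 ≤ k) (hp0 : ∀ i, 0 ≤ p i)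
    (hsum : ∑ a, p a = 1) (hp : ∀ a : Fin k, (a : ℕ) < m + 1 → p a = p₁) (hp₁ : 0 < p₁)
    (hlt : p₁ * (m + 1 : ℕ) < 1) :
    Continuous (limitCdf (m + 1) (p₁ / (1 - (m + 1 : ℕ) * p₁))) ∧
    ∀ (y : ℕ → ℝ) (s : ℝ),
      Tendsto (fun N : ℕ => (y N - N * p₁) / √(N * p₁)) atTop (nhds s) →
      Tendsto (fun N => wordExp p N fun w => if (lisTo m w : ℝ) ≤ y N then 1 else 0) atTop
        (nhds (limitCdf (m + 1) (p₁ / (1 - (m + 1 : ℕ) * p₁)) s)) := by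
  obtain ⟨ν, K, hK, hden, hpos, htot, hcdf⟩ :=
    exists_limit_weighted_counts hm hp0 hsum hp hp₁ hlt
  have hW : Integrable (fun x : EuclideanSpace ℝ (Fin (m + 1)) => diffProd x ^ 2) ν := by
    by_contra h
    rw [integral_undef h] at hpos
    exact hpos.false
  refine ⟨continuous_limitCdf hK hden hW, fun y s hy => ?_⟩
  rw [← setIntegral_div_integral_limit_law hK hden]
  set c := stairSize (m + 1)
  have hn : Tendsto (fun N => N + c) atTop atTop := tendsto_add_atTop_nat c
  have hs := tendsto_rescale_shift (z := fun N => (⌊y N⌋ : ℝ) + m) (B := 1 + m) c hp₁ hy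
    fun N => by
      have h1 := Int.floor_le (y N)
      have h2 := Int.lt_floor_add_one (y N)
      have h3 : (0 : ℝ) ≤ m := Nat.cast_nonneg m
      rw [abs_le]
      constructor <;> linarith
  have hnum := hcdf _ hn _ _ hs
  have hden' := htot.comp hn
  refine (hnum.div hden' hpos.ne').congr' ?_
  filter_upwards [eventually_gt_atTop 0, hden'.eventually (lt_mem_nhds hpos)] with N hN hNpos
  have hN' : (0 : ℝ) < N := by exact_mod_cast hN
  have hMp : 0 < ((N + c : ℕ) : ℝ) * p₁ := by push_cast; positivity
  have key := wordExp_vand_sq_eq hm hsum hp N ⌊y N⌋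
  have h1 : ∀ w : Fin (N + c) → Fin k, (∀ i, counts (m + 1) w i ≤ ⌊y N⌋ + m) ↔
      ∀ i, scaledCounts (m + 1) p₁ w i ≤
        ((⌊y N⌋ : ℝ) + m - (N + c : ℕ) * p₁) / √((N + c : ℕ) * p₁) := by
    intro w
    refine forall_congr' fun i => ?_
    rw [scaledCounts_apply, div_le_div_iff_of_pos_right (Real.sqrt_pos.2 hMp),
      sub_le_sub_iff_right]
    exact_mod_cast Iff.rfl
  simp only [vand_counts_sq hMp, mul_assoc, wordExp_const_mul, h1] at key
  have hne := pow_ne_zero (Finset.univ.filter fun q : Fin (m + 1) × Fin (m + 1) =>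
    q.1 < q.2).card hMp.ne'
  have key' := mul_left_cancel₀ hne key
  rw [Pi.div_apply, div_eq_iff hNpos.ne']
  refine key'.trans ((mul_comm _ _).trans ?_)
  simp only [Int.le_floor, Function.comp_apply, Int.cast_natCast]
  rfl

end final

/-- The length of the longest weakly increasing subsequence has the same limit law as its version
restricted to the letters up to `a`, when all larger letters have smaller probability. -/
lemma tendsto_wordExp_lisLen_le {k : ℕ} {p : Fin k → ℝ} {p₁ : ℝ} {F : ℝ → ℝ} (hp : ∀ i, 0 < p i)
    (hsum : ∑ i, p i = 1) (a : Fin k) (ha : ∀ j, a < j → p j < p a) (hp₁ : 0 < p₁)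
    (hF : Continuous F)
    (hlaw : ∀ (y : ℕ → ℝ) (s : ℝ),
      Tendsto (fun N : ℕ => (y N - N * p₁) / √(N * p₁)) atTop (nhds s) →
      Tendsto (fun N => wordExp p N fun w => if (lisTo a w : ℝ) ≤ y N then 1 else 0) atTop
        (nhds (F s))) (s : ℝ) :
    Tendsto (fun N : ℕ => wordExp p N fun w =>
      if (lisLen w : ℝ) ≤ N * p₁ + s * √(N * p₁) then 1 else 0) atTop (nhds (F s)) := by
  have hy : ∀ t : ℝ, Tendsto (fun N : ℕ => wordExp p N fun w =>
      if (lisTo a w : ℝ) ≤ N * p₁ + t * √(N * p₁) then 1 else 0) atTop (nhds (F t)) := by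
    refine fun t => hlaw _ t (tendsto_const_nhds.congr' ?_)
    filter_upwards [eventually_gt_atTop 0] with N hN
    have : 0 < √(N * p₁) := Real.sqrt_pos.2 (mul_pos (Nat.cast_pos.2 hN) hp₁)
    field_simp
    ring
  refine tendsto_order.2 ⟨fun b hb => ?_, fun b hb => ?_⟩
  · obtain ⟨δ, hδ, hδb⟩ : ∃ δ > 0, b < F (s - δ) := by
      have h : Tendsto (fun δ => F (s - δ)) (nhdsWithin 0 (Set.Ioi 0)) (nhds (F s)) := by
        have h0 : Continuous fun δ => F (s - δ) := hF.comp (by fun_prop)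
        simpa using (h0.tendsto 0).mono_left nhdsWithin_le_nhds
      have hpos : ∀ᶠ δ : ℝ in nhdsWithin 0 (Set.Ioi 0), 0 < δ := self_mem_nhdsWithin
      exact (hpos.and (h.eventually (lt_mem_nhds hb))).exists
    have herr := tendsto_wordExp_lisLen_sub_lisTo hp hsum a ha (mul_pos hδ (Real.sqrt_pos.2 hp₁))
    have hdiff := (hy (s - δ)).sub herr
    rw [sub_zero] at hdiff
    filter_upwards [hdiff.eventually (lt_mem_nhds hδb)] with N hN
    refine hN.trans_le ?_
    rw [← wordExp_sub]
    refine wordExp_mono (fun i => (hp i).le) fun w => ?_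
    have hsq : √(N * p₁) = √p₁ * √N := by rw [mul_comm, Real.sqrt_mul hp₁.le]
    split_ifs with h1 h2 <;> norm_num
    rename_i h3
    refine h3 ?_
    rw [hsq] at h1 ⊢
    linarith
  · filter_upwards [(hy s).eventually (gt_mem_nhds hb)] with N hN
    refine lt_of_le_of_lt (wordExp_mono (fun i => (hp i).le) fun w => ?_) hN
    have : (lisTo a w : ℝ) ≤ lisLen w := by exact_mod_cast lisTo_le_lisLen a w
    split_ifs with h1 h2 <;> norm_num
    exact h2 (this.trans h1)

/-- When the largest probability `p₁` has multiplicity `k₁ < k`, the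
limiting distribution of `(ℓ_N - Np₁)/√(Np₁)` reduces to the ratio `I(s)/I(∞)` of
`k₁`-dimensional integrals. -/
theorem random_words_limiting_distribution_reduced
    (k : ℕ) (hk : 2 ≤ k) (p : Fin k → ℝ)
    (hp : ∀ i, 0 < p i ∧ p i < 1) (hsum : ∑ i, p i = 1) (hmono : Antitone p)
    (k1 : ℕ) (hk1 : 1 ≤ k1) (hk1k : k1 < k)
    (heq : ∀ i : Fin k, (i : ℕ) < k1 → p i = p ⟨0, by omega⟩)
    (hlt : p ⟨k1, hk1k⟩ < p ⟨0, by omega⟩) (s : ℝ) :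
    Tendsto
      (fun N : ℕ => wordProb k N p
        {w | (lisLen w : ℝ) ≤ N * p ⟨0, by omega⟩ +
              s * Real.sqrt (N * p ⟨0, by omega⟩)})
      atTop
      (nhds (
        (∫ ξ in {ξ : Fin k1 → ℝ | ∀ i, ξ i ≤ s},
          (∏ q ∈ Finset.univ.filter fun q : Fin k1 × Fin k1 => q.1 < q.2,
              (ξ q.1 - ξ q.2)) ^ 2 *
            Real.exp (-((∑ i, (ξ i) ^ 2) +
              (p ⟨0, by omega⟩ / (1 - k1 * p ⟨0, by omega⟩)) * (∑ i, ξ i) ^ 2) / 2)) /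
        (∫ ξ : Fin k1 → ℝ,
          (∏ q ∈ Finset.univ.filter fun q : Fin k1 × Fin k1 => q.1 < q.2,
              (ξ q.1 - ξ q.2)) ^ 2 *
            Real.exp (-((∑ i, (ξ i) ^ 2) +
              (p ⟨0, by omega⟩ / (1 - k1 * p ⟨0, by omega⟩)) * (∑ i, ξ i) ^ 2) / 2)))) := by
  have hp0 : ∀ i, 0 < p i := fun i => (hp i).1
  obtain ⟨m, rfl⟩ : ∃ m, k1 = m + 1 := ⟨k1 - 1, by omega⟩
  set p₁ := p ⟨0, by omega⟩
  have hp₁ : 0 < p₁ := hp0 _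
  have hlt' : p₁ * (m + 1 : ℕ) < 1 := by
    have h := sum_letters hk1k.le hsum heq (fun _ => 0) 1
    have hpos : 0 < ∑ b, p b * if (b : ℕ) < m + 1 then 0 else 1 := by
      refine Finset.sum_pos' (fun b _ => ?_) ⟨⟨m + 1, hk1k⟩, Finset.mem_univ _, ?_⟩
      · split_ifs <;> simp [(hp0 b).le]
      · simpa using hp0 _
    simp only [dite_eq_ite, Finset.sum_const_zero, mul_zero, add_zero, mul_one] at h
    rw [h] at hpos
    linarith
  obtain ⟨hF, hlaw⟩ := tendsto_wordExp_lisTo_le hk1k.le (fun i => (hp0 i).le) hsum heq hp₁ hlt'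
  have ha : ∀ j : Fin k, (⟨m, by omega⟩ : Fin k) < j → p j < p ⟨m, by omega⟩ := fun j hj => by
    rw [heq ⟨m, by omega⟩ (by simp)]
    exact (hmono (Fin.mk_le_of_le_val (Nat.succ_le_of_lt hj))).trans_lt hlt
  simp only [wordProb_eq_wordExp, Set.mem_ofPred_eq]
  exact tendsto_wordExp_lisLen_le hp0 hsum _ ha hp₁ hF hlaw s

end
end

section
/- For every integer m ≥ 1 and every real a ≥ 0, ∫_{ℝ^m} Δ(ξ)² exp(−½[Σ_{i=1}^m ξ_i² + a (Σ_{i=1}^m ξ_i)²]) dξ = (2π)^{m/2} (1!·2!⋯m!) (1 + m a)^{−1/2}, where Δ(ξ) = ∏_{1≤i<j≤m}(ξ_i − ξ_j). -/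
open MeasureTheory Filter
open scoped Classical

noncomputable section

namespace MeasureTheory

/-- **Andréief's identity**: the integral of a product of two determinants is the determinant
of the pairings. -/
theorem integral_det_mul_det {ι E : Type*} [Fintype ι] [DecidableEq ι] [MeasurableSpace E]
    (μ : Measure E) [SigmaFinite μ] (f g : ι → E → ℝ)
    (hfg : ∀ j k, Integrable (fun x => f j x * g k x) μ) :
    ∫ x : ι → E, (Matrix.of fun i j => f j (x i)).det * (Matrix.of fun i j => g j (x i)).det
        ∂Measure.pi (fun _ => μ) =
      (Fintype.card ι).factorial * (Matrix.of fun j k => ∫ x, f j x * g k x ∂μ).det := by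
  have hint (σ τ : Equiv.Perm ι) :
      Integrable (fun x : ι → E => ∏ i, f (σ i) (x i) * g (τ i) (x i))
        (Measure.pi fun _ => μ) :=
    Integrable.fintype_prod (f := fun i x => f (σ i) x * g (τ i) x) fun i => hfg (σ i) (τ i)
  have hexpand (x : ι → E) :
      (Matrix.of fun i j => f j (x i)).det * (Matrix.of fun i j => g j (x i)).det =
        ∑ σ : Equiv.Perm ι, ∑ τ : Equiv.Perm ι, ((σ.sign : ℤ) : ℝ) * ((τ.sign : ℤ) : ℝ) *
          ∏ i, f (σ i) (x i) * g (τ i) (x i) := by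
    rw [← Matrix.det_transpose, ← Matrix.det_transpose (Matrix.of fun i j => g j (x i)),
      Matrix.det_apply', Matrix.det_apply', Finset.sum_mul_sum]
    refine Finset.sum_congr rfl fun σ _ => Finset.sum_congr rfl fun τ _ => ?_
    simp only [Matrix.transpose_apply, Matrix.of_apply, Finset.prod_mul_distrib]
    ring
  have hinner (σ : Equiv.Perm ι) :
      ∑ τ : Equiv.Perm ι, ((σ.sign : ℤ) : ℝ) * ((τ.sign : ℤ) : ℝ) *
          ∏ i, ∫ x, f (σ i) x * g (τ i) x ∂μ =
        (Matrix.of fun j k => ∫ x, f j x * g k x ∂μ).det := by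
    have h := Matrix.det_permute σ (Matrix.of fun j k => ∫ x, f j x * g k x ∂μ)
    have hs : ((σ.sign : ℤ) : ℝ) * ((σ.sign : ℤ) : ℝ) = 1 := by
      exact_mod_cast Int.units_coe_mul_self σ.sign
    have h' : ∑ τ : Equiv.Perm ι, ((τ.sign : ℤ) : ℝ) * ∏ i, ∫ x, f (σ i) x * g (τ i) x ∂μ =
        ((σ.sign : ℤ) : ℝ) * (Matrix.of fun j k => ∫ x, f j x * g k x ∂μ).det := by
      rw [← h, ← Matrix.det_transpose, Matrix.det_apply']
      rfl
    simp_rw [mul_assoc, ← Finset.mul_sum]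
    rw [h', ← mul_assoc, hs, one_mul]
  simp_rw [hexpand]
  rw [integral_finsetSum _ fun σ _ => integrable_finsetSum _ fun τ _ => (hint σ τ).const_mul _]
  have hσ (σ : Equiv.Perm ι) :
      ∫ x : ι → E, ∑ τ : Equiv.Perm ι, ((σ.sign : ℤ) : ℝ) * ((τ.sign : ℤ) : ℝ) *
          ∏ i, f (σ i) (x i) * g (τ i) (x i) ∂Measure.pi (fun _ => μ) =
        (Matrix.of fun j k => ∫ x, f j x * g k x ∂μ).det := by
    rw [integral_finsetSum _ fun τ _ => (hint σ τ).const_mul _, ← hinner σ]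
    refine Finset.sum_congr rfl fun τ _ => ?_
    rw [integral_const_mul, integral_fintype_prod_eq_prod (fun i x => f (σ i) x * g (τ i) x)]
  simp [hσ, Fintype.card_perm]

end MeasureTheory

namespace Polynomial

theorem integrable_eval_mul_gaussian (p : ℝ[X]) :
    Integrable fun x : ℝ => p.eval x * Real.exp (-x ^ 2 / 2) := by
  induction p using Polynomial.induction_on' with
  | add p q hp hq =>
    simp only [eval_add, add_mul]
    exact hp.add hq
  | monomial n c =>
    have h := (integrable_rpow_mul_exp_neg_mul_sq (b := 1 / 2) (by norm_num) (s := n)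
      (by linarith [n.cast_nonneg (α := ℝ)])).const_mul c
    convert! h using 2 with x
    rw [eval_monomial, Real.rpow_natCast, mul_assoc]
    ring_nf

theorem integral_eval_mul_hermite_succ (p : ℝ[X]) (n : ℕ) :
    ∫ x, p.eval x * (((hermite (n + 1)).map (Int.castRingHom ℝ)).eval x *
        Real.exp (-x ^ 2 / 2)) =
      ∫ x, (derivative p).eval x * (((hermite n).map (Int.castRingHom ℝ)).eval x *
        Real.exp (-x ^ 2 / 2)) := by
  set h := (hermite n).map (Int.castRingHom ℝ) with hh
  have hsucc : (hermite (n + 1)).map (Int.castRingHom ℝ) = X * h - derivative h := by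
    simp [hermite_succ, hh, derivative_map]
  have hd (x : ℝ) : HasDerivAt (fun x => (p * h).eval x * Real.exp (-x ^ 2 / 2))
      ((derivative p * h).eval x * Real.exp (-x ^ 2 / 2) -
        (p * (X * h - derivative h)).eval x * Real.exp (-x ^ 2 / 2)) x := by
    have he : HasDerivAt (fun x : ℝ => -x ^ 2 / 2) (-x) x := by
      have := ((hasDerivAt_pow 2 x).neg.div_const 2)
      convert! this using 1
      norm_num
      ring
    convert! ((p * h).hasDerivAt x).mul he.exp using 1
    simp only [derivative_mul, eval_add, eval_mul, eval_sub, eval_X]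
    ring
  have hzero := integral_eq_zero_of_hasDerivAt_of_integrable hd
    ((integrable_eval_mul_gaussian _).sub (integrable_eval_mul_gaussian _))
    (integrable_eval_mul_gaussian _)
  rw [integral_sub (integrable_eval_mul_gaussian _) (integrable_eval_mul_gaussian _),
    sub_eq_zero] at hzero
  simp only [hsucc, ← mul_assoc, ← eval_mul]
  exact hzero.symm

theorem integral_eval_mul_hermite (p : ℝ[X]) (n : ℕ) :
    ∫ x, p.eval x * (((hermite n).map (Int.castRingHom ℝ)).eval x * Real.exp (-x ^ 2 / 2)) =
      ∫ x, (derivative^[n] p).eval x * Real.exp (-x ^ 2 / 2) := by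
  induction n generalizing p with
  | zero => simp
  | succ n ih => rw [integral_eval_mul_hermite_succ, ih, Function.iterate_succ_apply]

theorem integral_hermite_mul_hermite_of_lt {m n : ℕ} (hmn : m < n) :
    ∫ x, ((hermite m).map (Int.castRingHom ℝ)).eval x *
      (((hermite n).map (Int.castRingHom ℝ)).eval x * Real.exp (-x ^ 2 / 2)) = 0 := by
  rw [integral_eval_mul_hermite, iterate_derivative_eq_zero]
  · simp
  · exact (natDegree_map_le.trans_eq natDegree_hermite).trans_lt hmn

theorem integral_hermite_mul_self (n : ℕ) :
    ∫ x, ((hermite n).map (Int.castRingHom ℝ)).eval x *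
      (((hermite n).map (Int.castRingHom ℝ)).eval x * Real.exp (-x ^ 2 / 2)) =
        n.factorial * √(2 * Real.pi) := by
  have hdeg : ((hermite n).map (Int.castRingHom ℝ)).natDegree ≤ n :=
    natDegree_map_le.trans_eq natDegree_hermite
  have hconst : derivative^[n] ((hermite n).map (Int.castRingHom ℝ)) = C (n.factorial : ℝ) := by
    rw [eq_C_of_natDegree_eq_zero (p := derivative^[n] _)
      (Nat.le_zero.mp ((natDegree_iterate_derivative _ n).trans (by omega))),
      coeff_iterate_derivative]
    simp [Nat.descFactorial_self, coeff_hermite_self]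
  rw [integral_eval_mul_hermite, hconst]
  simp only [eval_C]
  rw [integral_const_mul]
  congr 1
  rw [show 2 * Real.pi = Real.pi / (1 / 2) by ring, ← integral_gaussian]
  exact integral_congr_ae (.of_forall fun x => by ring_nf)

theorem integral_hermite_mul_hermite (m n : ℕ) :
    ∫ x, (((hermite m).map (Int.castRingHom ℝ)).eval x * Real.exp (-x ^ 2 / 2)) *
      ((hermite n).map (Int.castRingHom ℝ)).eval x =
        if m = n then m.factorial * √(2 * Real.pi) else 0 := by
  rcases lt_trichotomy m n with h | rfl | h
  · rw [if_neg h.ne, ← integral_hermite_mul_hermite_of_lt h]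
    exact integral_congr_ae (.of_forall fun x => by ring)
  · rw [if_pos rfl, ← integral_hermite_mul_self]
    exact integral_congr_ae (.of_forall fun x => by ring)
  · rw [if_neg h.ne', ← integral_hermite_mul_hermite_of_lt h]
    exact integral_congr_ae (.of_forall fun x => by ring)

end Polynomial

theorem Finset.prod_filter_lt_sub_sq {m : ℕ} (ξ : Fin m → ℝ) :
    (∏ q ∈ Finset.univ.filter fun q : Fin m × Fin m => q.1 < q.2, (ξ q.1 - ξ q.2)) ^ 2 =
      (Matrix.vandermonde ξ).det ^ 2 := by
  rw [Matrix.det_vandermonde, Finset.prod_filter, Fintype.prod_prod_type, ← Finset.prod_pow,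
    ← Finset.prod_pow]
  refine Finset.prod_congr rfl fun i _ => ?_
  rw [← Finset.prod_filter, Finset.filter_lt_eq_Ioi, ← Finset.prod_pow, ← Finset.prod_pow]
  exact Finset.prod_congr rfl fun j _ => by ring

theorem Finset.factorial_mul_prod_range_factorial (m : ℕ) :
    m.factorial * ∏ i ∈ Finset.range m, i.factorial =
      ∏ i ∈ Finset.range m, (i + 1).factorial := by
  rw [mul_comm, ← Finset.prod_range_succ, Finset.prod_range_succ']
  simp

theorem integral_vandermonde_sq_mul_gaussian (m : ℕ) :
    ∫ ξ : Fin m → ℝ, (Matrix.vandermonde ξ).det ^ 2 * Real.exp (-(∑ i, ξ i ^ 2) / 2) =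
      (2 * Real.pi) ^ ((m : ℝ) / 2) * ∏ i ∈ Finset.range m, ((i + 1).factorial : ℝ) := by
  set h : Fin m → Polynomial ℝ :=
    fun j => (Polynomial.hermite j).map (Int.castRingHom ℝ) with hh
  have hmonic (j : Fin m) : (h j).Monic := (Polynomial.hermite_monic j).map _
  have hdeg (j : Fin m) : (h j).natDegree = j := by
    rw [hh, (Polynomial.hermite_monic j).natDegree_map, Polynomial.natDegree_hermite]
  have hintegrand (ξ : Fin m → ℝ) :
      (Matrix.vandermonde ξ).det ^ 2 * Real.exp (-(∑ i, ξ i ^ 2) / 2) =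
        (Matrix.of fun i j => (h j).eval (ξ i) * Real.exp (-ξ i ^ 2 / 2)).det *
          (Matrix.of fun i j => (h j).eval (ξ i)).det := by
    have hw : (Matrix.of fun i j => (h j).eval (ξ i) * Real.exp (-ξ i ^ 2 / 2)).det =
        (∏ i, Real.exp (-ξ i ^ 2 / 2)) * (Matrix.of fun i j => (h j).eval (ξ i)).det := by
      rw [← Matrix.det_mul_column]
      simp only [Matrix.of_apply, mul_comm]
    rw [hw, Matrix.det_eval_matrixOfPolynomials_eq_det_vandermonde ξ h hdeg hmonic,
      ← Real.exp_sum, ← Finset.sum_div, Finset.sum_neg_distrib]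
    ring
  simp_rw [hintegrand]
  have handreief := integral_det_mul_det (volume : Measure ℝ)
    (fun j : Fin m => fun x => (h j).eval x * Real.exp (-x ^ 2 / 2)) (fun j x => (h j).eval x)
    fun j k => by
      have := (h j * h k).integrable_eval_mul_gaussian
      convert! this using 2 with x
      rw [Polynomial.eval_mul]
      ring
  rw [volume_pi, handreief]
  have hdiag : (Matrix.of fun j k : Fin m =>
      ∫ x, ((h j).eval x * Real.exp (-x ^ 2 / 2)) * (h k).eval x) =
        Matrix.diagonal fun j : Fin m => ((j : ℕ).factorial : ℝ) * √(2 * Real.pi) := by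
    ext j k
    simp only [Matrix.of_apply, hh, Polynomial.integral_hermite_mul_hermite,
      Matrix.diagonal_apply, Fin.ext_iff]
  have hsqrt : √(2 * Real.pi) ^ m = (2 * Real.pi) ^ ((m : ℝ) / 2) := by
    rw [Real.sqrt_eq_rpow, ← Real.rpow_mul_natCast (by positivity)]
    ring_nf
  rw [hdiag, Matrix.det_diagonal, Finset.prod_mul_distrib,
    Fin.prod_univ_eq_prod_range (fun i => (i.factorial : ℝ)) m, Finset.prod_const,
    Finset.card_univ, Fintype.card_fin, hsqrt, ← mul_assoc, mul_comm]
  congr 1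
  exact_mod_cast Finset.factorial_mul_prod_range_factorial m

/-- Adding `c` times the coordinate sum to every coordinate scales Lebesgue measure by
`|1 + m * c|`. -/
theorem integral_comp_add_const_mul_sum {m : ℕ} {c : ℝ} (hc : 1 + m * c ≠ 0)
    (F : (Fin m → ℝ) → ℝ) :
    ∫ ξ, F ξ = |1 + m * c| * ∫ ξ : Fin m → ℝ, F (fun i => ξ i + c * ∑ j, ξ j) := by
  set T := LinearMap.transvection (∑ j, LinearMap.proj j : (Fin m → ℝ) →ₗ[ℝ] ℝ)
    (fun _ : Fin m => c) with hT
  have hTapply (ξ : Fin m → ℝ) : T ξ = fun i => ξ i + c * ∑ j, ξ j := by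
    ext i
    simp [hT, LinearMap.transvection.apply, mul_comm]
  have hdet : LinearMap.det T = 1 + m * c := by
    rw [hT, LinearMap.transvection.det]
    simp
  have hdet0 : LinearMap.det T ≠ 0 := hdet ▸ hc
  have hemb : MeasurableEmbedding T :=
    (LinearMap.equivOfDetNeZero T hdet0).toContinuousLinearEquiv.toHomeomorph.measurableEmbedding
  simp_rw [← hTapply]
  rw [← hemb.integral_map, Real.map_linearMap_volume_pi_eq_smul_volume_pi hdet0,
    integral_smul_measure, ENNReal.toReal_ofReal (abs_nonneg _), hdet, abs_inv, smul_eq_mul,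
    mul_inv_cancel_left₀ (abs_ne_zero.mpr hc)]

/-- For every `m ≥ 1` and `a ≥ 0`,
`∫_{ℝ^m} Δ(ξ)² exp(-½[Σξᵢ² + a(Σξᵢ)²]) dξ = (2π)^{m/2} (1!2!⋯m!) (1+ma)^{-1/2}`. -/
theorem vandermonde_gaussian_integral_with_mean_constraint (m : ℕ) (hm : 1 ≤ m)
    (a : ℝ) (ha : 0 ≤ a) :
    (∫ ξ : Fin m → ℝ,
      (∏ q ∈ Finset.univ.filter fun q : Fin m × Fin m => q.1 < q.2,
          (ξ q.1 - ξ q.2)) ^ 2 *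
        Real.exp (-((∑ i, (ξ i) ^ 2) + a * (∑ i, ξ i) ^ 2) / 2)) =
      (2 * Real.pi) ^ ((m : ℝ) / 2) *
        (∏ i ∈ Finset.range m, (Nat.factorial (i + 1) : ℝ)) *
        (1 + m * a) ^ (-(1 : ℝ) / 2) := by
  have hm0 : (0 : ℝ) < m := by exact_mod_cast hm
  have hpos : 0 < 1 + m * a := by positivity
  set t := (1 + m * a) ^ (-(1 : ℝ) / 2) with ht
  have ht0 : 0 < t := Real.rpow_pos_of_pos hpos _
  have htsq : t ^ 2 * (1 + m * a) = 1 := by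
    rw [ht, ← Real.rpow_mul_natCast hpos.le]
    norm_num [Real.rpow_neg_one, hpos.ne']
  obtain ⟨c, hc⟩ : ∃ c : ℝ, 1 + m * c = t := ⟨(t - 1) / m, by field_simp; ring⟩
  simp only [Finset.prod_filter_lt_sub_sq]
  rw [integral_comp_add_const_mul_sum (c := c) (hc ▸ ht0.ne'), hc, abs_of_pos ht0,
    ← integral_vandermonde_sq_mul_gaussian m, mul_comm]
  congr 2
  ext ξ
  rw [Matrix.det_vandermonde_add]
  congr 3
  set s := ∑ j, ξ j with hs
  have hsum : ∑ i, (ξ i + c * s) = t * s := by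
    rw [Finset.sum_add_distrib, ← hs, ← hc]
    simp
    ring
  have hsq : ∑ i, (ξ i + c * s) ^ 2 = ∑ i, ξ i ^ 2 + (2 * c + m * c ^ 2) * s ^ 2 := by
    simp only [add_sq, Finset.sum_add_distrib, ← Finset.mul_sum, ← Finset.sum_mul, ← hs]
    simp
    ring
  have hcoef : 2 * c + m * c ^ 2 + a * t ^ 2 = 0 := by
    apply mul_left_cancel₀ hm0.ne'
    rw [← hc] at htsq ⊢
    linear_combination htsq
  rw [hsum, hsq]
  linear_combination (-s ^ 2) * hcoef

end
end

section
/- Suppose one letter occurs with strictly greater probability than all others: p₁ > p_i for all i ≥ 2. Then (ℓ_N − N p₁)/√N converges in distribution to a centered Gaussian with variance p₁(1−p₁); equivalently, for every real s, lim_{N→∞} Prob(ℓ_N ≤ N p₁ + s√(N p₁(1−p₁))) = (2π)^{−1/2} ∫_{−∞}^s e^{−u²/2} du. -/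
open MeasureTheory Filter
open scoped Classical

noncomputable section

section Combinatorics

variable {k N : ℕ}

/-- The number of occurrences of the letter `z` in `w`. -/
def letterCount (z : Fin k) (w : Fin N → Fin k) : ℕ :=
  (Finset.univ.filter fun j => w j = z).card

/-- The number of positions at which `w` agrees with the `ℕ`-valued function `b`. -/
def agreeCount (b : Fin N → ℕ) (w : Fin N → Fin k) : ℕ :=
  (Finset.univ.filter fun j => (w j : ℕ) = b j).card

/-- The monotone step function whose jumps are located at the cut points `t i`. -/
def stepFun (t : Fin k → Fin (N + 1)) (j : Fin N) : ℕ :=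
  (Finset.univ.filter fun i => (t i : ℕ) ≤ j).card

lemma letterCount_le_lisLen (z : Fin k) (w : Fin N → Fin k) : letterCount z w ≤ lisLen w := by
  refine Finset.le_sup (f := Finset.card) (b := Finset.univ.filter fun j => w j = z) ?_
  simp only [Finset.mem_filter, Finset.mem_univ, true_and]
  intro i hi j hj _
  rw [hi, hj]

lemma exists_lisLen_le_agreeCount (w : Fin N → Fin k) :
    ∃ t : Fin k → Fin (N + 1), lisLen w ≤ agreeCount (stepFun t) w := by
  obtain ⟨s, hs, hcard⟩ := Finset.exists_mem_eq_sup
    (Finset.univ.filter fun s : Finset (Fin N) => ∀ i ∈ s, ∀ j ∈ s, i ≤ j → w i ≤ w j)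
    ⟨∅, by simp⟩ Finset.card
  simp only [Finset.mem_filter, Finset.mem_univ, true_and] at hs
  let t : Fin k → Fin (N + 1) := fun i => (s.filter fun j => w j ≤ i).sup Fin.succ
  have ht : ∀ j ∈ s, ∀ i : Fin k, (t i : ℕ) ≤ j ↔ i < w j := by
    intro j hj i
    constructor
    · intro h
      by_contra! hle
      have h2 : j.succ ≤ t i := Finset.le_sup (f := Fin.succ) (by simp [hj, hle])
      rw [Fin.le_def, Fin.val_succ] at h2
      omega
    · intro h
      have h2 : t i ≤ j.castSucc := by
        refine Finset.sup_le fun j' hj' => ?_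
        simp only [Finset.mem_filter] at hj'
        have h3 : j' < j := by
          by_contra! hle
          exact absurd (hs j hj j' hj'.1 hle) (not_le.2 (hj'.2.trans_lt h))
        rw [Fin.le_def, Fin.val_succ, Fin.val_castSucc]
        exact h3
      simpa [Fin.le_def] using h2
  refine ⟨t, ?_⟩
  rw [show lisLen w = s.card from hcard]
  refine Finset.card_le_card fun j hj => ?_
  have hstep : stepFun t j = w j := by
    rw [stepFun, Finset.filter_congr fun i _ => ht j hj i, Finset.filter_gt_eq_Iio, Fin.card_Iio]
  exact Finset.mem_filter.2 ⟨Finset.mem_univ j, hstep.symm⟩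

end Combinatorics

section ExponentialMoment

variable {k N : ℕ} {p : Fin k → ℝ} {z : Fin k} {r : ℝ}

lemma exists_ratio_gt_one (hmax : ∀ i, i ≠ z → p i < p z) :
    ∃ r : ℝ, 1 < r ∧ ∀ i, i ≠ z → p i * r ≤ p z := by
  have h : ∀ᶠ r in nhdsWithin (1 : ℝ) (Set.Ioi 1), ∀ i, i ≠ z → p i * r ≤ p z := by
    refine Filter.eventually_all.2 fun i => ?_
    by_cases hi : i = z
    · simp [hi]
    have hc : ContinuousAt (fun r : ℝ => p i * r) 1 := by fun_prop
    have := hc.eventually_lt (continuousAt_const (y := p z)) (by simpa using hmax i hi)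
    filter_upwards [nhdsWithin_le_nhds this] with r hr _ using hr.le
  obtain ⟨r, hr, hr1⟩ := (h.and self_mem_nhdsWithin).exists
  exact ⟨r, hr1, hr⟩

lemma sum_tilted_le_one (hp : ∀ i, 0 < p i) (hsum : ∑ i, p i = 1) (hr : 1 < r)
    (hratio : ∀ i, i ≠ z → p i * r ≤ p z) (b : ℕ) :
    ∑ c, p c * ((if (c : ℕ) = b then r else 1) * (if c = z then r⁻¹ else 1)) ≤ 1 := by
  have hr0 : 0 < r := by linarith
  have hinv : r⁻¹ ≤ 1 := inv_le_one_of_one_le₀ hr.le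
  by_cases hb : ∃ c : Fin k, c ≠ z ∧ (c : ℕ) = b
  · obtain ⟨d, hdz, rfl⟩ := hb
    have key : ∀ c, p c * ((if (c : ℕ) = d then r else 1) * (if c = z then r⁻¹ else 1)) =
        p c + (if c = d then p d * (r - 1) else 0) - (if c = z then p z * (1 - r⁻¹) else 0) := by
      intro c
      simp only [← Fin.ext_iff]
      by_cases h1 : c = d
      · subst h1
        simp only [hdz, if_true, if_false]
        ring
      · by_cases h2 : c = z
        · subst h2
          simp only [h1, if_true, if_false]
          ring
        · simp [h1, h2]
    simp_rw [key, Finset.sum_sub_distrib, Finset.sum_add_distrib]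
    simp only [Finset.sum_ite_eq', Finset.mem_univ, if_true, hsum]
    have h3 : p d * (r - 1) ≤ p z * (1 - r⁻¹) := by
      have : p z * (1 - r⁻¹) - p d * (r - 1) = (p z - p d * r) * (r - 1) * r⁻¹ := by
        field_simp
      have h4 : 0 ≤ (p z - p d * r) * (r - 1) * r⁻¹ :=
        mul_nonneg (mul_nonneg (by linarith [hratio d hdz]) (by linarith)) (by positivity)
      linarith
    linarith
  · push Not at hb
    refine (Finset.sum_le_sum fun c _ => mul_le_of_le_one_right (hp c).le ?_).trans hsum.le
    by_cases hc : c = z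
    · by_cases hcb : (c : ℕ) = b
      · simp [hc, ← hcb, hr0.ne']
      · simp only [hc, if_true]
        rw [if_neg (by rwa [← hc])]
        simpa using hinv
    · simp [hc, hb c hc]

lemma sum_tilted_agreeCount_le_one (hp : ∀ i, 0 < p i) (hsum : ∑ i, p i = 1) (hr : 1 < r)
    (hratio : ∀ i, i ≠ z → p i * r ≤ p z) (b : Fin N → ℕ) :
    ∑ w : Fin N → Fin k, (∏ j, p (w j)) * (r ^ agreeCount b w * r⁻¹ ^ letterCount z w) ≤ 1 := by
  have hr0 : 0 < r := by linarith
  have key : ∀ w : Fin N → Fin k,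
      (∏ j, p (w j)) * (r ^ agreeCount b w * r⁻¹ ^ letterCount z w) =
      ∏ j, p (w j) * ((if (w j : ℕ) = b j then r else 1) * (if w j = z then r⁻¹ else 1)) := by
    intro w
    rw [Finset.prod_mul_distrib, Finset.prod_mul_distrib, agreeCount, letterCount,
      Finset.prod_ite, Finset.prod_ite]
    simp
  simp_rw [key]
  rw [← Fintype.prod_sum (fun (j : Fin N) (c : Fin k) =>
    p c * ((if (c : ℕ) = b j then r else 1) * (if c = z then r⁻¹ else 1)))]
  refine Finset.prod_le_one (fun j _ => Finset.sum_nonneg fun c _ => ?_)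
    (fun j _ => sum_tilted_le_one hp hsum hr hratio (b j))
  have := hp c
  positivity

lemma sum_tilted_lisLen_le (hp : ∀ i, 0 < p i) (hsum : ∑ i, p i = 1) (hr : 1 < r)
    (hratio : ∀ i, i ≠ z → p i * r ≤ p z) :
    ∑ w : Fin N → Fin k, (∏ j, p (w j)) * (r ^ lisLen w * r⁻¹ ^ letterCount z w) ≤
      ((N : ℝ) + 1) ^ k := by
  have hr0 : 0 < r := by linarith
  calc ∑ w : Fin N → Fin k, (∏ j, p (w j)) * (r ^ lisLen w * r⁻¹ ^ letterCount z w)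
      ≤ ∑ w : Fin N → Fin k, ∑ t : Fin k → Fin (N + 1),
          (∏ j, p (w j)) * (r ^ agreeCount (stepFun t) w * r⁻¹ ^ letterCount z w) := by
        refine Finset.sum_le_sum fun w _ => ?_
        have hpw : 0 ≤ ∏ j, p (w j) := Finset.prod_nonneg fun j _ => (hp _).le
        obtain ⟨t, ht⟩ := exists_lisLen_le_agreeCount w
        refine le_trans ?_ (Finset.single_le_sum (f := fun t : Fin k → Fin (N + 1) =>
          (∏ j, p (w j)) * (r ^ agreeCount (stepFun t) w * r⁻¹ ^ letterCount z w))
          (fun t _ => by positivity) (Finset.mem_univ t))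
        have := pow_le_pow_right₀ hr.le ht
        gcongr
    _ = ∑ t : Fin k → Fin (N + 1), ∑ w : Fin N → Fin k,
          (∏ j, p (w j)) * (r ^ agreeCount (stepFun t) w * r⁻¹ ^ letterCount z w) :=
        Finset.sum_comm
    _ ≤ ∑ t : Fin k → Fin (N + 1), (1 : ℝ) :=
        Finset.sum_le_sum fun t _ => sum_tilted_agreeCount_le_one hp hsum hr hratio _
    _ = ((N : ℝ) + 1) ^ k := by simp

lemma wordProb_excess_le (hp : ∀ i, 0 < p i) (hsum : ∑ i, p i = 1) (hr : 1 < r)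
    (hratio : ∀ i, i ≠ z → p i * r ≤ p z) (y : ℝ) :
    wordProb k N p {w | y ≤ (lisLen w : ℝ) - letterCount z w} ≤
      ((N : ℝ) + 1) ^ k * Real.exp (-(Real.log r * y)) := by
  have hr0 : 0 < r := by linarith
  rw [Real.exp_neg, ← div_eq_mul_inv, le_div_iff₀ (Real.exp_pos _)]
  refine le_trans ?_ (sum_tilted_lisLen_le (N := N) hp hsum hr hratio)
  rw [wordProb, Finset.sum_mul]
  refine Finset.sum_le_sum fun w _ => ?_
  have hpw : 0 ≤ ∏ j, p (w j) := Finset.prod_nonneg fun j _ => (hp _).le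
  by_cases hw : y ≤ (lisLen w : ℝ) - letterCount z w
  · rw [Set.indicator_of_mem (by exact hw)]
    refine mul_le_mul_of_nonneg_left ?_ hpw
    have h1 : r ^ lisLen w * r⁻¹ ^ letterCount z w =
        Real.exp (Real.log r * ((lisLen w : ℝ) - letterCount z w)) := by
      rw [← Real.rpow_def_of_pos hr0, Real.rpow_sub hr0, Real.rpow_natCast, Real.rpow_natCast,
        inv_pow, div_eq_mul_inv]
    rw [h1]
    exact Real.exp_le_exp.2 (mul_le_mul_of_nonneg_left hw (Real.log_nonneg hr.le))
  · rw [Set.indicator_of_notMem (by exact hw), zero_mul]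
    positivity

lemma tendsto_succ_pow_mul_exp_neg_sqrt (k : ℕ) {c : ℝ} (hc : 0 < c) :
    Tendsto (fun n : ℕ => ((n : ℝ) + 1) ^ k * Real.exp (-(c * √n))) atTop (nhds 0) := by
  have h1 : Tendsto (fun x : ℝ => x ^ (2 * k) / Real.exp (c * x)) atTop (nhds 0) :=
    (isLittleO_pow_exp_pos_mul_atTop (2 * k) hc).tendsto_div_nhds_zero
  have h2 : Tendsto (fun n : ℕ => √(n : ℝ)) atTop atTop :=
    Real.tendsto_sqrt_atTop.comp tendsto_natCast_atTop_atTop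
  have h3 := (h1.comp h2).const_mul ((2 : ℝ) ^ k)
  rw [mul_zero] at h3
  refine tendsto_of_tendsto_of_tendsto_of_le_of_le' tendsto_const_nhds h3
    (Eventually.of_forall fun n => by positivity) ?_
  filter_upwards [eventually_ge_atTop 1] with n hn
  have hn' : (1 : ℝ) ≤ n := by exact_mod_cast hn
  simp only [Function.comp]
  rw [pow_mul, Real.sq_sqrt (by positivity), Real.exp_neg, ← div_eq_mul_inv, ← mul_div_assoc,
    ← mul_pow]
  gcongr
  linarith

end ExponentialMoment

section InfiniteWords

open ProbabilityTheory

variable {k : ℕ} {p : Fin k → ℝ}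

/-- The law of a single letter: the letter `i` has mass `p i`. -/
def letterMeasure (p : Fin k → ℝ) : Measure (Fin k) :=
  ∑ i, ENNReal.ofReal (p i) • Measure.dirac i

/-- The law of an infinite sequence of i.i.d. letters. -/
def wordMeasure (p : Fin k → ℝ) : Measure (ℕ → Fin k) :=
  Measure.infinitePi fun _ => letterMeasure p

lemma letterMeasure_singleton (p : Fin k → ℝ) (i : Fin k) :
    letterMeasure p {i} = ENNReal.ofReal (p i) := by
  simp [letterMeasure, Set.indicator_apply]

lemma isProbabilityMeasure_letterMeasure (hp : ∀ i, 0 < p i) (hsum : ∑ i, p i = 1) :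
    IsProbabilityMeasure (letterMeasure p) := by
  constructor
  simp only [letterMeasure, Measure.coe_finsetSum, Finset.sum_apply, Measure.smul_apply,
    measure_univ, smul_eq_mul, mul_one]
  rw [← ENNReal.ofReal_sum_of_nonneg fun i _ => (hp i).le, hsum, ENNReal.ofReal_one]

variable [IsProbabilityMeasure (letterMeasure p)]

instance isProbabilityMeasure_wordMeasure : IsProbabilityMeasure (wordMeasure p) := by
  unfold wordMeasure
  infer_instance

lemma integral_letterMeasure (hp : ∀ i, 0 < p i) (f : Fin k → ℝ) :
    ∫ i, f i ∂(letterMeasure p) = ∑ i, p i * f i := by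
  rw [integral_fintype .of_finite]
  refine Finset.sum_congr rfl fun i _ => ?_
  rw [measureReal_def, letterMeasure_singleton, ENNReal.toReal_ofReal (hp i).le, smul_eq_mul]

lemma integral_wordMeasure_eval (hp : ∀ i, 0 < p i) (f : Fin k → ℝ) (n : ℕ) :
    ∫ ω, f (ω n) ∂(wordMeasure p) = ∑ i, p i * f i := by
  rw [← integral_letterMeasure hp, ← Measure.infinitePi_map_eval (fun _ => letterMeasure p) n,
    integral_map (measurable_pi_apply n).aemeasurable (measurable_of_finite f).aestronglyMeasurable]
  rfl

/-- The word formed by the first `N` letters of an infinite sequence. -/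
def wordPrefix (N : ℕ) (ω : ℕ → Fin k) : Fin N → Fin k := fun j => ω j

lemma measurable_wordPrefix (N : ℕ) : Measurable (wordPrefix (k := k) N) := by
  unfold wordPrefix
  fun_prop

lemma measureReal_wordPrefix_singleton (hp : ∀ i, 0 < p i) {N : ℕ} (w : Fin N → Fin k) :
    (wordMeasure p).real (wordPrefix N ⁻¹' {w}) = ∏ j, p (w j) := by
  have hmap : (wordMeasure p).map (wordPrefix N) = Measure.pi fun _ => letterMeasure p := by
    rw [← Measure.infinitePi_eq_pi]
    exact Measure.map_infinitePi_infinitePi_of_inj (P := fun _ : ℕ => letterMeasure p)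
      (Fin.val_injective (n := N))
  rw [measureReal_def, ← Measure.map_apply (measurable_wordPrefix N) (measurableSet_singleton w),
    hmap, Measure.pi_singleton, ENNReal.toReal_prod]
  simp [letterMeasure_singleton, ENNReal.toReal_ofReal (hp _).le]

lemma measureReal_wordPrefix_preimage (hp : ∀ i, 0 < p i) {N : ℕ} (E : Set (Fin N → Fin k)) :
    (wordMeasure p).real (wordPrefix N ⁻¹' E) = wordProb k N p E := by
  have hE : (E.toFinset : Set (Fin N → Fin k)) = E := Set.coe_toFinset E
  rw [← map_measureReal_apply (measurable_wordPrefix N) (Set.toFinite E).measurableSet]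
  conv_lhs => rw [← hE]
  rw [← sum_measureReal_singleton, wordProb, ← Finset.sum_indicator_subset _ E.toFinset.subset_univ]
  refine Finset.sum_congr rfl fun w _ => ?_
  simp only [map_measureReal_apply (measurable_wordPrefix N) (measurableSet_singleton _),
    measureReal_wordPrefix_singleton hp]
  simp [Set.indicator_apply]

lemma letterCount_wordPrefix (z : Fin k) (N : ℕ) (ω : ℕ → Fin k) :
    (letterCount z (wordPrefix N ω) : ℝ) = ∑ n ∈ Finset.range N, if ω n = z then (1 : ℝ) else 0 := by
  rw [letterCount, Finset.card_filter, Finset.sum_range]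
  push_cast
  rfl

lemma measureReal_gaussianReal_Iic (s : ℝ) :
    (gaussianReal 0 1).real (Set.Iic s) =
      (2 * Real.pi) ^ (-(1 : ℝ) / 2) * ∫ u in Set.Iic s, Real.exp (-u ^ 2 / 2) := by
  rw [measureReal_def, gaussianReal_apply_eq_integral 0 one_ne_zero, ENNReal.toReal_ofReal
    (integral_nonneg fun _ => gaussianPDFReal_nonneg _ _ _), ← integral_const_mul]
  congr 1 with u
  have hsqrt : (√(2 * Real.pi))⁻¹ = (2 * Real.pi) ^ (-(1 : ℝ) / 2) := by
    rw [Real.sqrt_eq_rpow, ← Real.rpow_neg (by positivity), neg_div]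
  simp [gaussianPDFReal_def, ← hsqrt]

/-- Central limit theorem for the number of occurrences of the letter `z`. -/
lemma tendstoInDistribution_letterCount (hp : ∀ i, 0 < p i) (hsum : ∑ i, p i = 1) (z : Fin k)
    (hz : p z < 1) :
    TendstoInDistribution
      (fun (N : ℕ) ω => ((letterCount z (wordPrefix N ω) : ℝ) - N * p z) / √(N * (p z * (1 - p z))))
      atTop id (fun _ => wordMeasure p) (gaussianReal 0 1) := by
  set v : ℝ := p z * (1 - p z) with hv
  have hv0 : 0 < v := mul_pos (hp z) (by linarith)
  let f : Fin k → ℝ := fun i => ((if i = z then 1 else 0) - p z) / √v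
  have hf1 : ∑ i, p i * f i = 0 := by
    simp only [f, mul_div_assoc', ← Finset.sum_div, mul_sub, Finset.sum_sub_distrib, ← Finset.sum_mul,
      hsum]
    simp
  have hf2 : ∑ i, p i * f i ^ 2 = 1 := by
    have h : ∀ i, p i * f i ^ 2 =
        ((if i = z then p z * (1 - 2 * p z) else 0) + p i * p z ^ 2) / v := by
      intro i
      simp only [f, div_pow, Real.sq_sqrt hv0.le]
      by_cases hi : i = z
      · subst hi
        simp only [if_true]
        ring
      · simp only [hi, if_false]
        ring
    simp_rw [h, ← Finset.sum_div, Finset.sum_add_distrib, ← Finset.sum_mul, hsum]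
    rw [Finset.sum_ite_eq', if_pos (Finset.mem_univ _), div_eq_one_iff_eq hv0.ne', hv]
    ring
  have hident : ∀ n, IdentDistrib (fun ω : ℕ → Fin k => ω n) (fun ω => ω 0)
      (wordMeasure p) (wordMeasure p) := fun n =>
    ⟨(measurable_pi_apply n).aemeasurable, (measurable_pi_apply 0).aemeasurable, by
      simp only [wordMeasure, Measure.infinitePi_map_eval]⟩
  have hX := tendstoInDistribution_inv_sqrt_mul_sum (P := wordMeasure p)
    (X := fun n ω => f (ω n)) (Y := id) (P' := gaussianReal 0 1) HasLaw.id
    ((integral_wordMeasure_eval hp f 0).trans hf1)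
    ((integral_wordMeasure_eval hp (fun i => f i ^ 2) 0).trans hf2)
    (iIndepFun_infinitePi fun _ => measurable_of_finite f)
    (fun n => (hident n).comp (measurable_of_finite f))
  convert hX using 3 with N ω
  rw [letterCount_wordPrefix, ← Finset.sum_div, Finset.sum_sub_distrib, Real.sqrt_mul N.cast_nonneg]
  simp
  field_simp

lemma tendstoInMeasure_excess (hp : ∀ i, 0 < p i) (hsum : ∑ i, p i = 1) {z : Fin k}
    (hz : p z < 1) (hmax : ∀ i, i ≠ z → p i < p z) :
    TendstoInMeasure (wordMeasure p)
      (fun (N : ℕ) ω => ((lisLen (wordPrefix N ω) : ℝ) - letterCount z (wordPrefix N ω)) /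
        √(N * (p z * (1 - p z)))) atTop (fun _ => 0) := by
  obtain ⟨r, hr, hratio⟩ := exists_ratio_gt_one hmax
  have hv0 : 0 < p z * (1 - p z) := mul_pos (hp z) (by linarith)
  rw [tendstoInMeasure_iff_measureReal_norm]
  intro ε hε
  have hlim := tendsto_succ_pow_mul_exp_neg_sqrt k
    (mul_pos (Real.log_pos hr) (mul_pos hε (Real.sqrt_pos.2 hv0)))
  refine tendsto_of_tendsto_of_tendsto_of_le_of_le' tendsto_const_nhds hlim
    (Eventually.of_forall fun _ => measureReal_nonneg) ?_
  filter_upwards [eventually_ge_atTop 1] with N hN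
  have hN0 : (0 : ℝ) < N := by exact_mod_cast hN
  have hbound := wordProb_excess_le (N := N) hp hsum hr hratio (ε * √(N * (p z * (1 - p z))))
  rw [← measureReal_wordPrefix_preimage hp] at hbound
  refine le_trans (measureReal_mono fun ω hω => ?_) (hbound.trans_eq ?_)
  · have hpos : 0 < √(N * (p z * (1 - p z))) := Real.sqrt_pos.2 (mul_pos hN0 hv0)
    have hle : (letterCount z (wordPrefix N ω) : ℝ) ≤ lisLen (wordPrefix N ω) :=
      Nat.cast_le.2 (letterCount_le_lisLen z _)
    simp only [Set.mem_ofPred_eq, sub_zero, Real.norm_eq_abs] at hω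
    rw [abs_of_nonneg (div_nonneg (by linarith) hpos.le), le_div_iff₀ hpos] at hω
    exact hω
  · rw [Real.sqrt_mul hN0.le]
    ring_nf

lemma tendsto_wordProb_lisLen (hp : ∀ i, 0 < p i) (hsum : ∑ i, p i = 1) {z : Fin k}
    (hz : p z < 1) (hmax : ∀ i, i ≠ z → p i < p z) (s : ℝ) :
    Tendsto
      (fun N : ℕ => wordProb k N p
        {w | (lisLen w : ℝ) ≤ N * p z + s * √(N * (p z * (1 - p z)))})
      atTop (nhds ((gaussianReal 0 1).real (Set.Iic s))) := by
  have hv0 : 0 < p z * (1 - p z) := mul_pos (hp z) (by linarith)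
  have hmeas : ∀ N, Measurable fun ω : ℕ → Fin k =>
      ((lisLen (wordPrefix N ω) : ℝ) - letterCount z (wordPrefix N ω)) /
        √(N * (p z * (1 - p z))) := fun N =>
    (measurable_of_finite fun w : Fin N → Fin k =>
      ((lisLen w : ℝ) - letterCount z w) / √(N * (p z * (1 - p z)))).comp (measurable_wordPrefix N)
  have hdist := (tendstoInDistribution_letterCount hp hsum z hz).add_of_tendstoInMeasure_const
    (tendstoInMeasure_excess hp hsum hz hmax) fun N => (hmeas N).aemeasurable
  have hnull : (gaussianReal 0 1) (frontier (Set.Iic s)) = 0 := by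
    have := nullSingletonClass_gaussianReal (μ := 0) (v := 1) one_ne_zero
    simp
  have hport := ProbabilityMeasure.tendsto_measure_of_null_frontier_of_tendsto' hdist.tendsto
    (E := Set.Iic s)
    (by simpa only [ProbabilityMeasure.coe_mk, add_zero, id_eq, Measure.map_id'] using hnull)
  simp only [ProbabilityMeasure.coe_mk, add_zero, id_eq, Measure.map_id'] at hport
  have hreal := (ENNReal.tendsto_toReal (measure_ne_top _ _)).comp hport
  refine hreal.congr' ?_
  filter_upwards [eventually_ge_atTop 1] with N hN
  have hpos : 0 < √(N * (p z * (1 - p z))) :=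
    Real.sqrt_pos.2 (mul_pos (by exact_mod_cast hN) hv0)
  rw [Function.comp, Measure.map_apply_of_aemeasurable (hdist.forall_aemeasurable N)
    measurableSet_Iic, ← measureReal_def, ← measureReal_wordPrefix_preimage hp]
  congr 1
  ext ω
  simp only [Set.mem_preimage, Set.mem_Iic, Pi.add_apply, Set.mem_ofPred_eq]
  rw [← add_div, div_le_iff₀ hpos, sub_add_sub_cancel', sub_le_iff_le_add']

end InfiniteWords

/-- If one letter occurs with strictly greater probability than all
others, then `(ℓ_N - Np₁)/√N` converges in distribution to a centered Gaussian with
variance `p₁(1-p₁)`: for every real `s`,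
`Prob(ℓ_N ≤ Np₁ + s√(Np₁(1-p₁))) → (2π)^{-1/2} ∫_{-∞}^s e^{-u²/2} du`. -/
theorem random_words_gaussian_limit
    (k : ℕ) (hk : 2 ≤ k) (p : Fin k → ℝ)
    (hp : ∀ i, 0 < p i ∧ p i < 1) (hsum : ∑ i, p i = 1)
    (hmax : ∀ i : Fin k, i ≠ ⟨0, by omega⟩ → p i < p ⟨0, by omega⟩) (s : ℝ) :
    Tendsto
      (fun N : ℕ => wordProb k N p
        {w | (lisLen w : ℝ) ≤ N * p ⟨0, by omega⟩ +
              s * Real.sqrt (N * (p ⟨0, by omega⟩ * (1 - p ⟨0, by omega⟩)))})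
      atTop
      (nhds ((2 * Real.pi) ^ (-(1 : ℝ) / 2) *
        ∫ u in Set.Iic s, Real.exp (-u ^ 2 / 2))) := by
  rw [← measureReal_gaussianReal_Iic]
  have := isProbabilityMeasure_letterMeasure (fun i => (hp i).1) hsum
  exact tendsto_wordProb_lisLen (fun i => (hp i).1) hsum (hp _).2 hmax s

end
end
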